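/- Let G be a 2-edge-connected cubic (3-regular) finite simple graph. Let 𝒪 be a set of pairwise edge-disjoint cycles of G such that for every 2-edge-cut {e, f} of G, all cycles of 𝒪 are subgraphs of the same connected component of G − {e, f}. Then there exists a perfect matching (1-factor) F of G such that E(F) ∩ E(O) ≠ ∅ for every O ∈ 𝒪. -/

import Mathlib

open SimpleGraph

namespace PaperFormalization

variable {V : Type*}

/-- The degree of a vertex in a subgraph. -/
noncomputable def sdeg {G : SimpleGraph V} (H : G.Subgraph) (v : V) : ℕ :=
  (H.neighborSet v).ncard

/-- `H` is a `t`-factor of `G`: a spanning subgraph in which every vertex has degree `t`. -/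
def IsTFactor {G : SimpleGraph V} (H : G.Subgraph) (t : ℕ) : Prop :=
  H.IsSpanning ∧ ∀ v : V, sdeg H v = t

/-- A cycle of `G`: a connected 2-regular subgraph. -/
def IsCycleSG {G : SimpleGraph V} (C : G.Subgraph) : Prop :=
  C.Connected ∧ ∀ v ∈ C.verts, sdeg C v = 2

/-- An odd cycle: a cycle with an odd number of edges. -/
def IsOddCycleSG {G : SimpleGraph V} (C : G.Subgraph) : Prop :=
  IsCycleSG C ∧ Odd C.edgeSet.ncard

/-- A family of subgraphs is pairwise edge-disjoint. -/
def PairwiseEdgeDisjoint {G : SimpleGraph V} (𝒪 : Set G.Subgraph) : Prop :=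
  𝒪.Pairwise fun O₁ O₂ => Disjoint O₁.edgeSet O₂.edgeSet

/-- A family of subgraphs is pairwise vertex-disjoint. -/
def PairwiseVertexDisjoint {G : SimpleGraph V} (𝒪 : Set G.Subgraph) : Prop :=
  𝒪.Pairwise fun O₁ O₂ => Disjoint O₁.verts O₂.verts

/-- `G` is `r`-regular. -/
def IsRegular (G : SimpleGraph V) (r : ℕ) : Prop :=
  ∀ v : V, (G.neighborSet v).ncard = r

/-- `G` is 2-connected: connected, at least 3 vertices, and no cut vertex. -/
def TwoConnected [Fintype V] (G : SimpleGraph V) : Prop :=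
  G.Connected ∧ 3 ≤ Fintype.card V ∧ ∀ v : V, (G.induce {u | u ≠ v}).Connected

/-- `G` is `r`-connected: more than `r` vertices and deleting fewer than `r`
vertices leaves it connected. -/
def KConnected [Fintype V] (r : ℕ) (G : SimpleGraph V) : Prop :=
  r < Fintype.card V ∧ ∀ S : Set V, S.ncard < r → (G.induce Sᶜ).Connected

/-- A set of edges is a matching: pairwise non-adjacent edges. -/
def IsMatchingSet (M : Set (Sym2 V)) : Prop :=
  M.Pairwise fun e f => ∀ v : V, v ∈ e → v ∉ f

/-- `G` is 2-edge-connected: connected and removing any single edge keeps it connected. -/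
def TwoEdgeConnected {W : Type*} (G : SimpleGraph W) : Prop :=
  G.Connected ∧ ∀ e ∈ G.edgeSet, (G.deleteEdges {e}).Connected

section
open Finset

set_option linter.unusedSectionVars false

/-- A finite cubic multigraph: the vertices are those of `K`, the darts at a vertex `v` are the
`d` with `vt d = v`, and `σ` reverses darts. -/
structure IsCubic {W D : Type*} [DecidableEq W] [Fintype D] (vt : D → W) (K : Finset W)
    (σ : D → D) : Prop where
  mem : ∀ d, vt d ∈ K → vt (σ d) ∈ K
  inv : ∀ d, vt d ∈ K → σ (σ d) = d
  ne : ∀ d, vt d ∈ K → σ d ≠ d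
  deg : ∀ v ∈ K, #{d | vt d = v} = 3

/-- The darts leaving `X`. -/
def dcut {W D : Type*} [DecidableEq W] [Fintype D] (vt : D → W) (σ : D → D) (X : Finset W) :
    Finset D :=
  {d | vt d ∈ X ∧ vt (σ d) ∉ X}

/-- A symmetric set of darts which induces a 2-regular graph on the vertices it covers. -/
structure IsTwoReg {W D : Type*} [DecidableEq W] [DecidableEq D] [Fintype D] (vt : D → W)
    (K : Finset W) (σ : D → D) (S : Finset D) : Prop where
  symm : ∀ d ∈ S, vt d ∈ K → σ d ∈ S
  deg : ∀ d ∈ S, vt d ∈ K → #{e ∈ S | vt e = vt d} = 2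

/-- A union of components of the graph formed by `S`. -/
structure SClosed {W D : Type*} (vt : D → W) (K : Finset W) (σ : D → D) (S : Finset D)
    (C : Finset W) : Prop where
  sub : C ⊆ K
  on : ∀ v ∈ C, ∃ d ∈ S, vt d = v
  closed : ∀ d ∈ S, vt d ∈ C → vt (σ d) ∈ C

/-- A component of the graph formed by `S`. -/
structure IsComp {W D : Type*} (vt : D → W) (K : Finset W) (σ : D → D) (S : Finset D)
    (C : Finset W) : Prop extends SClosed vt K σ S C where
  nonempty : C.Nonempty
  min : ∀ T ⊆ C, T.Nonempty → SClosed vt K σ S T → T = C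

/-- A perfect matching, as a symmetric set of darts. -/
structure IsPM {W D : Type*} (vt : D → W) (K : Finset W) (σ : D → D) (F : Set D) : Prop where
  ex : ∀ v ∈ K, ∃ d ∈ F, vt d = v
  uniq : ∀ d ∈ F, ∀ e ∈ F, vt d ∈ K → vt d = vt e → d = e
  symm : ∀ d ∈ F, vt d ∈ K → σ d ∈ F

/-- Every proper cut has at least `k` edges. -/
def CutGe {W D : Type*} [DecidableEq W] [Fintype D] (vt : D → W) (K : Finset W) (σ : D → D)
    (k : ℕ) : Prop :=
  ∀ X ⊆ K, X.Nonempty → X ≠ K → k ≤ #(dcut vt σ X)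

/-- Every cut with at least two vertices on both sides has at least four edges. -/
def CutGeFour {W D : Type*} [DecidableEq W] [Fintype D] (vt : D → W) (K : Finset W) (σ : D → D) :
    Prop :=
  ∀ X ⊆ K, 2 ≤ #X → 2 ≤ #(K \ X) → 4 ≤ #(dcut vt σ X)

section
variable {W D : Type*} [DecidableEq W] [DecidableEq D] [Fintype D] {vt : D → W}
  {K : Finset W} {σ : D → D} {S : Finset D}

theorem even_card_of_involution {s : Finset D} (f : D → D) (h1 : ∀ d ∈ s, f d ∈ s)
    (h2 : ∀ d ∈ s, f (f d) = d) (h3 : ∀ d ∈ s, f d ≠ d) : Even #s := by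
  have h : ∑ _x ∈ s, (1 : ZMod 2) = 0 :=
    Finset.sum_involution (fun d _ => f d) (fun _ _ => by decide) (fun d hd _ => h3 d hd)
      (fun d hd => h1 d hd) (fun d hd => h2 d hd)
  rw [Finset.sum_const, nsmul_one] at h
  exact (ZMod.natCast_eq_zero_iff_even).1 h

theorem mem_dcut {X : Finset W} {d : D} : d ∈ dcut vt σ X ↔ vt d ∈ X ∧ vt (σ d) ∉ X := by
  simp [dcut]

theorem card_dcut_compl (hc : IsCubic vt K σ) {X : Finset W} (hX : X ⊆ K) :
    #(dcut vt σ (K \ X)) = #(dcut vt σ X) := by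
  apply Finset.card_nbij' σ σ
  · intro d hd
    simp only [mem_coe, mem_dcut, mem_sdiff] at hd ⊢
    have := hc.inv d hd.1.1
    have := hc.mem d hd.1.1
    grind
  · intro d hd
    simp only [mem_coe, mem_dcut, mem_sdiff] at hd ⊢
    have := hc.inv d (hX hd.1)
    have := hc.mem d (hX hd.1)
    grind
  · intro d hd
    simp only [mem_coe, mem_dcut, mem_sdiff] at hd
    exact hc.inv d hd.1.1
  · intro d hd
    simp only [mem_coe, mem_dcut] at hd
    exact hc.inv d (hX hd.1)

theorem even_card_inside (hc : IsCubic vt K σ) {X : Finset W} (hX : X ⊆ K)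
    (hs : ∀ d ∈ S, vt d ∈ K → σ d ∈ S) : Even #{d ∈ S | vt d ∈ X ∧ vt (σ d) ∈ X} := by
  apply even_card_of_involution σ
  · intro d hd
    simp only [mem_filter] at hd ⊢
    have := hc.inv d (hX hd.2.1)
    have := hs d hd.1 (hX hd.2.1)
    grind
  · intro d hd
    simp only [mem_filter] at hd
    exact hc.inv d (hX hd.2.1)
  · intro d hd
    simp only [mem_filter] at hd
    exact hc.ne d (hX hd.2.1)

theorem even_card_inter_dcut (hc : IsCubic vt K σ) (hS : IsTwoReg vt K σ S) {X : Finset W}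
    (hX : X ⊆ K) : Even #(S ∩ dcut vt σ X) := by
  have h1 : Even #{d ∈ S | vt d ∈ X} := by
    have : #{d ∈ S | vt d ∈ X} = ∑ v ∈ X, #{d ∈ {d ∈ S | vt d ∈ X} | vt d = v} :=
      Finset.card_eq_sum_card_fiberwise (fun d hd => by simpa using (by simpa using hd : _ ∧ _).2)
    rw [this]
    apply Finset.even_sum
    intro v hv
    have e : {d ∈ {d ∈ S | vt d ∈ X} | vt d = v} = {d ∈ S | vt d = v} := by
      ext d; simp only [mem_filter]; grind
    rw [e]
    by_cases hd : ∃ d ∈ S, vt d = v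
    · obtain ⟨d, hd, rfl⟩ := hd
      rw [hS.deg d hd (hX hv)]; decide
    · have : {d ∈ S | vt d = v} = ∅ := by
        ext d; simp only [mem_filter]; grind
      rw [this]; simp
  have h2 := even_card_inside (S := S) hc hX hS.symm
  have h3 : #{d ∈ S | vt d ∈ X} = #{d ∈ S | vt d ∈ X ∧ vt (σ d) ∈ X} + #(S ∩ dcut vt σ X) := by
    rw [← Finset.card_union_of_disjoint]
    · congr 1; ext d; simp only [mem_filter, mem_union, mem_inter, mem_dcut]; grind
    · rw [Finset.disjoint_left]; intro d; simp only [mem_filter, mem_inter, mem_dcut]; grind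
  rw [h3] at h1
  exact (Nat.even_add.1 h1).1 h2

theorem even_card_add_dcut (hc : IsCubic vt K σ) {X : Finset W}
    (hX : X ⊆ K) : Even (#X + #(dcut vt σ X)) := by
  have h1 : #({d | vt d ∈ X} : Finset D) = 3 * #X := by
    rw [Finset.card_eq_sum_card_fiberwise (f := vt) (t := X) (fun d hd => by simpa using hd)]
    rw [Finset.sum_congr rfl (g := fun _ => 3)]
    · simp [mul_comm]
    · intro v hv
      rw [← hc.deg v (hX hv)]
      congr 1
      ext d; simp only [mem_filter, mem_univ]; grind
  have h2 := even_card_inside (S := univ) hc hX (by simp)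
  have h3 : #({d | vt d ∈ X} : Finset D) = #{d ∈ univ | vt d ∈ X ∧ vt (σ d) ∈ X}
      + #(dcut vt σ X) := by
    rw [← Finset.card_union_of_disjoint]
    · congr 1; ext d; simp only [mem_filter, mem_union, mem_dcut]; grind
    · rw [Finset.disjoint_left]; intro d; simp only [mem_filter, mem_dcut]; grind
  rw [Nat.even_iff] at *
  omega

theorem dcut_self (hc : IsCubic vt K σ) : dcut vt σ K = ∅ := by
  ext d
  simp only [mem_dcut, notMem_empty, iff_false]
  have := hc.mem d
  grind

theorem IsCubic.even (hc : IsCubic vt K σ) : Even #K := by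
  have := even_card_add_dcut hc (subset_refl K)
  rw [dcut_self hc] at this
  simpa using this

theorem IsCubic.exists_three (hc : IsCubic vt K σ) {d : D} (hd : vt d ∈ K) :
    ∃ a b, a ≠ d ∧ b ≠ d ∧ a ≠ b ∧ vt a = vt d ∧ vt b = vt d ∧
      ∀ x, vt x = vt d → x = d ∨ x = a ∨ x = b := by
  have h := hc.deg _ hd
  have hm : d ∈ ({e | vt e = vt d} : Finset D) := by simp
  have h2 : #(({e | vt e = vt d} : Finset D).erase d) = 2 := by
    rw [Finset.card_erase_of_mem hm, h]
  obtain ⟨a, b, hab, he⟩ := Finset.card_eq_two.1 h2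
  have ha : ∀ x, x ∈ (({e | vt e = vt d} : Finset D).erase d) ↔ x = a ∨ x = b := by
    rw [he]; simp
  simp only [mem_erase, mem_filter, mem_univ, true_and] at ha
  have h1 := (ha a).2 (Or.inl rfl)
  have h2 := (ha b).2 (Or.inr rfl)
  refine ⟨a, b, h1.1, h2.1, hab, h1.2, h2.2, fun x hx => ?_⟩
  by_cases h : x = d
  · exact Or.inl h
  · exact Or.inr ((ha x).1 ⟨h, hx⟩)

theorem IsCubic.exists_dart (hc : IsCubic vt K σ) {v : W} (hv : v ∈ K) : ∃ d, vt d = v := by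
  have h := hc.deg _ hv
  have : ({d | vt d = v} : Finset D).Nonempty := by
    rw [← Finset.card_pos]; omega
  obtain ⟨d, hd⟩ := this
  exact ⟨d, by simpa using hd⟩

theorem IsTwoReg.exists_of_mem (hc : IsCubic vt K σ) (hS : IsTwoReg vt K σ S) {d : D}
    (hd : vt d ∈ K) (hdS : d ∈ S) :
    ∃ a z, a ≠ d ∧ z ≠ d ∧ a ≠ z ∧ vt a = vt d ∧ vt z = vt d ∧ a ∈ S ∧ z ∉ S ∧
      ∀ x, vt x = vt d → x = d ∨ x = a ∨ x = z := by
  obtain ⟨a, b, h1, h2, h3, h4, h5, h6⟩ := hc.exists_three hd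
  have h := hS.deg d hdS hd
  by_cases ha : a ∈ S <;> by_cases hb : b ∈ S
  · exfalso
    have : {e ∈ S | vt e = vt d} = {d, a, b} := by
      ext x; simp only [mem_filter, mem_insert, mem_singleton]; grind
    rw [this, Finset.card_eq_three.2 ⟨d, a, b, h1.symm, h2.symm, h3, rfl⟩] at h
    omega
  · exact ⟨a, b, h1, h2, h3, h4, h5, ha, hb, h6⟩
  · exact ⟨b, a, h2, h1, h3.symm, h5, h4, hb, ha, fun x hx => by have := h6 x hx; tauto⟩
  · exfalso
    have : {e ∈ S | vt e = vt d} = {d} := by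
      ext x; simp only [mem_filter, mem_singleton]; grind
    rw [this] at h
    simp at h

theorem IsTwoReg.exists_of_notMem (hc : IsCubic vt K σ) (hS : IsTwoReg vt K σ S) {d : D}
    (hd : vt d ∈ K) (hdS : d ∉ S) (ho : ∃ e ∈ S, vt e = vt d) :
    ∃ a b, a ≠ d ∧ b ≠ d ∧ a ≠ b ∧ vt a = vt d ∧ vt b = vt d ∧ a ∈ S ∧ b ∈ S ∧
      ∀ x, vt x = vt d → x = d ∨ x = a ∨ x = b := by
  obtain ⟨e, he, hed⟩ := ho
  obtain ⟨a, z, h1, h2, h3, h4, h5, h6, h7, h8⟩ := hS.exists_of_mem hc (by rwa [hed]) he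
  have : d = z := by grind
  subst this
  exact ⟨e, a, by grind, by grind, by grind, by grind, by grind, he, h6, by grind⟩

theorem SClosed.inter {A B : Finset W} (hA : SClosed vt K σ S A) (hB : SClosed vt K σ S B) :
    SClosed vt K σ S (A ∩ B) :=
  ⟨fun v hv => hA.sub (by grind), fun v hv => hA.on v (by grind), fun d hd h => by
    have := hA.closed d hd
    have := hB.closed d hd
    grind⟩

theorem SClosed.sdiff (hc : IsCubic vt K σ) (hS : IsTwoReg vt K σ S) {A B : Finset W}
    (hA : SClosed vt K σ S A) (hB : SClosed vt K σ S B) :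
    SClosed vt K σ S (A \ B) :=
  ⟨fun v hv => hA.sub (by grind), fun v hv => hA.on v (by grind), fun d hd h => by
    have h1 := hA.closed d hd (by grind)
    have hK : vt d ∈ K := hA.sub (by grind)
    have h2 := hB.closed (σ d) (hS.symm d hd hK)
    rw [hc.inv d hK] at h2
    grind⟩

theorem SClosed.exists_comp {A : Finset W} (hA : SClosed vt K σ S A) (hne : A.Nonempty) :
    ∃ C ⊆ A, IsComp vt K σ S C := by
  induction hn : #A using Nat.strong_induction_on generalizing A with
  | _ n ih =>
    by_cases h : ∃ T ⊆ A, T.Nonempty ∧ SClosed vt K σ S T ∧ T ≠ A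
    · obtain ⟨T, hT, hTn, hTc, hTA⟩ := h
      obtain ⟨C, hC, h⟩ := ih #T (hn ▸ Finset.card_lt_card (hT.ssubset_of_ne hTA)) hTc hTn rfl
      exact ⟨C, hC.trans hT, h⟩
    · push Not at h
      exact ⟨A, subset_refl _, ⟨hA, hne, fun T h1 h2 h3 => h T h1 h2 h3⟩⟩

theorem IsComp.subset_or_disjoint
    {C A : Finset W} (hC : IsComp vt K σ S C) (hA : SClosed vt K σ S A) :
    C ⊆ A ∨ Disjoint C A := by
  by_cases h : (C ∩ A).Nonempty
  · left
    have := hC.min _ (by simp) h (hC.toSClosed.inter hA)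
    intro v hv
    rw [← this] at hv
    grind
  · right
    rwa [Finset.not_nonempty_iff_eq_empty, ← Finset.disjoint_iff_inter_eq_empty] at h

theorem IsComp.eq_of_mem {C C' : Finset W} (hC : IsComp vt K σ S C)
    (hC' : IsComp vt K σ S C') {v : W}
    (h : v ∈ C) (h' : v ∈ C') : C = C' := by
  rcases hC.subset_or_disjoint hC'.toSClosed with h1 | h1
  · exact hC'.min _ h1 hC.nonempty hC.toSClosed
  · exact absurd h' (Finset.disjoint_left.1 h1 h)

theorem IsTwoReg.sclosed_all (hc : IsCubic vt K σ) (hS : IsTwoReg vt K σ S) :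
    SClosed vt K σ S {v ∈ K | ∃ d ∈ S, vt d = v} :=
  ⟨by simp, by simp, fun d hd h => by
    simp only [mem_filter] at h ⊢
    exact ⟨hc.mem d h.1, σ d, hS.symm d hd h.1, rfl⟩⟩

theorem IsTwoReg.exists_comp (hc : IsCubic vt K σ) (hS : IsTwoReg vt K σ S)
    {d : D} (hd : d ∈ S) (hK : vt d ∈ K) : ∃ C, IsComp vt K σ S C ∧ vt d ∈ C := by
  have key : ∀ n, ∀ A, #A = n → SClosed vt K σ S A → vt d ∈ A →
      ∃ C, IsComp vt K σ S C ∧ vt d ∈ C := by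
    intro n
    induction n using Nat.strong_induction_on with
    | _ n ih =>
      intro A hn hA hd
      obtain ⟨C, hCA, hC⟩ := hA.exists_comp ⟨_, hd⟩
      by_cases h : vt d ∈ C
      · exact ⟨C, hC, h⟩
      · refine ih #(A \ C) ?_ (A \ C) rfl (hA.sdiff hc hS hC.toSClosed) (by grind)
        rw [← hn]
        apply Finset.card_lt_card
        obtain ⟨v, hv⟩ := hC.nonempty
        refine ⟨sdiff_subset, fun h => ?_⟩
        have := h (hCA hv)
        grind
  exact key _ _ rfl (hS.sclosed_all hc) (by simp only [mem_filter]; exact ⟨hK, d, hd, rfl⟩)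

end

/-- The hypotheses under which a perfect matching through the dart `h` meeting all components of
`S` is sought. -/
structure Inst {W D : Type*} [DecidableEq W] [DecidableEq D] [Fintype D] (vt : D → W)
    (K : Finset W) (σ : D → D) (S : Finset D) (h : D) : Prop where
  cub : IsCubic vt K σ
  cut : CutGe vt K σ 2
  reg : IsTwoReg vt K σ S
  mem : vt h ∈ K
  notMem : h ∉ S
  c1 : ∀ C, IsComp vt K σ S C → vt h ∈ C → vt (σ h) ∉ C
  c2 : ∀ C, IsComp vt K σ S C → ∀ Y ⊆ K, vt h ∈ Y ∨ vt (σ h) ∈ Y → Disjoint Y C →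
    (∀ d ∈ dcut vt σ Y, vt (σ d) ∈ C) → 3 ≤ #(dcut vt σ Y)

/-- There is a perfect matching through the dart `h` meeting all components of `S`. -/
def Good {W D : Type*} (vt : D → W) (K : Finset W) (σ : D → D) (S : Finset D) (h : D) : Prop :=
  ∃ F : Set D, IsPM vt K σ F ∧ h ∈ F ∧ ∀ C, IsComp vt K σ S C → ∃ d ∈ F, d ∈ S ∧ vt d ∈ C

/-- `σ'` arises from `σ` by deleting the vertices of `R` and reconnecting the loose ends. -/
structure Removal {W D : Type*} [DecidableEq W] [Fintype D] (vt : D → W)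
    (K : Finset W) (σ : D → D) (R : Finset W) (σ' : D → D) : Prop where
  cub : IsCubic vt (K \ R) σ'
  agree : ∀ d, vt d ∈ K → vt d ∉ R → vt (σ d) ∉ R → σ' d = σ d

section
variable {W D : Type*} [DecidableEq W] [DecidableEq D] [Fintype D] {vt : D → W}
  {K R : Finset W} {σ σ' : D → D} {S : Finset D} {h : D}

theorem Inst.notMem_symm (hI : Inst vt K σ S h) : σ h ∉ S := fun hs => hI.notMem (by
  have := hI.reg.symm _ hs (hI.cub.mem _ hI.mem)
  rwa [hI.cub.inv _ hI.mem] at this)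

theorem Inst.swap (hI : Inst vt K σ S h) : Inst vt K σ S (σ h) where
  cub := hI.cub
  cut := hI.cut
  reg := hI.reg
  mem := hI.cub.mem _ hI.mem
  notMem := hI.notMem_symm
  c1 C hC h1 h2 := by
    rw [hI.cub.inv _ hI.mem] at h2
    exact hI.c1 C hC h2 h1
  c2 C hC Y hY h1 := by
    rw [hI.cub.inv _ hI.mem] at h1
    exact hI.c2 C hC Y hY h1.symm

theorem Good.of_swap (hc : IsCubic vt K σ) (hK : vt h ∈ K) (hG : Good vt K σ S (σ h)) :
    Good vt K σ S h := by
  obtain ⟨F, hF, hh, hC⟩ := hG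
  refine ⟨F, hF, ?_, hC⟩
  have := hF.symm _ hh (hc.mem _ hK)
  rwa [hc.inv _ hK] at this

theorem Removal.loose (hc : IsCubic vt K σ) (hr : Removal vt K σ R σ') {d : D} (hd : vt d ∈ K)
    (hdR : vt d ∉ R) (hσ : vt (σ d) ∈ R) :
    vt (σ' d) ∈ K ∧ vt (σ' d) ∉ R ∧ vt (σ (σ' d)) ∈ R ∧ σ' (σ' d) = d ∧ σ' d ≠ d := by
  have h1 := hr.cub.mem d (by grind)
  have h2 := hr.cub.inv d (by grind)
  have h3 := hr.cub.ne d (by grind)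
  refine ⟨by grind, by grind, ?_, h2, h3⟩
  by_contra h4
  have h5 := hr.agree (σ' d) (by grind) (by grind) h4
  rw [h2] at h5
  have := hc.inv (σ' d) (by grind)
  grind

theorem Removal.dcut_eq (hr : Removal vt K σ R σ') {Y : Finset W}
    (hY : Y ⊆ K \ R) (hp : ∀ d, vt d ∈ Y → vt (σ d) ∈ R → vt (σ' d) ∉ Y) :
    dcut vt σ' Y = dcut vt σ Y := by
  ext d
  simp only [mem_dcut]
  by_cases hd : vt d ∈ Y
  · have := hY hd
    by_cases h2 : vt (σ d) ∈ R
    · have := hp d hd h2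
      have : vt (σ d) ∉ Y := fun h => by have := hY h; grind
      tauto
    · rw [hr.agree d (by grind) (by grind) h2]
  · tauto

theorem Removal.card_dcut_union (hc : IsCubic vt K σ) (hr : Removal vt K σ R σ') (hR : R ⊆ K)
    {Y : Finset W} (hY : Y ⊆ K \ R)
    (hp : ∀ d, vt d ∈ K → vt d ∉ R → vt (σ d) ∈ R → vt d ∈ Y ∨ vt (σ' d) ∈ Y) :
    #(dcut vt σ' Y) = #(dcut vt σ (Y ∪ R)) := by
  rw [← card_dcut_compl hr.cub hY, hr.dcut_eq sdiff_subset,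
    ← card_dcut_compl hc (X := Y ∪ R) (by grind)]
  · congr 2; grind
  · intro d hd h2
    have := hp d (by grind) (by grind) h2
    grind

theorem exists_removal (hc : IsCubic vt K σ) (τ : D → D)
    (hτ : ∀ d, vt d ∈ K → vt d ∉ R → vt (σ d) ∈ R →
      vt (τ d) ∈ K ∧ vt (τ d) ∉ R ∧ vt (σ (τ d)) ∈ R ∧ τ (τ d) = d ∧ τ d ≠ d) :
    Removal vt K σ R (fun d => if vt (σ d) ∈ R then τ d else σ d) := by
  refine ⟨⟨?_, ?_, ?_, ?_⟩, ?_⟩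
  · intro d hd
    have := hτ d
    have := hc.mem d
    grind
  · intro d hd
    have := hτ d
    have := hc.mem d
    have := hc.inv d
    grind
  · intro d hd
    have := hτ d
    have := hc.ne d
    grind
  · intro v hv
    exact hc.deg v (by grind)
  · intro d _ _ h3
    simp [h3]

theorem exists_removal_one (hc : IsCubic vt K σ) (hR : R ⊆ K) {a b : D} (hab : a ≠ b)
    (ha : vt a ∈ R) (hb : vt b ∈ R) (ha' : vt (σ a) ∉ R) (hb' : vt (σ b) ∉ R)
    (hall : ∀ x, vt x ∈ R → vt (σ x) ∉ R → x = a ∨ x = b) :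
    ∃ σ', Removal vt K σ R σ' ∧ σ' (σ a) = σ b ∧ σ' (σ b) = σ a := by
  have ia := hc.inv a (hR ha)
  have ib := hc.inv b (hR hb)
  have ma := hc.mem a (hR ha)
  have mb := hc.mem b (hR hb)
  refine ⟨_, exists_removal hc (fun d => if d = σ a then σ b else σ a) ?_, ?_, ?_⟩
  · intro d hd hdR hσ
    have h1 := hall (σ d) hσ (by rwa [hc.inv d hd])
    have h2 := hc.inv d hd
    grind
  · grind
  · grind

theorem exists_removal_two (hc : IsCubic vt K σ) (hR : R ⊆ K) {a b a' b' : D} (hab : a ≠ b)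
    (hab' : a' ≠ b') (haa : a ≠ a') (hbb : b ≠ b') (h1 : a ≠ b') (h2 : b ≠ a')
    (ha : vt a ∈ R ∧ vt (σ a) ∉ R) (hb : vt b ∈ R ∧ vt (σ b) ∉ R)
    (ha' : vt a' ∈ R ∧ vt (σ a') ∉ R) (hb' : vt b' ∈ R ∧ vt (σ b') ∉ R)
    (hall : ∀ x, vt x ∈ R → vt (σ x) ∉ R → x = a ∨ x = b ∨ x = a' ∨ x = b') :
    ∃ σ', Removal vt K σ R σ' ∧ σ' (σ a) = σ b ∧ σ' (σ b) = σ a ∧ σ' (σ a') = σ b' ∧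
      σ' (σ b') = σ a' := by
  have ia := hc.inv a (hR ha.1)
  have ib := hc.inv b (hR hb.1)
  have ia' := hc.inv a' (hR ha'.1)
  have ib' := hc.inv b' (hR hb'.1)
  have ma := hc.mem a (hR ha.1)
  have mb := hc.mem b (hR hb.1)
  have ma' := hc.mem a' (hR ha'.1)
  have mb' := hc.mem b' (hR hb'.1)
  refine ⟨_, exists_removal hc (fun d => if d = σ a then σ b else if d = σ b then σ a else
    if d = σ a' then σ b' else σ a') ?_, ?_, ?_, ?_, ?_⟩
  · intro d hd hdR hσ
    have h1 := hall (σ d) hσ (by rwa [hc.inv d hd])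
    have h2 := hc.inv d hd
    grind
  all_goals grind

theorem exists_removal_three (hc : IsCubic vt K σ) (hR : R ⊆ K) {a b a' b' a'' b'' : D}
    (hn : [a, b, a', b', a'', b''].Nodup)
    (ha : vt a ∈ R ∧ vt (σ a) ∉ R) (hb : vt b ∈ R ∧ vt (σ b) ∉ R)
    (ha' : vt a' ∈ R ∧ vt (σ a') ∉ R) (hb' : vt b' ∈ R ∧ vt (σ b') ∉ R)
    (ha'' : vt a'' ∈ R ∧ vt (σ a'') ∉ R) (hb'' : vt b'' ∈ R ∧ vt (σ b'') ∉ R)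
    (hall : ∀ x, vt x ∈ R → vt (σ x) ∉ R →
      x = a ∨ x = b ∨ x = a' ∨ x = b' ∨ x = a'' ∨ x = b'') :
    ∃ σ', Removal vt K σ R σ' ∧ σ' (σ a) = σ b ∧ σ' (σ b) = σ a ∧ σ' (σ a') = σ b' ∧
      σ' (σ b') = σ a' ∧ σ' (σ a'') = σ b'' ∧ σ' (σ b'') = σ a'' := by
  have ia := hc.inv a (hR ha.1)
  have ib := hc.inv b (hR hb.1)
  have ia' := hc.inv a' (hR ha'.1)
  have ib' := hc.inv b' (hR hb'.1)
  have ia'' := hc.inv a'' (hR ha''.1)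
  have ib'' := hc.inv b'' (hR hb''.1)
  have ma := hc.mem a (hR ha.1)
  have mb := hc.mem b (hR hb.1)
  have ma' := hc.mem a' (hR ha'.1)
  have mb' := hc.mem b' (hR hb'.1)
  have ma'' := hc.mem a'' (hR ha''.1)
  have mb'' := hc.mem b'' (hR hb''.1)
  simp only [List.nodup_cons, List.mem_cons, List.not_mem_nil, not_or, or_false,
    List.nodup_nil, and_true] at hn
  have hn' : σ a ≠ σ b ∧ σ a ≠ σ a' ∧ σ a ≠ σ b' ∧ σ a ≠ σ a'' ∧ σ a ≠ σ b'' ∧ σ b ≠ σ a' ∧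
      σ b ≠ σ b' ∧ σ b ≠ σ a'' ∧ σ b ≠ σ b'' ∧ σ a' ≠ σ b' ∧ σ a' ≠ σ a'' ∧ σ a' ≠ σ b'' ∧
      σ b' ≠ σ a'' ∧ σ b' ≠ σ b'' ∧ σ a'' ≠ σ b'' := by
    refine ⟨?_, ?_, ?_, ?_, ?_, ?_, ?_, ?_, ?_, ?_, ?_, ?_, ?_, ?_, ?_⟩ <;> grind
  obtain ⟨n1, n2, n3, n4, n5, n6, n7, n8, n9, n10, n11, n12, n13, n14, n15⟩ := hn'
  let τ : D → D := fun d => if d = σ a then σ b else if d = σ b then σ a else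
    if d = σ a' then σ b' else if d = σ b' then σ a' else if d = σ a'' then σ b'' else σ a''
  have t1 : τ (σ a) = σ b := by simp [τ]
  have t2 : τ (σ b) = σ a := by simp [τ, n1.symm]
  have t3 : τ (σ a') = σ b' := by simp [τ, n2.symm, n6.symm]
  have t4 : τ (σ b') = σ a' := by simp [τ, n3.symm, n7.symm, n10.symm]
  have t5 : τ (σ a'') = σ b'' := by simp [τ, n4.symm, n8.symm, n11.symm, n13.symm]
  have t6 : τ (σ b'') = σ a'' := by simp [τ, n5.symm, n9.symm, n12.symm, n14.symm, n15.symm]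
  refine ⟨_, exists_removal hc τ ?_, ?_⟩
  · intro d hd hdR hσ
    have h1 := hall (σ d) hσ (by rwa [hc.inv d hd])
    have h2 : d = σ a ∨ d = σ b ∨ d = σ a' ∨ d = σ b' ∨ d = σ a'' ∨ d = σ b'' := by
      have h2 := hc.inv d hd
      grind
    rcases h2 with rfl | rfl | rfl | rfl | rfl | rfl
    · rw [t1, t2, ib]; exact ⟨mb, hb.2, hb.1, rfl, n1.symm⟩
    · rw [t2, t1, ia]; exact ⟨ma, ha.2, ha.1, rfl, n1⟩
    · rw [t3, t4, ib']; exact ⟨mb', hb'.2, hb'.1, rfl, n10.symm⟩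
    · rw [t4, t3, ia']; exact ⟨ma', ha'.2, ha'.1, rfl, n10⟩
    · rw [t5, t6, ib'']; exact ⟨mb'', hb''.2, hb''.1, rfl, n15.symm⟩
    · rw [t6, t5, ia'']; exact ⟨ma'', ha''.2, ha''.1, rfl, n15⟩
  · simp only [ia, ha.1, ib, hb.1, ia', ha'.1, ib', hb'.1, ia'', ha''.1, ib'', hb''.1, if_true, t1,
      t2, t3, t4, t5, t6, and_self]

end

section
variable {W D : Type*} [DecidableEq W] [DecidableEq D] [Fintype D] {vt : D → W}
  {K R : Finset W} {σ σ' : D → D} {S : Finset D} {h : D}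

theorem Removal.card_dcut_singleton (hc : IsCubic vt K σ) (hr : Removal vt K σ R σ')
    (hR : R.Nonempty) (hRK : R ⊆ K) (h3 : CutGe vt K σ 3)
    (hl : ∀ d, vt d ∈ K → vt d ∉ R → vt (σ d) ∈ R → vt (σ' d) ≠ vt d) {v : W} (hv : v ∈ K)
    (hvR : v ∉ R) : #(dcut vt σ' {v}) = 3 := by
  have hd : #(dcut vt σ {v}) ≥ 3 := by
    apply h3 _ (by simpa) (by simp)
    rintro rfl
    obtain ⟨r, hr⟩ := hR
    have := hRK hr
    grind
  have hs : dcut vt σ {v} ⊆ ({d | vt d = v} : Finset D) := by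
    intro d; simp only [mem_dcut, mem_filter, mem_univ, mem_singleton]; tauto
  have he := Finset.eq_of_subset_of_card_le hs (by rw [hc.deg v hv]; exact hd)
  rw [← hc.deg v hv]
  congr 1
  ext d
  have := Finset.ext_iff.1 he d
  simp only [mem_dcut, mem_filter, mem_univ, mem_singleton, true_and] at this ⊢
  refine ⟨fun h => h.1, ?_⟩
  intro h
  refine ⟨h, ?_⟩
  by_cases hσ : vt (σ d) ∈ R
  · have := hl d (by grind) (by grind) hσ
    grind
  · rw [hr.agree d (by grind) (by grind) hσ]
    tauto

theorem Removal.cutGe_two (hc : IsCubic vt K σ) (hr : Removal vt K σ R σ') (hRK : R ⊆ K)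
    (hR : 2 ≤ #R) (h3 : CutGe vt K σ 3) (h4 : CutGeFour vt K σ) (hN : #(dcut vt σ R) ≤ 6)
    (hl : ∀ d, vt d ∈ K → vt d ∉ R → vt (σ d) ∈ R → vt (σ' d) ≠ vt d) :
    CutGe vt (K \ R) σ' 2 := by
  intro X hX hne hXK
  have hRn : R.Nonempty := by rw [← Finset.card_pos]; omega
  have hXR : ∀ v ∈ X, v ∈ K ∧ v ∉ R := fun v hv => by have := hX hv; grind
  have hXne : ((K \ R) \ X).Nonempty := by
    rw [Finset.nonempty_iff_ne_empty]
    intro he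
    rw [Finset.sdiff_eq_empty_iff_subset] at he
    exact hXK (hX.antisymm he)
  by_cases h1 : #X = 1
  · obtain ⟨v, rfl⟩ := Finset.card_eq_one.1 h1
    have := hXR v (by simp)
    rw [hr.card_dcut_singleton hc hRn hRK h3 hl this.1 this.2]
    omega
  by_cases h2 : #((K \ R) \ X) = 1
  · obtain ⟨v, hv⟩ := Finset.card_eq_one.1 h2
    have : v ∈ K ∧ v ∉ R := by
      have : v ∈ (K \ R) \ X := by rw [hv]; simp
      grind
    rw [← card_dcut_compl hr.cub hX, hv,
      hr.card_dcut_singleton hc hRn hRK h3 hl this.1 this.2]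
    omega
  have c1 := Finset.card_pos.2 hne
  have c2 := Finset.card_pos.2 hXne
  have k1 : 4 ≤ #(dcut vt σ X) := by
    apply h4 X (by grind) (by omega)
    have : (K \ R) \ X ⊆ K \ X := by grind
    have := Finset.card_le_card this
    omega
  have k2 : 4 ≤ #(dcut vt σ (X ∪ R)) := by
    apply h4 (X ∪ R) (by grind)
    · have := Finset.card_le_card (Finset.subset_union_right (s₁ := X) (s₂ := R))
      omega
    · have : (K \ R) \ X ⊆ K \ (X ∪ R) := by grind
      have := Finset.card_le_card this
      omega
  set A : Finset D := {d ∈ dcut vt σ' X | vt (σ d) ∉ R} with hA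
  set B : Finset D := {d ∈ dcut vt σ' X | vt (σ d) ∈ R} with hB
  set Dx : Finset D := {d | vt d ∈ X ∧ vt (σ d) ∈ R} with hDx
  have e1 : #(dcut vt σ' X) = #A + #B := by
    rw [hA, hB, add_comm, Finset.card_filter_add_card_filter_not]
  have e2 : #(dcut vt σ X) = #A + #Dx := by
    rw [← Finset.card_union_of_disjoint]
    · congr 1
      ext d
      have := hXR (vt d)
      have := hXR (vt (σ d))
      have := hr.agree d
      simp only [hA, hDx, mem_union, mem_filter, mem_dcut, mem_univ, true_and]
      grind
    · rw [Finset.disjoint_left]; intro d; simp only [hA, hDx, mem_filter]; grind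
  have e3 : #(dcut vt σ (X ∪ R)) = #A + #{d ∈ dcut vt σ R | vt (σ d) ∉ X} := by
    rw [← Finset.card_union_of_disjoint]
    · congr 1
      ext d
      have := hXR (vt d)
      have := hXR (vt (σ d))
      have := hr.agree d
      simp only [hA, mem_union, mem_filter, mem_dcut]
      grind
    · rw [Finset.disjoint_left]; intro d; simp only [hA, mem_filter, mem_dcut]; grind
  have e4 : #{d ∈ dcut vt σ R | vt (σ d) ∈ X} = #Dx := by
    apply Finset.card_nbij' σ σ
    · intro d hd
      have := hc.inv d
      simp only [hDx, coe_filter, Set.mem_ofPred_eq, mem_dcut, mem_univ, true_and] at hd ⊢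
      grind
    · intro d hd
      have := hc.inv d
      have := hXR (vt d)
      simp only [hDx, coe_filter, Set.mem_ofPred_eq, mem_dcut, mem_univ, true_and] at hd ⊢
      grind
    · intro d hd
      simp only [coe_filter, Set.mem_ofPred_eq, mem_dcut] at hd
      exact hc.inv d (hRK hd.1.1)
    · intro d hd
      simp only [hDx, coe_filter, Set.mem_ofPred_eq, mem_univ, true_and] at hd
      exact hc.inv d (hXR _ hd.1).1
  have e5 : #{d ∈ dcut vt σ R | vt (σ d) ∈ X} + #{d ∈ dcut vt σ R | vt (σ d) ∉ X} =
      #(dcut vt σ R) := Finset.card_filter_add_card_filter_not _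
  have e6 : #Dx = #B + #{d ∈ Dx | vt (σ' d) ∈ X} := by
    rw [← Finset.card_union_of_disjoint]
    · congr 1
      ext d
      simp only [hB, hDx, mem_union, mem_filter, mem_dcut, mem_univ, true_and]
      tauto
    · rw [Finset.disjoint_left]; intro d; simp only [hB, mem_filter, mem_dcut]; grind
  have e7 : Even #{d ∈ Dx | vt (σ' d) ∈ X} := by
    have key : ∀ d ∈ ({d ∈ Dx | vt (σ' d) ∈ X} : Finset D), vt d ∈ X ∧ vt (σ d) ∈ R ∧
        vt (σ' d) ∈ X := by
      intro d hd
      simp only [hDx, mem_filter, mem_univ, true_and] at hd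
      tauto
    apply even_card_of_involution σ'
    · intro d hd
      obtain ⟨h1, h2, h3⟩ := key d hd
      obtain ⟨q1, q2, q3, q4, q5⟩ := hr.loose hc (hXR _ h1).1 (hXR _ h1).2 h2
      simp only [hDx, mem_filter, mem_univ, true_and, q4]
      exact ⟨⟨h3, q3⟩, h1⟩
    · intro d hd
      obtain ⟨h1, h2, h3⟩ := key d hd
      obtain ⟨q1, q2, q3, q4, q5⟩ := hr.loose hc (hXR _ h1).1 (hXR _ h1).2 h2
      exact q4
    · intro d hd
      obtain ⟨h1, h2, h3⟩ := key d hd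
      obtain ⟨q1, q2, q3, q4, q5⟩ := hr.loose hc (hXR _ h1).1 (hXR _ h1).2 h2
      exact q5
  obtain ⟨m, hm⟩ := e7
  omega

theorem sclosed_empty : SClosed vt K σ S ∅ := ⟨by simp, by simp, by simp⟩

/-- The darts of `S` which lie outside of `C₀`. -/
def dropComp {W D : Type*} [DecidableEq W] (vt : D → W) (S : Finset D) (C₀ : Finset W) :
    Finset D :=
  {d ∈ S | vt d ∉ C₀}

theorem mem_dropComp {C₀ : Finset W} {d : D} : d ∈ dropComp vt S C₀ ↔ d ∈ S ∧ vt d ∉ C₀ := by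
  simp [dropComp]

theorem Removal.isTwoReg (hc : IsCubic vt K σ) (hr : Removal vt K σ R σ')
    (hS : IsTwoReg vt K σ S) {C₀ : Finset W} (h0 : SClosed vt K σ S C₀)
    (hH : ∀ d ∈ S, vt d ∈ K → vt d ∉ R → vt d ∉ C₀ → vt (σ d) ∉ R) :
    IsTwoReg vt (K \ R) σ' (dropComp vt S C₀) := by
  constructor
  · intro d hd hK
    rw [mem_dropComp] at hd ⊢
    rw [mem_sdiff] at hK
    have h1 := hH d hd.1 hK.1 hK.2 hd.2
    have h2 := hS.symm d hd.1 hK.1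
    rw [hr.agree d hK.1 hK.2 h1]
    refine ⟨h2, fun h => hd.2 ?_⟩
    have := h0.closed _ h2 h
    rwa [hc.inv d hK.1] at this
  · intro d hd hK
    rw [mem_dropComp] at hd
    rw [mem_sdiff] at hK
    rw [← hS.deg d hd.1 hK.1]
    congr 1
    ext e
    simp only [mem_filter, mem_dropComp]
    grind

theorem Removal.sclosed_iff (hr : Removal vt K σ R σ')
    {C₀ : Finset W} (hH : ∀ d ∈ S, vt d ∈ K → vt d ∉ R → vt d ∉ C₀ → vt (σ d) ∉ R)
    {T : Finset W} :
    SClosed vt (K \ R) σ' (dropComp vt S C₀) T ↔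
      SClosed vt K σ S T ∧ Disjoint T R ∧ Disjoint T C₀ := by
  constructor
  · intro hT
    have hs := fun (v : W) (hv : v ∈ T) => mem_sdiff.1 (hT.sub hv)
    have hC : ∀ v ∈ T, v ∉ C₀ := by
      intro v hv
      obtain ⟨d, hd, rfl⟩ := hT.on v hv
      exact (mem_dropComp.1 hd).2
    refine ⟨⟨fun v hv => (hs v hv).1, ?_, ?_⟩, ?_, ?_⟩
    · intro v hv
      obtain ⟨d, hd, rfl⟩ := hT.on v hv
      exact ⟨d, (mem_dropComp.1 hd).1, rfl⟩
    · intro d hd hv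
      have := hT.closed d (mem_dropComp.2 ⟨hd, hC _ hv⟩) hv
      rwa [hr.agree d (hs _ hv).1 (hs _ hv).2 (hH d hd (hs _ hv).1 (hs _ hv).2 (hC _ hv))] at this
    · rw [Finset.disjoint_left]; exact fun v hv => (hs v hv).2
    · rw [Finset.disjoint_left]; exact hC
  · rintro ⟨hT, h1, h2⟩
    rw [Finset.disjoint_left] at h1 h2
    refine ⟨fun v hv => mem_sdiff.2 ⟨hT.sub hv, h1 hv⟩, ?_, ?_⟩
    · intro v hv
      obtain ⟨d, hd, rfl⟩ := hT.on v hv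
      exact ⟨d, mem_dropComp.2 ⟨hd, h2 hv⟩, rfl⟩
    · intro d hd hv
      have h3 := hT.closed d (mem_dropComp.1 hd).1 hv
      rwa [hr.agree d (hT.sub hv) (h1 hv) (h1 h3)]

theorem Removal.isComp_iff (hr : Removal vt K σ R σ')
    {C₀ : Finset W} (hH : ∀ d ∈ S, vt d ∈ K → vt d ∉ R → vt d ∉ C₀ → vt (σ d) ∉ R)
    {C : Finset W} :
    IsComp vt (K \ R) σ' (dropComp vt S C₀) C ↔
      IsComp vt K σ S C ∧ Disjoint C R ∧ Disjoint C C₀ := by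
  constructor
  · intro h
    obtain ⟨h1, h2, h3⟩ := (hr.sclosed_iff hH).1 h.toSClosed
    exact ⟨⟨h1, h.nonempty, fun T hT hn hc => h.min T hT hn ((hr.sclosed_iff hH).2
      ⟨hc, h2.mono_left hT, h3.mono_left hT⟩)⟩, h2, h3⟩
  · rintro ⟨h, h2, h3⟩
    exact ⟨(hr.sclosed_iff hH).2 ⟨h.toSClosed, h2, h3⟩, h.nonempty, fun T hT hn hc =>
      h.min T hT hn ((hr.sclosed_iff hH).1 hc).1⟩

/-- A component which meets `C₀` is inside `C₀`; otherwise it avoids `R` or is inside `R`. -/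
theorem Removal.comp_cases (hr : Removal vt K σ R σ')
    {C₀ : Finset W} (h0 : SClosed vt K σ S C₀)
    (hH : ∀ d ∈ S, vt d ∈ K → vt d ∉ R → vt d ∉ C₀ → vt (σ d) ∉ R)
    {C : Finset W} (hC : IsComp vt K σ S C) :
    C ⊆ C₀ ∨ C ⊆ R ∨ IsComp vt (K \ R) σ' (dropComp vt S C₀) C := by
  rcases hC.subset_or_disjoint h0 with h1 | h1
  · exact Or.inl h1
  by_cases hR : C ⊆ R
  · exact Or.inr (Or.inl hR)
  right; right
  rw [hr.isComp_iff hH]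
  refine ⟨hC, ?_, h1⟩
  have h2 : C \ R = C := by
    apply hC.min _ sdiff_subset
    · rwa [Finset.sdiff_nonempty]
    · refine ⟨sdiff_subset.trans hC.sub, fun v hv => hC.on v (mem_sdiff.1 hv).1, ?_⟩
      intro d hd hv
      rw [mem_sdiff] at hv ⊢
      exact ⟨hC.closed d hd hv.1, hH d hd (hC.sub hv.1) hv.2 (Finset.disjoint_left.1 h1 hv.1)⟩
  exact Finset.sdiff_eq_self_iff_disjoint.1 h2

/-- Two matchings on complementary vertex sets which agree on the crossing edges. -/
theorem IsPM.glue (hc : IsCubic vt K σ) {X : Finset W} {F₁ F₂ : Set D}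
    (e₁ : ∀ v ∈ K, v ∈ X → ∃ d ∈ F₁, vt d = v) (e₂ : ∀ v ∈ K, v ∉ X → ∃ d ∈ F₂, vt d = v)
    (u₁ : ∀ d ∈ F₁, ∀ e ∈ F₁, vt d ∈ K → vt d ∈ X → vt d = vt e → d = e)
    (u₂ : ∀ d ∈ F₂, ∀ e ∈ F₂, vt d ∈ K → vt d ∉ X → vt d = vt e → d = e)
    (s₁ : ∀ d ∈ F₁, vt d ∈ K → vt d ∈ X → vt (σ d) ∈ X → σ d ∈ F₁)
    (s₂ : ∀ d ∈ F₂, vt d ∈ K → vt d ∉ X → vt (σ d) ∉ X → σ d ∈ F₂)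
    (hx : ∀ d, vt d ∈ K → vt d ∈ X → vt (σ d) ∉ X → (d ∈ F₁ ↔ σ d ∈ F₂)) :
    IsPM vt K σ {d | (vt d ∈ X ∧ d ∈ F₁) ∨ (vt d ∉ X ∧ d ∈ F₂)} := by
  constructor
  · intro v hv
    by_cases h : v ∈ X
    · obtain ⟨d, hd, rfl⟩ := e₁ v hv h
      exact ⟨d, Or.inl ⟨h, hd⟩, rfl⟩
    · obtain ⟨d, hd, rfl⟩ := e₂ v hv h
      exact ⟨d, Or.inr ⟨h, hd⟩, rfl⟩
  · rintro d (⟨h1, h2⟩ | ⟨h1, h2⟩) e (⟨h3, h4⟩ | ⟨h3, h4⟩) hK he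
    · exact u₁ d h2 e h4 hK h1 he
    · exact absurd (he ▸ h1) h3
    · exact absurd (he ▸ h3) h1
    · exact u₂ d h2 e h4 hK h1 he
  · rintro d (⟨h1, h2⟩ | ⟨h1, h2⟩) hK
    · by_cases h : vt (σ d) ∈ X
      · exact Or.inl ⟨h, s₁ d h2 hK h1 h⟩
      · exact Or.inr ⟨h, (hx d hK h1 h).1 h2⟩
    · by_cases h : vt (σ d) ∈ X
      · refine Or.inl ⟨h, ?_⟩
        rw [hx (σ d) (hc.mem d hK) h (by rwa [hc.inv d hK]), hc.inv d hK]
        exact h2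
      · exact Or.inr ⟨h, s₂ d h2 hK h1 h⟩

end

/-- `d₁` and `d₂` are the two darts leaving `A`. -/
structure TwoCut {W D : Type*} (vt : D → W) (K : Finset W) (σ : D → D) (A : Finset W)
    (d₁ d₂ : D) : Prop where
  sub : A ⊆ K
  ne : d₁ ≠ d₂
  iff : ∀ d, (vt d ∈ A ∧ vt (σ d) ∉ A) ↔ d = d₁ ∨ d = d₂

section
variable {W D : Type*} [DecidableEq W] [DecidableEq D] [Fintype D] {vt : D → W}
  {K R A : Finset W} {σ σ' : D → D} {S : Finset D} {h d₁ d₂ : D}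

theorem Removal.lift_landing (hc : IsCubic vt K σ) (hr : Removal vt K σ R σ') (hR : R ⊆ K)
    {Y C : Finset W} (hY : Y ⊆ K \ R)
    (hp : ∀ d, vt d ∈ K → vt d ∉ R → vt (σ d) ∈ R → vt d ∈ Y ∨ vt (σ' d) ∈ Y)
    (hC : ∀ d ∈ dcut vt σ' Y, vt (σ' d) ∈ C) : ∀ d ∈ dcut vt σ (Y ∪ R), vt (σ d) ∈ C := by
  intro d hd
  simp only [mem_dcut, mem_union, not_or] at hd hC
  obtain ⟨h1 | h1, h2, h3⟩ := hd
  · have := mem_sdiff.1 (hY h1)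
    have h4 := hr.agree d this.1 this.2 h3
    rw [← h4]
    exact hC d ⟨h1, by rwa [h4]⟩
  · have h4 := hc.mem d (hR h1)
    have h5 := hc.inv d (hR h1)
    have h6 := hp (σ d) h4 h3 (by rwa [h5])
    obtain ⟨q1, q2, q3, q4, q5⟩ := hr.loose hc h4 h3 (by rwa [h5])
    have h7 := h6.resolve_left h2
    have := hC (σ' (σ d)) ⟨h7, by rwa [q4]⟩
    rwa [q4] at this

theorem TwoCut.swap (h2 : TwoCut vt K σ A d₁ d₂) : TwoCut vt K σ A d₂ d₁ :=
  ⟨h2.sub, h2.ne.symm, fun d => by rw [h2.iff d, or_comm]⟩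

theorem TwoCut.compl (hc : IsCubic vt K σ) (h2 : TwoCut vt K σ A d₁ d₂) :
    TwoCut vt K σ (K \ A) (σ d₁) (σ d₂) := by
  have m1 := (h2.iff d₁).2 (Or.inl rfl)
  have m2 := (h2.iff d₂).2 (Or.inr rfl)
  have i1 := hc.inv d₁ (h2.sub m1.1)
  have i2 := hc.inv d₂ (h2.sub m2.1)
  have n1 := hc.mem d₁ (h2.sub m1.1)
  have n2 := hc.mem d₂ (h2.sub m2.1)
  have hn := h2.ne
  refine ⟨sdiff_subset, by grind, fun d => ?_⟩
  simp only [mem_sdiff]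
  constructor
  · rintro ⟨⟨h3, h4⟩, h5⟩
    have h6 := hc.mem d h3
    have h7 := hc.inv d h3
    have := (h2.iff (σ d)).1 ⟨by grind, by rwa [h7]⟩
    grind
  · grind

theorem TwoCut.exists_removal (hc : IsCubic vt K σ) (h2 : TwoCut vt K σ A d₁ d₂) :
    ∃ σ', Removal vt K σ (K \ A) σ' ∧ σ' d₁ = d₂ ∧ σ' d₂ = d₁ := by
  have h3 := h2.compl hc
  have m1 := (h2.iff d₁).2 (Or.inl rfl)
  have m2 := (h2.iff d₂).2 (Or.inr rfl)
  have i1 := hc.inv d₁ (h2.sub m1.1)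
  have i2 := hc.inv d₂ (h2.sub m2.1)
  have k1 := (h3.iff (σ d₁)).2 (Or.inl rfl)
  have k2 := (h3.iff (σ d₂)).2 (Or.inr rfl)
  obtain ⟨σ', hr, e1, e2⟩ := exists_removal_one hc (R := K \ A) sdiff_subset h3.ne k1.1 k2.1
    k1.2 k2.2 (fun x hx hx' => (h3.iff x).1 ⟨hx, hx'⟩)
  rw [i1, i2] at e1 e2
  exact ⟨σ', hr, e1, e2⟩

theorem TwoCut.cross (hc : IsCubic vt K σ) (hS : IsTwoReg vt K σ S)
    (h2 : TwoCut vt K σ A d₁ d₂) {C : Finset W} (hC : SClosed vt K σ S C) (h1 : d₁ ∈ S)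
    (hd : vt d₁ ∈ C) : d₂ ∈ S ∧ vt d₂ ∈ C := by
  have he := even_card_inter_dcut hc hS (X := C ∩ A) (inter_subset_left.trans hC.sub)
  have m1 := (h2.iff d₁).2 (Or.inl rfl)
  by_contra hcon
  have : S ∩ dcut vt σ (C ∩ A) = {d₁} := by
    ext d
    have := h2.iff d
    have := hC.closed d
    simp only [mem_inter, mem_dcut, mem_singleton]
    grind
  rw [this] at he
  simp at he

theorem TwoCut.pair (h2 : TwoCut vt K σ A d₁ d₂) (e1 : σ' d₁ = d₂) (e2 : σ' d₂ = d₁)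
    {Y : Finset W} (hd : vt d₁ ∈ Y ∨ vt d₂ ∈ Y) (d : D) (h3 : vt d ∈ K) (h4 : vt d ∉ K \ A)
    (h5 : vt (σ d) ∈ K \ A) : vt d ∈ Y ∨ vt (σ' d) ∈ Y := by
  rw [mem_sdiff] at h4 h5
  rcases (h2.iff d).1 ⟨by tauto, h5.2⟩ with rfl | rfl
  · rwa [e1]
  · rwa [e2, or_comm]

theorem TwoCut.cutGe (hI : Inst vt K σ S h) (h2 : TwoCut vt K σ A d₁ d₂) (hAK : A ≠ K)
    (hr : Removal vt K σ (K \ A) σ') (e1 : σ' d₁ = d₂) (e2 : σ' d₂ = d₁) :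
    CutGe vt A σ' 2 := by
  intro Y hY hne hYA
  have hAA : K \ (K \ A) = A := Finset.sdiff_sdiff_eq_self h2.sub
  have m1 := (h2.iff d₁).2 (Or.inl rfl)
  have m2 := (h2.iff d₂).2 (Or.inr rfl)
  by_cases hd : vt d₁ ∈ Y ∨ vt d₂ ∈ Y
  · rw [hr.card_dcut_union hI.cub sdiff_subset (by rwa [hAA])]
    · apply hI.cut
      · exact union_subset (hY.trans h2.sub) sdiff_subset
      · exact hne.mono subset_union_left
      · intro he
        apply hYA
        apply hY.antisymm
        intro v hv
        have : v ∈ Y ∪ K \ A := by rw [he]; exact h2.sub hv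
        grind
    · exact h2.pair e1 e2 hd
  · rw [hr.dcut_eq (by rwa [hAA])]
    · apply hI.cut _ (hY.trans h2.sub) hne
      rintro rfl
      exact hAK (h2.sub.antisymm hY)
    · intro d h3 h4
      have := (h2.iff d).1
      grind

theorem TwoCut.exists_comp_or (hc : IsCubic vt K σ) (hS : IsTwoReg vt K σ S)
    (hd : vt d₁ ∈ K) :
    ∃ C₀, SClosed vt K σ S C₀ ∧ (d₁ ∈ S → vt d₁ ∈ C₀) ∧
      (C₀ = ∅ ∨ IsComp vt K σ S C₀ ∧ d₁ ∈ S ∧ vt d₁ ∈ C₀) := by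
  by_cases h : d₁ ∈ S
  · obtain ⟨C, hC, h1⟩ := hS.exists_comp hc h hd
    exact ⟨C, hC.toSClosed, fun _ => h1, Or.inr ⟨hC, h, h1⟩⟩
  · exact ⟨∅, sclosed_empty, fun h' => absurd h' h, Or.inl rfl⟩

theorem TwoCut.inner (hc : IsCubic vt K σ) (hS : IsTwoReg vt K σ S)
    (h2 : TwoCut vt K σ A d₁ d₂) {C₀ : Finset W} (h0 : SClosed vt K σ S C₀)
    (h01 : d₁ ∈ S → vt d₁ ∈ C₀) :
    ∀ d ∈ S, vt d ∈ K → vt d ∉ K \ A → vt d ∉ C₀ → vt (σ d) ∉ K \ A := by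
  intro d hd hK hA h3
  have m2 := (h2.iff d₂).2 (Or.inr rfl)
  have hdA : vt d ∈ A := by grind
  by_contra h4
  rcases (h2.iff d).1 ⟨hdA, by grind⟩ with rfl | rfl
  · exact h3 (h01 hd)
  · obtain ⟨C, hC, h5⟩ := hS.exists_comp hc hd hK
    obtain ⟨h6, -⟩ := h2.swap.cross hc hS hC.toSClosed hd h5
    exact h3 (h2.cross hc hS h0 h6 (h01 h6)).2

theorem TwoCut.far (hI : Inst vt K σ S h) (h2 : TwoCut vt K σ A d₁ d₂)
    (hA : A ≠ K)
    (IH : ∀ K' σ' S' h', #K' < #K → Inst vt K' σ' S' h' → Good vt K' σ' S' h')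
    (hf : vt h ∉ A ∨ vt (σ h) ∉ A) (hr : Removal vt K σ (K \ A) σ') (e1 : σ' d₁ = d₂)
    (e2 : σ' d₂ = d₁) {C₀ : Finset W} {h' : D} (h0 : SClosed vt K σ S C₀)
    (h01 : d₁ ∈ S → vt d₁ ∈ C₀) (h0h : h' ∈ S → vt h' ∈ C₀)
    (h0c : C₀ = ∅ ∨ IsComp vt K σ S C₀ ∧ h' ∈ S ∧ vt h' ∈ C₀)
    (hh : h' = d₁ ∨ vt h' = vt d₁ ∧ ∀ e ∈ S, vt e = vt d₁ → vt d₁ ∈ C₀) :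
    ∃ F, IsPM vt A σ' F ∧ h' ∈ F ∧ ∀ C, IsComp vt K σ S C → ∀ v ∈ C, v ∈ A →
      ∃ d ∈ F, d ∈ S ∧ vt d ∈ C ∧ vt d ∈ A := by
  have hc := hI.cub
  have hAA : K \ (K \ A) = A := Finset.sdiff_sdiff_eq_self h2.sub
  have m1 := (h2.iff d₁).2 (Or.inl rfl)
  have m2 := (h2.iff d₂).2 (Or.inr rfl)
  have hH := h2.inner hc hI.reg h0 h01
  have hreg := hr.isTwoReg hc hI.reg h0 hH
  have hcub := hr.cub
  have hiff := fun C => hr.isComp_iff hH (C := C)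
  have hcases := fun C => hr.comp_cases h0 hH (C := C)
  have hhK : vt h ∈ K \ A ∨ vt (σ h) ∈ K \ A := by
    have := hc.mem h hI.mem
    have := hI.mem
    grind
  have hvh : vt h' = vt d₁ := by rcases hh with rfl | hh; exacts [rfl, hh.1]
  rw [hAA] at hreg hcub hiff hcases
  have hI' : Inst vt A σ' (dropComp vt S C₀) h' := by
    refine ⟨hcub, h2.cutGe hI hA hr e1 e2, hreg, by rw [hvh]; exact m1.1, ?_, ?_, ?_⟩
    · rw [mem_dropComp]; tauto
    · intro C hC hC1 hC2
      obtain ⟨k1, k2, k3⟩ := (hiff C).1 hC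
      rcases hh with rfl | hh
      · rw [e1] at hC2
        have hB : dcut vt σ (K \ A) = {σ h', σ d₂} := by
          ext d
          rw [mem_dcut, (h2.compl hc).iff d]
          simp
        have := hI.c2 C k1 (K \ A) sdiff_subset hhK k2.symm (by
          rw [hB]
          intro d hd
          have i1 := hc.inv h' (h2.sub m1.1)
          have i2 := hc.inv d₂ (h2.sub m2.1)
          simp only [mem_insert, mem_singleton] at hd
          rcases hd with rfl | rfl
          · rwa [i1]
          · rwa [i2])
        rw [hB] at this
        have := Finset.card_le_two (a := σ h') (b := σ d₂)
        omega
      · obtain ⟨e, he, he'⟩ := k1.on _ hC1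
        rw [hvh] at he' hC1
        exact Finset.disjoint_left.1 k3 hC1 (hh.2 e he he')
    · intro C hC Y hY hhY hdis hland
      obtain ⟨k1, k2, k3⟩ := (hiff C).1 hC
      have hdY : vt d₁ ∈ Y ∨ vt d₂ ∈ Y := by
        rcases hh with rfl | hh
        · rwa [e1] at hhY
        · left
          rcases hhY with hhY | hhY
          · rwa [hvh] at hhY
          · by_contra hcon
            have hhA : vt h' ∈ A := by rw [hvh]; exact m1.1
            have := hland (σ' h') (mem_dcut.2 ⟨hhY, by rwa [hcub.inv h' hhA, hvh]⟩)
            rw [hcub.inv h' hhA] at this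
            obtain ⟨e, he, he'⟩ := k1.on _ this
            rw [hvh] at he' this
            exact Finset.disjoint_left.1 k3 this (hh.2 e he he')
      have hp := h2.pair e1 e2 hdY
      rw [hr.card_dcut_union hc sdiff_subset (by rwa [hAA]) hp]
      apply hI.c2 C k1
      · exact union_subset (hY.trans h2.sub) sdiff_subset
      · rcases hhK with q | q
        exacts [Or.inl (mem_union_right _ q), Or.inr (mem_union_right _ q)]
      · rw [Finset.disjoint_union_left]
        exact ⟨hdis, k2.symm⟩
      · exact hr.lift_landing hc sdiff_subset (by rwa [hAA]) hp hland
  obtain ⟨F, hF, hhF, hhit⟩ := IH A σ' _ h' (Finset.card_lt_card (h2.sub.ssubset_of_ne hA)) hI'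
  refine ⟨F, hF, hhF, fun C hC v hv hvA => ?_⟩
  rcases hcases C hC with h3 | h3 | h3
  · rcases h0c with rfl | ⟨k1, k2, k3⟩
    · simpa using h3 hv
    · rw [k1.min C h3 hC.nonempty hC.toSClosed]
      exact ⟨h', hhF, k2, k3, by rw [hvh]; exact m1.1⟩
  · have := h3 hv
    grind
  · obtain ⟨d, q1, q2, q3⟩ := hhit C h3
    exact ⟨d, q1, (mem_dropComp.1 q2).1, q3, h3.sub q3⟩

theorem TwoCut.far_contain (hI : Inst vt K σ S h) (h2 : TwoCut vt K σ A d₁ d₂)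
    (hA : A ≠ K)
    (IH : ∀ K' σ' S' h', #K' < #K → Inst vt K' σ' S' h' → Good vt K' σ' S' h')
    (hf : vt h ∉ A ∨ vt (σ h) ∉ A) (hr : Removal vt K σ (K \ A) σ') (e1 : σ' d₁ = d₂)
    (e2 : σ' d₂ = d₁) :
    ∃ F, IsPM vt A σ' F ∧ d₁ ∈ F ∧ ∀ C, IsComp vt K σ S C → ∀ v ∈ C, v ∈ A →
      ∃ d ∈ F, d ∈ S ∧ vt d ∈ C ∧ vt d ∈ A := by
  have m1 := (h2.iff d₁).2 (Or.inl rfl)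
  obtain ⟨C₀, h0, h01, h0c⟩ := TwoCut.exists_comp_or hI.cub hI.reg (h2.sub m1.1)
  exact h2.far hI hA IH hf hr e1 e2 h0 h01 h01 h0c (Or.inl rfl)

theorem TwoCut.far_avoid (hI : Inst vt K σ S h) (h2 : TwoCut vt K σ A d₁ d₂)
    (hA : A ≠ K)
    (IH : ∀ K' σ' S' h', #K' < #K → Inst vt K' σ' S' h' → Good vt K' σ' S' h')
    (hf : vt h ∉ A ∨ vt (σ h) ∉ A) (hr : Removal vt K σ (K \ A) σ') (e1 : σ' d₁ = d₂)
    (e2 : σ' d₂ = d₁) :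
    ∃ F, IsPM vt A σ' F ∧ d₁ ∉ F ∧ ∀ C, IsComp vt K σ S C → ∀ v ∈ C, v ∈ A →
      ∃ d ∈ F, d ∈ S ∧ vt d ∈ C ∧ vt d ∈ A := by
  have m1 := (h2.iff d₁).2 (Or.inl rfl)
  have hK := h2.sub m1.1
  have key : ∃ h' C₀, h' ≠ d₁ ∧ vt h' = vt d₁ ∧ SClosed vt K σ S C₀ ∧ (d₁ ∈ S → vt d₁ ∈ C₀) ∧
      (h' ∈ S → vt h' ∈ C₀) ∧ (C₀ = ∅ ∨ IsComp vt K σ S C₀ ∧ h' ∈ S ∧ vt h' ∈ C₀) ∧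
      (∀ e ∈ S, vt e = vt d₁ → vt d₁ ∈ C₀) := by
    by_cases hs : ∃ e ∈ S, vt e = vt d₁
    · obtain ⟨h', k1, k2, k3⟩ : ∃ h' ∈ S, h' ≠ d₁ ∧ vt h' = vt d₁ := by
        by_cases hd : d₁ ∈ S
        · obtain ⟨a, z, h1, h2, h3, h4, h5, h6, h7, h8⟩ := hI.reg.exists_of_mem hI.cub hK hd
          exact ⟨a, h6, h1, h4⟩
        · obtain ⟨e, he, he'⟩ := hs
          exact ⟨e, he, fun h => hd (h ▸ he), he'⟩
      obtain ⟨C₀, hC, h1⟩ := hI.reg.exists_comp hI.cub k1 (by rwa [k3])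
      exact ⟨h', C₀, k2, k3, hC.toSClosed, fun _ => k3 ▸ h1, fun _ => h1, Or.inr ⟨hC, k1, h1⟩,
        fun _ _ _ => k3 ▸ h1⟩
    · push Not at hs
      obtain ⟨a, b, h1, -, -, h4, -⟩ := hI.cub.exists_three hK
      exact ⟨a, ∅, h1, h4, sclosed_empty, fun h => absurd rfl (hs _ h), fun h => absurd h4 (hs _ h),
        Or.inl rfl, fun e he he' => absurd he' (hs e he)⟩
  obtain ⟨h', C₀, k1, k2, k3, k4, k5, k6, k7⟩ := key
  obtain ⟨F, hF, hh, hit⟩ := h2.far hI hA IH hf hr e1 e2 k3 k4 k5 k6 (Or.inr ⟨k2, k7⟩)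
  exact ⟨F, hF, fun hd => k1 (hF.uniq _ hh _ hd (by rw [k2]; exact m1.1) k2), hit⟩

theorem TwoCut.near (hI : Inst vt K σ S h) (h2 : TwoCut vt K σ A d₁ d₂)
    (hA : A ≠ K)
    (IH : ∀ K' σ' S' h', #K' < #K → Inst vt K' σ' S' h' → Good vt K' σ' S' h')
    (hn : vt h ∈ A) (hn' : vt (σ h) ∈ A) (hr : Removal vt K σ (K \ A) σ') (e1 : σ' d₁ = d₂)
    (e2 : σ' d₂ = d₁) :
    ∃ F, IsPM vt A σ' F ∧ h ∈ F ∧ ∀ C, IsComp vt K σ S C → ∀ v ∈ C, v ∈ A →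
      vt (σ d₁) ∈ C ∨ ∃ d ∈ F, d ∈ S ∧ vt d ∈ C ∧ vt d ∈ A := by
  have hc := hI.cub
  have hAA : K \ (K \ A) = A := Finset.sdiff_sdiff_eq_self h2.sub
  have m1 := (h2.iff d₁).2 (Or.inl rfl)
  have m2 := (h2.iff d₂).2 (Or.inr rfl)
  obtain ⟨C₀, h0, h01, h0c⟩ := TwoCut.exists_comp_or hI.cub hI.reg (h2.sub m1.1)
  have hH := h2.inner hc hI.reg h0 h01
  have hreg := hr.isTwoReg hc hI.reg h0 hH
  have hcub := hr.cub
  have hiff := fun C => hr.isComp_iff hH (C := C)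
  have hcases := fun C => hr.comp_cases h0 hH (C := C)
  rw [hAA] at hreg hcub hiff hcases
  have hσ : σ' h = σ h := hr.agree h hI.mem (by grind) (by grind)
  have hI' : Inst vt A σ' (dropComp vt S C₀) h := by
    refine ⟨hcub, h2.cutGe hI hA hr e1 e2, hreg, hn, ?_, ?_, ?_⟩
    · rw [mem_dropComp]; exact fun h => hI.notMem h.1
    · intro C hC hC1 hC2
      obtain ⟨k1, k2, k3⟩ := (hiff C).1 hC
      exact hI.c1 C k1 hC1 (by rwa [← hσ])
    · intro C hC Y hY hhY hdis hland
      obtain ⟨k1, k2, k3⟩ := (hiff C).1 hC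
      rw [hσ] at hhY
      by_cases hd : vt d₁ ∈ Y ∨ vt d₂ ∈ Y
      · have hp := h2.pair e1 e2 hd
        rw [hr.card_dcut_union hc sdiff_subset (by rwa [hAA]) hp]
        apply hI.c2 C k1
        · exact union_subset (hY.trans h2.sub) sdiff_subset
        · simp only [mem_union]; tauto
        · rw [Finset.disjoint_union_left]
          exact ⟨hdis, k2.symm⟩
        · exact hr.lift_landing hc sdiff_subset (by rwa [hAA]) hp hland
      · have hp : ∀ d, vt d ∈ Y → vt (σ d) ∈ K \ A → vt (σ' d) ∉ Y := by
          intro d h3 h4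
          have := (h2.iff d).1
          grind
        rw [hr.dcut_eq (by rwa [hAA]) hp] at hland ⊢
        apply hI.c2 C k1 Y (hY.trans h2.sub) hhY hdis
        intro d hd'
        rw [← hr.agree d]
        · exact hland d hd'
        · exact h2.sub (hY (mem_dcut.1 hd').1)
        · have := hY (mem_dcut.1 hd').1
          grind
        · have := hY (mem_dcut.1 hd').1
          have := (h2.iff d).1
          have := (mem_dcut.1 hd').1
          grind
  obtain ⟨F, hF, hhF, hhit⟩ := IH A σ' _ h (Finset.card_lt_card (h2.sub.ssubset_of_ne hA)) hI'
  refine ⟨F, hF, hhF, fun C hC v hv hvA => ?_⟩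
  rcases hcases C hC with h3 | h3 | h3
  · rcases h0c with rfl | ⟨k1, k2, k3⟩
    · simpa using h3 hv
    · rw [k1.min C h3 hC.nonempty hC.toSClosed]
      exact Or.inl (k1.closed _ k2 k3)
  · have := h3 hv
    grind
  · obtain ⟨d, q1, q2, q3⟩ := hhit C h3
    exact Or.inr ⟨d, q1, (mem_dropComp.1 q2).1, q3, h3.sub q3⟩

theorem TwoCut.glue (hc : IsCubic vt K σ) (h2 : TwoCut vt K σ A d₁ d₂) {σ'' : D → D}
    (hr : Removal vt K σ (K \ A) σ') (e1 : σ' d₁ = d₂) (e2 : σ' d₂ = d₁)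
    (hr' : Removal vt K σ A σ'') (e1' : σ'' (σ d₁) = σ d₂) (e2' : σ'' (σ d₂) = σ d₁)
    {F₁ F₂ : Set D} (hF₁ : IsPM vt A σ' F₁) (hF₂ : IsPM vt (K \ A) σ'' F₂)
    (hx : d₁ ∈ F₁ ↔ σ d₁ ∈ F₂) :
    IsPM vt K σ {d | (vt d ∈ A ∧ d ∈ F₁) ∨ (vt d ∉ A ∧ d ∈ F₂)} := by
  have m1 := (h2.iff d₁).2 (Or.inl rfl)
  have m2 := (h2.iff d₂).2 (Or.inr rfl)
  have k1 := hc.mem d₁ (h2.sub m1.1)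
  have k2 := hc.mem d₂ (h2.sub m2.1)
  apply IsPM.glue hc
  · exact fun v _ hv => hF₁.ex v hv
  · exact fun v hv hv' => hF₂.ex v (by grind)
  · exact fun d hd e he _ h => hF₁.uniq d hd e he h
  · exact fun d hd e he hK h => hF₂.uniq d hd e he (by grind)
  · intro d hd hK hA hA'
    rw [← hr.agree d hK (by grind) (by grind)]
    exact hF₁.symm d hd hA
  · intro d hd hK hA hA'
    rw [← hr'.agree d hK hA hA']
    exact hF₂.symm d hd (by grind)
  · intro d hd hA hA'
    have a1 := hF₁.symm d₁
    have a2 := hF₁.symm d₂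
    have b1 := hF₂.symm (σ d₁)
    have b2 := hF₂.symm (σ d₂)
    rcases (h2.iff d).1 ⟨hA, hA'⟩ with rfl | rfl
    · exact hx
    · grind

theorem TwoCut.good (hI : Inst vt K σ S h) (h2 : TwoCut vt K σ A d₁ d₂)
    (hA : A ≠ K)
    (IH : ∀ K' σ' S' h', #K' < #K → Inst vt K' σ' S' h' → Good vt K' σ' S' h')
    (hn : vt h ∈ A) : Good vt K σ S h := by
  have hc := hI.cub
  have m1 := (h2.iff d₁).2 (Or.inl rfl)
  have k1 := hc.mem d₁ (h2.sub m1.1)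
  have h3 := h2.compl hc
  have hAA : K \ (K \ A) = A := Finset.sdiff_sdiff_eq_self h2.sub
  have hBK : K \ A ≠ K := by
    intro h
    have := h2.sub hn
    rw [← h] at this
    grind
  obtain ⟨σ', hr, e1, e2⟩ := h2.exists_removal hc
  obtain ⟨σ'', hr', e1', e2'⟩ := h3.exists_removal hc
  have hr'' := hr'
  rw [hAA] at hr''
  by_cases hn' : vt (σ h) ∈ A
  · obtain ⟨F₁, hF₁, hhF, hit₁⟩ := h2.near hI hA IH hn hn' hr e1 e2
    have : ∃ F₂, IsPM vt (K \ A) σ'' F₂ ∧ (d₁ ∈ F₁ ↔ σ d₁ ∈ F₂) ∧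
        ∀ C, IsComp vt K σ S C → ∀ v ∈ C, v ∈ K \ A →
          ∃ d ∈ F₂, d ∈ S ∧ vt d ∈ C ∧ vt d ∈ K \ A := by
      by_cases hd : d₁ ∈ F₁
      · obtain ⟨F₂, q1, q2, q3⟩ := h3.far_contain hI hBK IH (Or.inr (by grind)) hr' e1' e2'
        exact ⟨F₂, q1, by tauto, q3⟩
      · obtain ⟨F₂, q1, q2, q3⟩ := h3.far_avoid hI hBK IH (Or.inr (by grind)) hr' e1' e2'
        exact ⟨F₂, q1, by tauto, q3⟩
    obtain ⟨F₂, hF₂, hx, hit₂⟩ := this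
    refine ⟨_, h2.glue hc hr e1 e2 hr'' e1' e2' hF₁ hF₂ hx, Or.inl ⟨hn, hhF⟩, ?_⟩
    intro C hC
    have hB : ∀ v ∈ C, v ∈ K \ A → ∃ d ∈ {d | (vt d ∈ A ∧ d ∈ F₁) ∨ (vt d ∉ A ∧ d ∈ F₂)},
        d ∈ S ∧ vt d ∈ C := by
      intro v hv hvA
      obtain ⟨d, q1, q2, q3, q4⟩ := hit₂ C hC v hv hvA
      exact ⟨d, Or.inr ⟨(mem_sdiff.1 q4).2, q1⟩, q2, q3⟩
    obtain ⟨v, hv⟩ := hC.nonempty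
    by_cases hvA : v ∈ A
    · rcases hit₁ C hC v hv hvA with h5 | ⟨d, q1, q2, q3, q4⟩
      · exact hB _ h5 (by grind)
      · exact ⟨d, Or.inl ⟨q4, q1⟩, q2, q3⟩
    · exact hB v hv (mem_sdiff.2 ⟨hC.sub hv, hvA⟩)
  · have key : ∀ d₁ d₂ σ' σ'', TwoCut vt K σ A d₁ d₂ → h = d₁ → Removal vt K σ (K \ A) σ' →
        σ' d₁ = d₂ → σ' d₂ = d₁ → Removal vt K σ (K \ (K \ A)) σ'' → σ'' (σ d₁) = σ d₂ →
        σ'' (σ d₂) = σ d₁ → Good vt K σ S h := by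
      intro d₁ d₂ σ' σ'' h2 hd hr e1 e2 hr' e1' e2'
      have h3 := h2.compl hc
      have hr'' := hr'
      rw [hAA] at hr''
      obtain ⟨F₁, hF₁, hd₁, hit₁⟩ := h2.far_contain hI hA IH (Or.inr hn') hr e1 e2
      obtain ⟨F₂, hF₂, hd₂, hit₂⟩ := h3.far_contain hI hBK IH (Or.inl (by grind)) hr' e1' e2'
      refine ⟨_, h2.glue hc hr e1 e2 hr'' e1' e2' hF₁ hF₂ (by tauto),
        Or.inl ⟨hn, hd ▸ hd₁⟩, ?_⟩
      intro C hC
      obtain ⟨v, hv⟩ := hC.nonempty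
      by_cases hvA : v ∈ A
      · obtain ⟨d, q1, q2, q3, q4⟩ := hit₁ C hC v hv hvA
        exact ⟨d, Or.inl ⟨q4, q1⟩, q2, q3⟩
      · obtain ⟨d, q1, q2, q3, q4⟩ := hit₂ C hC v hv (mem_sdiff.2 ⟨hC.sub hv, hvA⟩)
        exact ⟨d, Or.inr ⟨(mem_sdiff.1 q4).2, q1⟩, q2, q3⟩
    rcases (h2.iff h).1 ⟨hn, hn'⟩ with h5 | h5
    · exact key d₁ d₂ σ' σ'' h2 h5 hr e1 e2 hr' e1' e2'
    · exact key d₂ d₁ σ' σ'' h2.swap h5 hr e2 e1 hr' e2' e1'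

theorem Inst.good_of_two_cut (hI : Inst vt K σ S h)
    (IH : ∀ K' σ' S' h', #K' < #K → Inst vt K' σ' S' h' → Good vt K' σ' S' h')
    (hA : A ⊆ K) (hne : A.Nonempty) (hAK : A ≠ K) (h2 : #(dcut vt σ A) = 2) :
    Good vt K σ S h := by
  obtain ⟨d₁, d₂, hd, he⟩ := Finset.card_eq_two.1 h2
  have hT : TwoCut vt K σ A d₁ d₂ := ⟨hA, hd, fun d => by rw [← mem_dcut, he]; simp⟩
  by_cases hh : vt h ∈ A
  · exact hT.good hI hAK IH hh
  · have := hI.mem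
    refine (hT.compl hI.cub).good hI ?_ IH (by grind)
    intro he
    rw [Finset.sdiff_eq_self_iff_disjoint] at he
    obtain ⟨v, hv⟩ := hne
    exact Finset.disjoint_left.1 he (hA hv) hv

end

/-- `σ₁` arises from `σ` by contracting everything outside `X` to the vertex `y`. -/
structure Side {W D : Type*} [DecidableEq W] [Fintype D] (vt : D → W) (K : Finset W) (σ : D → D)
    (X : Finset W) (y : W) (σ₁ : D → D) : Prop where
  sub : X ⊆ K
  mem : y ∈ K
  notMem : y ∉ X
  cub : IsCubic vt (insert y X) σ₁
  agree : ∀ d, vt d ∈ X → vt (σ d) ∈ X → σ₁ d = σ d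
  cross : ∀ d, vt d ∈ X → vt (σ d) ∉ X → vt (σ₁ d) = y
  inner : ∀ d, vt d = y → vt (σ₁ d) ∈ X ∧ vt (σ (σ₁ d)) ∉ X

/-- The darts corresponding to `S` after contracting everything outside `X` to `y`. -/
def sideSet {W D : Type*} [DecidableEq W] [DecidableEq D] [Fintype D] (vt : D → W) (σ₁ : D → D)
    (S : Finset D) (X : Finset W) (y : W) : Finset D :=
  {d | (vt d ∈ X ∧ d ∈ S) ∨ (vt d = y ∧ σ₁ d ∈ S)}

section
variable {W D : Type*} [DecidableEq W] [DecidableEq D] [Fintype D] {vt : D → W}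
  {K X : Finset W} {σ σ₁ : D → D} {S : Finset D} {h : D} {y : W}

theorem mem_sideSet {d : D} :
    d ∈ sideSet vt σ₁ S X y ↔ (vt d ∈ X ∧ d ∈ S) ∨ (vt d = y ∧ σ₁ d ∈ S) := by
  simp [sideSet]

theorem exists_side (hc : IsCubic vt K σ) (hX : X ⊆ K) (hy : y ∈ K) (hyX : y ∉ X)
    (h3 : #(dcut vt σ X) = 3) : ∃ σ₁, Side vt K σ X y σ₁ := by
  have e := Finset.equivOfCardEq (s := dcut vt σ X) (t := ({d | vt d = y} : Finset D))
    (by rw [h3, hc.deg y hy])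
  let σ₁ : D → D := fun d => if hd : d ∈ dcut vt σ X then (e ⟨d, hd⟩ : D) else
    if hd' : d ∈ ({d | vt d = y} : Finset D) then (e.symm ⟨d, hd'⟩ : D) else σ d
  have s1 : ∀ d, vt d ∈ X → vt (σ d) ∉ X → vt (σ₁ d) = y ∧ σ₁ (σ₁ d) = d := by
    intro d h1 h2
    have hd : d ∈ dcut vt σ X := mem_dcut.2 ⟨h1, h2⟩
    have k1 : σ₁ d = e ⟨d, hd⟩ := by simp only [σ₁, dif_pos hd]
    have k2 := (e ⟨d, hd⟩).2
    rw [← k1] at k2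
    have k3 : vt (σ₁ d) = y := by simpa using k2
    have k4 : σ₁ d ∉ dcut vt σ X := by rw [mem_dcut, k3]; tauto
    refine ⟨k3, ?_⟩
    have k5 : σ₁ (σ₁ d) = e.symm ⟨σ₁ d, k2⟩ := by
      conv_lhs => rw [show σ₁ = fun d => if hd : d ∈ dcut vt σ X then (e ⟨d, hd⟩ : D) else
        if hd' : d ∈ ({d | vt d = y} : Finset D) then (e.symm ⟨d, hd'⟩ : D) else σ d from rfl]
      exact (dif_neg k4).trans (dif_pos k2)
    rw [k5]
    have : (⟨σ₁ d, k2⟩ : {x // x ∈ ({d | vt d = y} : Finset D)}) = e ⟨d, hd⟩ := Subtype.ext k1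
    rw [this, Equiv.symm_apply_apply]
  have s2 : ∀ d, vt d = y → (vt (σ₁ d) ∈ X ∧ vt (σ (σ₁ d)) ∉ X) ∧ σ₁ (σ₁ d) = d := by
    intro d h1
    have hd : d ∈ ({d | vt d = y} : Finset D) := by simpa
    have k4 : d ∉ dcut vt σ X := by rw [mem_dcut, h1]; tauto
    have k1 : σ₁ d = e.symm ⟨d, hd⟩ := by simp only [σ₁, dif_pos hd, dif_neg k4]
    have k2 := (e.symm ⟨d, hd⟩).2
    rw [← k1] at k2
    refine ⟨mem_dcut.1 k2, ?_⟩
    have k5 : σ₁ (σ₁ d) = e ⟨σ₁ d, k2⟩ := dif_pos k2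
    rw [k5]
    have : (⟨σ₁ d, k2⟩ : {x // x ∈ dcut vt σ X}) = e.symm ⟨d, hd⟩ := Subtype.ext k1
    rw [this, Equiv.apply_symm_apply]
  have s3 : ∀ d, vt d ∈ X → vt (σ d) ∈ X → σ₁ d = σ d := by
    intro d h1 h2
    have k4 : d ∉ dcut vt σ X := by rw [mem_dcut]; tauto
    have k5 : d ∉ ({d | vt d = y} : Finset D) := by simp; rintro rfl; exact hyX h1
    simp only [σ₁, dif_neg k4, dif_neg k5]
  clear_value σ₁
  refine ⟨σ₁, hX, hy, hyX, ⟨?_, ?_, ?_, ?_⟩, s3, fun d a b => (s1 d a b).1, fun d a => (s2 d a).1⟩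
  · intro d hd
    have := s1 d; have := s2 d; have := s3 d
    grind
  · intro d hd
    have := s1 d; have := s2 d; have := s3 d; have := s3 (σ d); have := hc.inv d
    grind
  · intro d hd
    have := s1 d; have := s2 d; have := s3 d; have := hc.ne d
    grind
  · intro v hv
    exact hc.deg v (by grind)

theorem Side.cutGe (hc : IsCubic vt K σ) (hs : Side vt K σ X y σ₁) (h3 : CutGe vt K σ 3) :
    CutGe vt (insert y X) σ₁ 3 := by
  have key : ∀ Z ⊆ X, Z.Nonempty → 3 ≤ #(dcut vt σ₁ Z) := by
    intro Z hZ hne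
    have : dcut vt σ₁ Z = dcut vt σ Z := by
      ext d
      simp only [mem_dcut]
      refine and_congr_right fun hd => not_congr ?_
      by_cases hσ : vt (σ d) ∈ X
      · rw [hs.agree d (hZ hd) hσ]
      · rw [hs.cross d (hZ hd) hσ]
        exact iff_of_false (fun hh => hs.notMem (hZ hh)) (fun hh => hσ (hZ hh))
    rw [this]
    apply h3 Z (hZ.trans hs.sub) hne
    rintro rfl
    exact hs.notMem (hZ hs.mem)
  intro Z hZ hne hZ'
  by_cases hy : y ∈ Z
  · rw [← card_dcut_compl hs.cub hZ]
    apply key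
    · intro v hv; grind
    · rw [Finset.sdiff_nonempty]
      exact fun h => hZ' (hZ.antisymm h)
  · exact key Z (fun v hv => by have := hZ hv; grind) hne

theorem cross_comp (hc : IsCubic vt K σ) (hS : IsTwoReg vt K σ S) (hX : X ⊆ K)
    (h3 : #(dcut vt σ X) = 3) {C : Finset W} (hC : SClosed vt K σ S C) {d e : D}
    (hd : d ∈ S ∩ dcut vt σ X) (he : e ∈ S ∩ dcut vt σ X) (hdC : vt d ∈ C) : vt e ∈ C := by
  have e1 := even_card_inter_dcut hc hS hX
  have e2 := even_card_inter_dcut hc hS (inter_subset_left.trans hC.sub : C ∩ X ⊆ K)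
  have hsub : S ∩ dcut vt σ (C ∩ X) ⊆ S ∩ dcut vt σ X := by
    intro x hx
    simp only [mem_inter, mem_dcut] at hx ⊢
    have := hC.closed x
    tauto
  have hd' : d ∈ S ∩ dcut vt σ (C ∩ X) := by
    simp only [mem_inter, mem_dcut] at hd ⊢
    tauto
  have p := Finset.card_pos.2 ⟨d, hd'⟩
  have q : #(S ∩ dcut vt σ X) ≤ 3 := h3 ▸ Finset.card_le_card inter_subset_right
  have := Finset.eq_of_subset_of_card_le hsub (by
    obtain ⟨m, hm⟩ := e1
    obtain ⟨n, hn⟩ := e2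
    omega)
  rw [← this] at he
  simp only [mem_inter, mem_dcut] at he
  exact he.2.1.1

theorem Side.isTwoReg (hc : IsCubic vt K σ) (hs : Side vt K σ X y σ₁) (hS : IsTwoReg vt K σ S)
    (h3 : #(dcut vt σ X) = 3) : IsTwoReg vt (insert y X) σ₁ (sideSet vt σ₁ S X y) := by
  constructor
  · intro d hd hK
    rw [mem_sideSet] at hd ⊢
    have := hs.agree d; have := hs.cross d; have := hs.notMem; have := hs.inner d
    have := hS.symm d; have := hs.cub.inv d hK
    have := @hs.sub (vt d)
    grind
  · intro d hd hK
    rw [mem_sideSet] at hd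
    by_cases hy : vt d = y
    · have hX : vt d ∉ X := by rw [hy]; exact hs.notMem
      have : #{e ∈ sideSet vt σ₁ S X y | vt e = vt d} = #(S ∩ dcut vt σ X) := by
        apply Finset.card_nbij' σ₁ σ₁
        · intro e he
          simp only [coe_filter, mem_sideSet, Set.mem_ofPred_eq, mem_coe, mem_inter, mem_dcut]
            at he ⊢
          have := hs.inner e; have := hs.notMem
          grind
        · intro e he
          simp only [coe_filter, mem_sideSet, Set.mem_ofPred_eq, mem_coe, mem_inter, mem_dcut]
            at he ⊢
          have := hs.cross e; have := hs.notMem; have := hs.cub.inv e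
          grind
        · intro e he
          simp only [coe_filter, Set.mem_ofPred_eq] at he
          exact hs.cub.inv e (by grind)
        · intro e he
          simp only [mem_coe, mem_inter, mem_dcut] at he
          exact hs.cub.inv e (by grind)
      rw [this]
      have h1 : σ₁ d ∈ S ∩ dcut vt σ X := by
        have := hs.inner d hy
        simp only [mem_inter, mem_dcut]
        tauto
      have p := Finset.card_pos.2 ⟨_, h1⟩
      have q : #(S ∩ dcut vt σ X) ≤ 3 := h3 ▸ Finset.card_le_card inter_subset_right
      obtain ⟨m, hm⟩ := even_card_inter_dcut hc hS hs.sub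
      omega
    · have hX : vt d ∈ X := by grind
      rw [← hS.deg d (by tauto) (hs.sub hX)]
      congr 1
      ext e
      simp only [mem_filter, mem_sideSet]
      grind

theorem Side.exists_closed (hc : IsCubic vt K σ) (hs : Side vt K σ X y σ₁)
    (hS : IsTwoReg vt K σ S) (h3 : #(dcut vt σ X) = 3) {C : Finset W}
    (hC : SClosed vt K σ S C) : ∃ T, SClosed vt (insert y X) σ₁ (sideSet vt σ₁ S X y) T ∧
      (∀ v ∈ X, v ∈ T ↔ v ∈ C) ∧ (y ∈ T ↔ ∃ d ∈ S, vt d ∈ C ∧ vt d ∈ X ∧ vt (σ d) ∉ X) := by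
  have hcc := fun d e => cross_comp hc hS hs.sub h3 hC (d := d) (e := e)
  simp only [mem_inter, mem_dcut] at hcc
  have hyX := hs.notMem
  by_cases hf : ∃ d ∈ S, vt d ∈ C ∧ vt d ∈ X ∧ vt (σ d) ∉ X
  · refine ⟨insert y (C ∩ X), ⟨?_, ?_, ?_⟩, ?_, ?_⟩
    · intro v; grind
    · intro v hv
      rw [mem_insert] at hv
      rcases hv with rfl | hv
      · obtain ⟨d, h1, h2, h3, h4⟩ := hf
        refine ⟨σ₁ d, mem_sideSet.2 (Or.inr ⟨hs.cross d h3 h4, ?_⟩), hs.cross d h3 h4⟩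
        rwa [hs.cub.inv d (by grind)]
      · rw [mem_inter] at hv
        obtain ⟨d, hd, rfl⟩ := hC.on v hv.1
        exact ⟨d, mem_sideSet.2 (Or.inl ⟨hv.2, hd⟩), rfl⟩
    · intro d hd hv
      rw [mem_sideSet] at hd
      obtain ⟨d', h1, h2, h3, h4⟩ := hf
      have := hcc d' (σ₁ d); have := hs.inner d; have := hs.agree d; have := hs.cross d
      have := hC.closed d
      grind
    · intro v; grind
    · simp [hf]
  · refine ⟨C ∩ X, ⟨?_, ?_, ?_⟩, ?_, ?_⟩
    · intro v; grind
    · intro v hv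
      rw [mem_inter] at hv
      obtain ⟨d, hd, rfl⟩ := hC.on v hv.1
      exact ⟨d, mem_sideSet.2 (Or.inl ⟨hv.2, hd⟩), rfl⟩
    · intro d hd hv
      rw [mem_sideSet] at hd
      have := hs.agree d
      have := hC.closed d
      grind
    · intro v; grind
    · grind

theorem Side.good (hc : IsCubic vt K σ) (hs : Side vt K σ X y σ₁) (hS : IsTwoReg vt K σ S)
    (h3 : CutGe vt K σ 3) (hX : #(dcut vt σ X) = 3) (hhS : h ∉ S) (hhX : vt h ∈ X)
    (hc1 : ∀ C, IsComp vt K σ S C → vt h ∈ C → vt (σ h) ∉ C)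
    (hb : ∀ C, IsComp vt K σ S C → vt h ∈ C → vt (σ h) ∉ X →
      ∀ d ∈ S, vt d ∈ C → vt d ∈ X → vt (σ d) ∈ X)
    (IH : ∀ S' h', Inst vt (insert y X) σ₁ S' h' → Good vt (insert y X) σ₁ S' h') :
    ∃ F, IsPM vt (insert y X) σ₁ F ∧ h ∈ F ∧
      ∀ C, IsComp vt K σ S C → ∀ v ∈ C, v ∈ X → ∃ d ∈ F, d ∈ S ∧ vt d ∈ C ∧ vt d ∈ X := by
  have hcut := hs.cutGe hc h3
  have hreg := hs.isTwoReg hc hS hX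
  have hyX := hs.notMem
  have hI : Inst vt (insert y X) σ₁ (sideSet vt σ₁ S X y) h := by
    refine ⟨hs.cub, fun Z a b c => by have := hcut Z a b c; omega, hreg, by grind, ?_, ?_, ?_⟩
    · rw [mem_sideSet]; grind
    · intro C₁ hC₁ m1 m2
      obtain ⟨d, hd, hd'⟩ := hC₁.on _ m1
      have hdS : d ∈ S := by rw [mem_sideSet] at hd; grind
      obtain ⟨C, hC, hdC⟩ := hS.exists_comp hc hdS (hs.sub (hd' ▸ hhX))
      rw [hd'] at hdC
      obtain ⟨T, hT, t1, t2⟩ := hs.exists_closed hc hS hX hC.toSClosed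
      have hCT : C₁ ⊆ T := (hC₁.subset_or_disjoint hT).resolve_right
        (fun hh => Finset.disjoint_left.1 hh m1 ((t1 _ hhX).2 hdC))
      have m3 := hCT m2
      by_cases hσ : vt (σ h) ∈ X
      · rw [hs.agree h hhX hσ, t1 _ hσ] at m3
        exact hc1 C hC hdC m3
      · rw [hs.cross h hhX hσ, t2] at m3
        obtain ⟨e, k1, k2, k3, k4⟩ := m3
        exact k4 (hb C hC hdC hσ e k1 k2 k3)
    · intro C hC Y hY hh hdis _
      apply hcut Y hY
      · rcases hh with hh | hh
        exacts [⟨_, hh⟩, ⟨_, hh⟩]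
      · rintro rfl
        obtain ⟨v, hv⟩ := hC.nonempty
        exact Finset.disjoint_left.1 hdis (hC.sub hv) hv
  obtain ⟨F, hF, hhF, hhit⟩ := IH _ _ hI
  refine ⟨F, hF, hhF, fun C hC v hv hvX => ?_⟩
  obtain ⟨T, hT, t1, t2⟩ := hs.exists_closed hc hS hX hC.toSClosed
  obtain ⟨C₁, hC₁T, hC₁⟩ := hT.exists_comp ⟨v, (t1 v hvX).2 hv⟩
  obtain ⟨d, d1, d2, d3⟩ := hhit C₁ hC₁
  have d4 := hC₁T d3
  rw [mem_sideSet] at d2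
  rcases d2 with d2 | d2
  · exact ⟨d, d1, d2.2, (t1 _ d2.1).1 d4, d2.1⟩
  · have d5 := hT.closed d (mem_sideSet.2 (Or.inr d2)) d4
    have d6 := (hs.inner d d2.1).1
    exact ⟨σ₁ d, hF.symm d d1 (by grind), d2.2, (t1 _ d6).1 d5, d6⟩

theorem Side.exists_unique_cross (hs : Side vt K σ X y σ₁) {F : Set D}
    (hF : IsPM vt (insert y X) σ₁ F) : ∃ d ∈ F, vt d ∈ X ∧ vt (σ d) ∉ X ∧
      ∀ e ∈ F, vt e ∈ X → vt (σ e) ∉ X → e = d := by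
  obtain ⟨f, f1, f2⟩ := hF.ex y (by simp)
  have f3 := hs.inner f f2
  refine ⟨σ₁ f, hF.symm f f1 (by grind), f3.1, f3.2, fun e e1 e2 e3 => ?_⟩
  have := hF.uniq _ (hF.symm e e1 (by grind)) f f1 (by rw [hs.cross e e2 e3]; simp)
    (by rw [hs.cross e e2 e3, f2])
  rw [← this, hs.cub.inv e (by grind)]

end

section
variable {W D : Type*} [DecidableEq W] [DecidableEq D] [Fintype D] {vt : D → W}
  {K X : Finset W} {σ : D → D} {S : Finset D} {h : D}

theorem good_of_sides (hc : IsCubic vt K σ) (hS : IsTwoReg vt K σ S)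
    (h3 : CutGe vt K σ 3) (hXK : X ⊆ K) (hX1 : 2 ≤ #X) (hX2 : 2 ≤ #(K \ X))
    (hX : #(dcut vt σ X) = 3) (hhS : h ∉ S) (hhX : vt h ∈ X)
    (hc1 : ∀ C, IsComp vt K σ S C → vt h ∈ C → vt (σ h) ∉ C)
    (hb : ∀ C, IsComp vt K σ S C → vt h ∈ C → vt (σ h) ∉ X →
      ∀ d ∈ S, vt d ∈ C → vt d ∈ X → vt (σ d) ∈ X)
    (IH : ∀ K' σ' S' h', #K' < #K → Inst vt K' σ' S' h' → Good vt K' σ' S' h') :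
    Good vt K σ S h := by
  obtain ⟨y, hy⟩ := Finset.card_pos.1 (by omega : 0 < #(K \ X))
  obtain ⟨x, hx⟩ := Finset.card_pos.1 (by omega : 0 < #X)
  have hcard : #(K \ X) = #K - #X := Finset.card_sdiff_of_subset hXK
  have hyX := (mem_sdiff.1 hy).2
  have hxX : x ∉ K \ X := by simp [hx]
  obtain ⟨σ₁, hs⟩ := exists_side hc hXK (mem_sdiff.1 hy).1 hyX hX
  obtain ⟨σ₂, hs2⟩ := exists_side hc (X := K \ X) sdiff_subset (hXK hx) hxX
    (by rw [card_dcut_compl hc hXK, hX])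
  obtain ⟨F₁, hF₁, hhF₁, hhit₁⟩ := hs.good hc hS h3 hX hhS hhX hc1 hb
    (IH _ _ · · (by rw [Finset.card_insert_of_notMem hyX]; omega))
  obtain ⟨d₀, d1, d2, d3, d4⟩ := hs.exists_unique_cross hF₁
  have i0 := hc.inv d₀ (hXK d2)
  have m0 := hc.mem d₀ (hXK d2)
  obtain ⟨C₀, hC₀, hC₀'⟩ : ∃ C₀, (∀ d ∈ S, vt d ∈ X → vt (σ d) ∉ X → vt d ∈ C₀) ∧
      (C₀ = ∅ ∨ IsComp vt K σ S C₀ ∧ ∃ v ∈ C₀, v ∈ X) := by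
    by_cases hf : ∃ d ∈ S, vt d ∈ X ∧ vt (σ d) ∉ X
    · obtain ⟨d, k1, k2, k3⟩ := hf
      obtain ⟨C, hC, hdC⟩ := hS.exists_comp hc k1 (hXK k2)
      refine ⟨C, fun e e1 e2 e3 => ?_, Or.inr ⟨hC, _, hdC, k2⟩⟩
      refine cross_comp hc hS hXK hX hC.toSClosed (d := d) ?_ ?_ hdC
      · simp only [mem_inter, mem_dcut]; tauto
      · simp only [mem_inter, mem_dcut]; tauto
    · exact ⟨∅, fun d k1 k2 k3 => absurd ⟨d, k1, k2, k3⟩ hf, Or.inl rfl⟩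
  have h0 : SClosed vt K σ S C₀ := by
    rcases hC₀' with rfl | h
    exacts [sclosed_empty, h.1.toSClosed]
  have hr : Removal vt K σ ∅ σ := ⟨by simpa using hc, fun _ _ _ _ => rfl⟩
  have hH : ∀ d ∈ S, vt d ∈ K → vt d ∉ (∅ : Finset W) → vt d ∉ C₀ →
    vt (σ d) ∉ (∅ : Finset W) := by simp
  have hS2 := hr.isTwoReg hc hS h0 hH
  have hiff := fun C => hr.isComp_iff hH (C := C)
  have hcases := fun C => hr.comp_cases h0 hH (C := C)
  rw [sdiff_empty] at hS2 hiff hcases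
  have hcr : ∀ d ∈ dropComp vt S C₀, vt d ∈ K → vt d ∉ X → vt (σ d) ∉ X := by
    intro d hd hK hdX hσ
    rw [mem_dropComp] at hd
    have i := hc.inv d hK
    have := hC₀ (σ d) (hS.symm d hd.1 hK) hσ (by rwa [i])
    have := h0.closed _ (hS.symm d hd.1 hK) this
    rw [i] at this
    exact hd.2 this
  obtain ⟨F₂, hF₂, hhF₂, hhit₂⟩ := hs2.good (h := σ d₀) hc hS2 h3
    (by rw [card_dcut_compl hc hXK, hX])
    (fun hd => hcr _ hd m0 d3 (by rwa [i0])) (mem_sdiff.2 ⟨m0, d3⟩)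
    (by
      intro C hC m1 m2
      rw [i0] at m2
      obtain ⟨e, e1, e2⟩ := hC.on _ m1
      obtain ⟨k1, -, k3⟩ := (hiff C).1 hC
      have hCX : C ∩ X = C := by
        apply hC.min _ inter_subset_left ⟨_, mem_inter.2 ⟨m2, d2⟩⟩
        refine ⟨inter_subset_left.trans hC.sub, fun v hv => hC.on v (mem_inter.1 hv).1,
          fun d hd hv => ?_⟩
        rw [mem_inter] at hv ⊢
        refine ⟨hC.closed d hd hv.1, ?_⟩
        by_contra hσ
        exact Finset.disjoint_left.1 k3 hv.1 (hC₀ d (mem_dropComp.1 hd).1 hv.2 hσ)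
      rw [← hCX] at m1
      exact d3 (mem_inter.1 m1).2)
    (by
      intro C hC m1 _ d hd m2 m3
      rw [mem_sdiff] at m3 ⊢
      exact ⟨hc.mem d m3.1, hcr d hd m3.1 m3.2⟩)
    (IH _ _ · · (by rw [Finset.card_insert_of_notMem hxX]; omega))
  obtain ⟨e₀, e1, e2, e3, e4⟩ := hs2.exists_unique_cross hF₂
  have he : σ d₀ = e₀ := e4 _ hhF₂ (mem_sdiff.2 ⟨m0, d3⟩) (by rw [i0]; simp [d2])
  subst he
  have inK : ∀ d, vt d ∈ K → vt d ∉ X → vt d ∈ insert x (K \ X) := by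
    intro d a b; simp [a, b]
  refine ⟨{d | (vt d ∈ X ∧ d ∈ F₁) ∨ (vt d ∉ X ∧ d ∈ F₂)},
    IsPM.glue hc ?_ ?_ ?_ ?_ ?_ ?_ ?_, Or.inl ⟨hhX, hhF₁⟩, ?_⟩
  · exact fun v _ hv => hF₁.ex v (by simp [hv])
  · exact fun v hv hvX => hF₂.ex v (by simp [hv, hvX])
  · exact fun d k1 e k2 _ k4 => hF₁.uniq d k1 e k2 (by simp [k4])
  · exact fun d k1 e k2 k3 k4 => hF₂.uniq d k1 e k2 (inK d k3 k4)
  · intro d k1 k2 k3 k4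
    rw [← hs.agree d k3 k4]
    exact hF₁.symm d k1 (by simp [k3])
  · intro d k1 k2 k3 k4
    rw [← hs2.agree d (mem_sdiff.2 ⟨k2, k3⟩) (mem_sdiff.2 ⟨hc.mem d k2, k4⟩)]
    exact hF₂.symm d k1 (inK d k2 k3)
  · intro d k1 k2 k3
    have i := hc.inv d k1
    constructor
    · intro k4
      rw [d4 d k4 k2 k3]
      exact e1
    · intro k4
      have := e4 _ k4 (mem_sdiff.2 ⟨hc.mem d k1, k3⟩) (by rw [i]; simp [k2])
      have : σ (σ d) = σ (σ d₀) := by rw [this]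
      rw [i, i0] at this
      rwa [this]
  · intro C hC
    by_cases hm : ∃ v ∈ C, v ∈ X
    · obtain ⟨v, hv, hvX⟩ := hm
      obtain ⟨d, k1, k2, k3, k4⟩ := hhit₁ C hC v hv hvX
      exact ⟨d, Or.inl ⟨k4, k1⟩, k2, k3⟩
    · rcases hcases C hC with k | k | k
      · exfalso
        rcases hC₀' with rfl | ⟨q1, v, q2, q3⟩
        · obtain ⟨w, hw⟩ := hC.nonempty
          simpa using k hw
        · have := q1.min C k hC.nonempty hC.toSClosed
          exact hm ⟨v, this ▸ q2, q3⟩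
      · obtain ⟨w, hw⟩ := hC.nonempty
        simpa using k hw
      · obtain ⟨v, hv⟩ := hC.nonempty
        obtain ⟨d, k1, k2, k3, k4⟩ := hhit₂ C k v hv
          (mem_sdiff.2 ⟨hC.sub hv, fun q => hm ⟨v, hv, q⟩⟩)
        exact ⟨d, Or.inr ⟨(mem_sdiff.1 k4).2, k1⟩, (mem_dropComp.1 k2).1, k3⟩

theorem IsComp.exists_cross {C : Finset W} (hC : IsComp vt K σ S C) {v w : W} (hv : v ∈ C)
    (hw : w ∈ C) (hvX : v ∈ X) (hwX : w ∉ X) : ∃ d ∈ S, vt d ∈ C ∧ vt d ∈ X ∧ vt (σ d) ∉ X := by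
  by_contra! hcon
  have hCX : C ∩ X = C := by
    apply hC.min _ inter_subset_left ⟨_, mem_inter.2 ⟨hv, hvX⟩⟩
    refine ⟨inter_subset_left.trans hC.sub, fun v hv => hC.on v (mem_inter.1 hv).1,
      fun d hd hv => ?_⟩
    rw [mem_inter] at hv ⊢
    exact ⟨hC.closed d hd hv.1, hcon d hd hv.1 hv.2⟩
  rw [← hCX] at hw
  exact hwX (mem_inter.1 hw).2

theorem Inst.good_of_three_cut (hI : Inst vt K σ S h)
    (h3 : CutGe vt K σ 3) (hXK : X ⊆ K) (hX1 : 2 ≤ #X) (hX2 : 2 ≤ #(K \ X))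
    (hX : #(dcut vt σ X) = 3)
    (IH : ∀ K' σ' S' h', #K' < #K → Inst vt K' σ' S' h' → Good vt K' σ' S' h') :
    Good vt K σ S h := by
  have hc := hI.cub
  -- reduce to the case where `h` starts in `X`
  wlog hhX : vt h ∈ X generalizing X
  · apply this (X := K \ X) sdiff_subset hX2 (by rwa [Finset.sdiff_sdiff_eq_self hXK])
      (by rw [card_dcut_compl hc hXK, hX]) (mem_sdiff.2 ⟨hI.mem, hhX⟩)
  by_cases hb : ∀ C, IsComp vt K σ S C → vt h ∈ C → vt (σ h) ∉ X →
      ∀ d ∈ S, vt d ∈ C → vt d ∈ X → vt (σ d) ∈ X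
  · exact good_of_sides hc hI.reg h3 hXK hX1 hX2 hX hI.notMem hhX hI.c1 hb IH
  push Not at hb
  obtain ⟨C, hC, hhC, hσ, d, hd, hdC, hdX, hdσ⟩ := hb
  apply Good.of_swap hc hI.mem
  have hJ := hI.swap
  refine good_of_sides (X := K \ X) hc hI.reg h3 sdiff_subset hX2
    (by rwa [Finset.sdiff_sdiff_eq_self hXK]) (by rw [card_dcut_compl hc hXK, hX]) hJ.notMem
    (mem_sdiff.2 ⟨hJ.mem, hσ⟩) hJ.c1 ?_ IH
  intro C' hC' hhC' _ e he heC heX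
  rw [mem_sdiff] at heX ⊢
  refine ⟨hc.mem e heX.1, fun heσ => ?_⟩
  have i := hc.inv e heX.1
  have hσe := hI.reg.symm e he heX.1
  have := cross_comp hc hI.reg hXK hX hC'.toSClosed (d := σ e) (e := d)
    (by simp only [mem_inter, mem_dcut, i]; tauto) (by simp only [mem_inter, mem_dcut]; tauto)
    (hC'.closed e he heC)
  have := hC.eq_of_mem hC' hdC this
  subst this
  exact hI.c1 C hC hhC hhC'

end

/-- No loops, parallel edges, or triangles. -/
structure GirthFour {W D : Type*} (vt : D → W) (K : Finset W) (σ : D → D) : Prop where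
  loop : ∀ d, vt d ∈ K → vt (σ d) ≠ vt d
  parallel : ∀ d e, vt d ∈ K → vt d = vt e → vt (σ d) = vt (σ e) → d = e
  triangle : ∀ d e f, vt d ∈ K → vt d = vt e → d ≠ e → vt f = vt (σ d) → vt (σ f) ≠ vt (σ e)

section
variable {W D : Type*} [DecidableEq W] [DecidableEq D] [Fintype D] {vt : D → W}
  {K R X : Finset W} {σ σ' : D → D} {S : Finset D} {h : D}

theorem card_darts (hc : IsCubic vt K σ) (hX : X ⊆ K) : #({d | vt d ∈ X} : Finset D) = 3 * #X := by
  rw [Finset.card_eq_sum_card_fiberwise (f := vt) (t := X) (fun d hd => by simpa using hd)]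
  rw [Finset.sum_congr rfl (g := fun _ => 3)]
  · simp [mul_comm]
  · intro v hv
    rw [← hc.deg v (hX hv)]
    congr 1
    ext d
    simp only [mem_filter, mem_univ, true_and]
    exact ⟨fun k => k.2, fun k => ⟨k ▸ hv, k⟩⟩

theorem card_dcut_add_le (hc : IsCubic vt K σ) (hX : X ⊆ K) {T : Finset D}
    (hT : ∀ d ∈ T, vt d ∈ X ∧ vt (σ d) ∈ X) : #(dcut vt σ X) + #T ≤ 3 * #X := by
  rw [← card_darts hc hX, ← Finset.card_union_of_disjoint]
  · apply Finset.card_le_card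
    intro d
    simp only [mem_union, mem_dcut, mem_filter, mem_univ, true_and]
    have := hT d
    tauto
  · rw [Finset.disjoint_left]
    intro d
    rw [mem_dcut]
    have := hT d
    tauto

theorem CutGe.loop (hc : IsCubic vt K σ) (h3 : CutGe vt K σ 3) (hK : 2 ≤ #K) (d : D)
    (hd : vt d ∈ K) : vt (σ d) ≠ vt d := by
  intro he
  have k1 := h3 {vt d} (by simpa) (by simp) (by rintro h; rw [← h] at hK; simp at hK)
  have k2 := card_dcut_add_le hc (X := {vt d}) (by simpa) (T := {d}) (by simp [he])
  simp at k2
  omega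

theorem CutGe.parallel (hc : IsCubic vt K σ) (h3 : CutGe vt K σ 3) (hK : 3 ≤ #K) (d e : D)
    (hd : vt d ∈ K) (h1 : vt d = vt e) (h2 : vt (σ d) = vt (σ e)) : d = e := by
  by_contra hne
  have l := h3.loop hc (by omega)
  have hs : ({vt d, vt (σ d)} : Finset W) ⊆ K := by
    intro v; have := hc.mem d; grind
  have hcard : #({vt d, vt (σ d)} : Finset W) = 2 := Finset.card_pair (l d hd).symm
  have k1 := h3 {vt d, vt (σ d)} hs (by simp) (by rintro h; rw [← h] at hK; omega)
  have k2 := card_dcut_add_le hc hs (T := {d, σ d, e, σ e}) (by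
    have := hc.inv d; have := hc.inv e
    grind)
  have k3 : #({d, σ d, e, σ e} : Finset D) = 4 := by
    have := hc.inv d; have := hc.inv e; have := l d hd; have := hc.ne d hd
    have := hc.ne e (h1 ▸ hd)
    rw [card_insert_of_notMem, card_insert_of_notMem, Finset.card_pair] <;> grind
  omega

theorem CutGeFour.girthFour (hc : IsCubic vt K σ) (h3 : CutGe vt K σ 3) (h4 : CutGeFour vt K σ)
    (hK : 5 ≤ #K) : GirthFour vt K σ := by
  have l := h3.loop hc (by omega)
  have p := h3.parallel hc (by omega)
  refine ⟨l, p, fun d e f hd h1 hne h2 h3 => ?_⟩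
  have md := hc.mem d hd
  have me := hc.mem e (h1 ▸ hd)
  have hs : ({vt d, vt (σ d), vt (σ e)} : Finset W) ⊆ K := by
    intro v; grind
  have ld := l d hd
  have le := l e (h1 ▸ hd)
  have lf := l f (h2 ▸ md)
  have hcard : #({vt d, vt (σ d), vt (σ e)} : Finset W) = 3 := by
    rw [card_insert_of_notMem, Finset.card_pair] <;> grind
  have k0 := Finset.card_sdiff_of_subset hs
  have k1 := h4 _ hs (by omega) (by omega)
  have jd := hc.inv d hd
  have ie := hc.inv e (h1 ▸ hd)
  have jf := hc.inv f (h2 ▸ md)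
  have k2 := card_dcut_add_le hc hs (T := {d, σ d, e, σ e, f, σ f}) (by
    simp only [mem_insert, mem_singleton]
    rintro x (rfl | rfl | rfl | rfl | rfl | rfl)
    all_goals simp [jd, ie, jf, h2, h3, ← h1])
  have k3 : #({d, σ d, e, σ e, f, σ f} : Finset D) = 6 := by
    rw [card_insert_of_notMem, card_insert_of_notMem, card_insert_of_notMem,
      card_insert_of_notMem, Finset.card_pair]
    all_goals try simp only [mem_insert, mem_singleton, not_or]
    all_goals repeat' apply And.intro
    all_goals grind
  omega

theorem IsComp.exists_two (hc : IsCubic vt K σ) (hS : IsTwoReg vt K σ S) {C : Finset W}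
    (hC : IsComp vt K σ S C) {v : W} (hv : v ∈ C) : ∃ d ∈ S, ∃ e ∈ S, d ≠ e ∧ vt d = v ∧ vt e = v ∧
      vt (σ d) ∈ C ∧ vt (σ e) ∈ C := by
  obtain ⟨d, hd, rfl⟩ := hC.on v hv
  obtain ⟨a, z, h1, h2, h3, h4, h5, h6, h7, h8⟩ := hS.exists_of_mem hc (hC.sub hv) hd
  exact ⟨d, hd, a, h6, h1.symm, rfl, h4, hC.closed d hd hv, hC.closed a h6 (h4 ▸ hv)⟩

theorem Inst.good_of_card_two (hI : Inst vt K σ S h) (h3 : CutGe vt K σ 3) (hK : #K = 2) :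
    Good vt K σ S h := by
  have hc := hI.cub
  have l := h3.loop hc (by omega)
  have hm := hI.mem
  have hm' := hc.mem h hm
  have hi := hc.inv h hm
  have hl := l h hm
  have hKe : {vt h, vt (σ h)} = K := Finset.eq_of_subset_of_card_le
    (by intro v; grind) (by rw [Finset.card_pair hl.symm, hK])
  have hv : ∀ v ∈ K, v = vt h ∨ v = vt (σ h) := by rw [← hKe]; simp
  refine ⟨{h, σ h}, ⟨?_, ?_, ?_⟩, by simp, ?_⟩
  · intro v k
    rcases hv v k with rfl | rfl
    exacts [⟨h, by simp, rfl⟩, ⟨σ h, by simp, rfl⟩]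
  · intro d hd e he
    simp only [Set.mem_insert_iff, Set.mem_singleton_iff] at hd he
    grind
  · intro d hd
    simp only [Set.mem_insert_iff, Set.mem_singleton_iff] at hd ⊢
    grind
  · intro C hC
    exfalso
    have h1 := hI.c1 C hC
    obtain ⟨v, hvC⟩ := hC.nonempty
    obtain ⟨d, hd, e, he, hne, d1, e1, d2, e2⟩ := hC.exists_two hc hI.reg hvC
    have := hv _ (hC.sub hvC)
    have := hv _ (hC.sub d2)
    have := l d
    grind

theorem Inst.good_of_card_four (hI : Inst vt K σ S h) (h3 : CutGe vt K σ 3) (hK : #K = 4) :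
    Good vt K σ S h := by
  have hc := hI.cub
  have l := h3.loop hc (by omega)
  have p := h3.parallel hc (by omega)
  have hm := hI.mem
  have hm' := hc.mem h hm
  have hi := hc.inv h hm
  have hl := l h hm
  have hs : {vt h, vt (σ h)} ⊆ K := by intro v; grind
  have hcard := Finset.card_sdiff_of_subset hs
  rw [Finset.card_pair hl.symm, hK] at hcard
  obtain ⟨a, b, hab, hW⟩ := Finset.card_eq_two.1 hcard
  have hv : ∀ v, v ∈ K ↔ v = vt h ∨ v = vt (σ h) ∨ v = a ∨ v = b := by
    intro v
    have := Finset.ext_iff.1 hW v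
    grind
  have ha : a ≠ vt h ∧ a ≠ vt (σ h) := by
    have := Finset.ext_iff.1 hW a
    grind
  have hb : b ≠ vt h ∧ b ≠ vt (σ h) := by
    have := Finset.ext_iff.1 hW b
    grind
  clear hcard hW hs
  obtain ⟨d, d1, d2⟩ : ∃ d, vt d = a ∧ vt (σ d) = b := by
    by_contra! hcon
    have haK : a ∈ K := (hv a).2 (by simp)
    obtain ⟨d, rfl⟩ := hc.exists_dart haK
    obtain ⟨e, f, q1, q2, q3, q4, q5, -⟩ := hc.exists_three haK
    have r1 := (hv _).1 (hc.mem d haK)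
    have r2 := (hv _).1 (hc.mem e (q4 ▸ haK))
    have r3 := (hv _).1 (hc.mem f (q5 ▸ haK))
    have := l d haK
    have := l e (q4 ▸ haK)
    have := l f (q5 ▸ haK)
    have := hcon d rfl
    have := hcon e q4
    have := hcon f q5
    have := p d e haK q4.symm
    have := p d f haK q5.symm
    have := p e f (q4 ▸ haK) (q4.trans q5.symm)
    grind
  have haK : vt d ∈ K := (hv _).2 (by simp [d1])
  have hbK := hc.mem d haK
  have hd := hc.inv d haK
  subst d1 d2
  refine ⟨{h, σ h, d, σ d}, ⟨?_, ?_, ?_⟩, by simp, ?_⟩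
  · intro v k
    rcases (hv v).1 k with rfl | rfl | rfl | rfl
    exacts [⟨h, by simp, rfl⟩, ⟨σ h, by simp, rfl⟩, ⟨d, by simp, rfl⟩, ⟨σ d, by simp, rfl⟩]
  · intro d hd e he
    simp only [Set.mem_insert_iff, Set.mem_singleton_iff] at hd he
    grind
  · intro d hd
    simp only [Set.mem_insert_iff, Set.mem_singleton_iff] at hd ⊢
    grind
  · intro C hC
    have h1 := hI.c1 C hC
    have key : ∀ v ∈ C, ∃ e ∈ S, ∃ f ∈ S, vt e = v ∧ vt f = v ∧ vt (σ e) ∈ C ∧ vt (σ f) ∈ C ∧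
        vt (σ e) ≠ v ∧ vt (σ f) ≠ v ∧ vt (σ e) ≠ vt (σ f) := by
      intro v hvC
      obtain ⟨e, he, f, hf, hne, e1, f1, e2, f2⟩ := hC.exists_two hc hI.reg hvC
      have hvK := hC.sub hvC
      subst e1
      refine ⟨e, he, f, hf, rfl, f1, e2, f2, l e hvK, ?_, fun hh => hne (p e f hvK f1.symm hh)⟩
      have := l f (f1 ▸ hvK)
      rwa [f1] at this
    have hCv := fun v (hv' : v ∈ C) => (hv v).1 (hC.sub hv')
    have hdC : vt d ∈ C := by
      obtain ⟨v, hvC⟩ := hC.nonempty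
      obtain ⟨e, he, f, hf, e1, f1, e2, f2, e3, f3, h7⟩ := key v hvC
      have := hCv _ hvC
      have := hCv _ e2
      have := hCv _ f2
      grind
    have : d ∈ S := by
      obtain ⟨e, he, f, hf, e1, f1, e2, f2, e3, f3, h7⟩ := key _ hdC
      have := hCv _ e2
      have := hCv _ f2
      have := p e d
      have := p f d
      grind
    exact ⟨d, by simp, this, hdC⟩

end

/-- The darts at the ends `vt t ≠ vt (σ t)` of an edge. -/
structure Ends {W D : Type*} (vt : D → W) (K : Finset W) (σ : D → D) (t g₁ g₁' g₂ g₂' : D) :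
    Prop where
  mem : vt t ∈ K
  ne : vt (σ t) ≠ vt t
  l : vt g₁ = vt t ∧ vt g₁' = vt t
  r : vt g₂ = vt (σ t) ∧ vt g₂' = vt (σ t)
  dl : g₁ ≠ t ∧ g₁' ≠ t ∧ g₁ ≠ g₁'
  dr : g₂ ≠ σ t ∧ g₂' ≠ σ t ∧ g₂ ≠ g₂'
  out₁ : vt (σ g₁) ≠ vt t ∧ vt (σ g₁) ≠ vt (σ t)
  out₁' : vt (σ g₁') ≠ vt t ∧ vt (σ g₁') ≠ vt (σ t)
  out₂ : vt (σ g₂) ≠ vt t ∧ vt (σ g₂) ≠ vt (σ t)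
  out₂' : vt (σ g₂') ≠ vt t ∧ vt (σ g₂') ≠ vt (σ t)
  all₁ : ∀ x, vt x = vt t → x = t ∨ x = g₁ ∨ x = g₁'
  all₂ : ∀ x, vt x = vt (σ t) → x = σ t ∨ x = g₂ ∨ x = g₂'

section
variable {W D : Type*} [DecidableEq W] [DecidableEq D] [Fintype D] {vt : D → W}
  {K R X : Finset W} {σ σ' : D → D} {S : Finset D} {h t g₁ g₁' g₂ g₂' : D}

theorem Removal.inst (hI : Inst vt K σ S h) (hr : Removal vt K σ R σ') (hRK : R ⊆ K)
    (hR : 2 ≤ #R) (h3 : CutGe vt K σ 3) (h4 : CutGeFour vt K σ) (hN : #(dcut vt σ R) ≤ 6)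
    (hl : ∀ d, vt d ∈ K → vt d ∉ R → vt (σ d) ∈ R → vt (σ' d) ≠ vt d) {C₀ : Finset W}
    (h0 : SClosed vt K σ S C₀)
    (hH : ∀ d ∈ S, vt d ∈ K → vt d ∉ R → vt d ∉ C₀ → vt (σ d) ∉ R)
    (hm : vt h ∉ R) (hm' : vt (σ h) ∉ R)
    (hc2 : ∀ C, IsComp vt K σ S C → Disjoint C R → Disjoint C C₀ → ∀ Y ⊆ K \ R,
      vt h ∈ Y ∨ vt (σ h) ∈ Y → Disjoint Y C → (∀ d ∈ dcut vt σ' Y, vt (σ' d) ∈ C) →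
      #(dcut vt σ' Y) ≤ 2 →
      (∀ d, vt d ∈ K → vt d ∉ R → vt (σ d) ∈ R → vt d ∈ Y ∨ vt (σ' d) ∈ Y) ∨
        ∀ d, vt d ∈ Y → vt (σ d) ∈ R → vt (σ' d) ∉ Y) :
    Inst vt (K \ R) σ' (dropComp vt S C₀) h := by
  have hc := hI.cub
  have hσ := hr.agree h hI.mem hm hm'
  refine ⟨hr.cub, hr.cutGe_two hc hRK hR h3 h4 hN hl, hr.isTwoReg hc hI.reg h0 hH,
    mem_sdiff.2 ⟨hI.mem, hm⟩, ?_, ?_, ?_⟩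
  · rw [mem_dropComp]; exact fun hh => hI.notMem hh.1
  · intro C hC
    rw [hσ]
    exact hI.c1 C ((hr.isComp_iff hH).1 hC).1
  · intro C hC Y hY hhY hdis hland
    rw [hσ] at hhY
    obtain ⟨k1, k2, k3⟩ := (hr.isComp_iff hH).1 hC
    by_contra hlt
    have hne : Y.Nonempty := by
      rcases hhY with hh | hh
      exacts [⟨_, hh⟩, ⟨_, hh⟩]
    obtain ⟨v, hv⟩ := k1.nonempty
    rcases hc2 C k1 k2 k3 Y hY hhY hdis hland (by omega) with hp | hp
    · rw [hr.card_dcut_union hc hRK hY hp] at hlt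
      apply hlt
      apply h3 _ (union_subset (hY.trans sdiff_subset) hRK) (hne.mono subset_union_left)
      intro he
      have := k1.sub hv
      rw [← he, mem_union] at this
      exact this.elim (fun q => Finset.disjoint_left.1 hdis q hv)
        (fun q => Finset.disjoint_left.1 k2 hv q)
    · rw [hr.dcut_eq hY hp] at hlt
      apply hlt
      apply h3 _ (hY.trans sdiff_subset) hne
      rintro rfl
      exact Finset.disjoint_left.1 hdis (k1.sub hv) hv

/-- If a closed set `C` is entered from `R` at exactly two darts, then a set whose boundary lands
away from `C` contains both or neither of their ends. -/
theorem Removal.parity (hc : IsCubic vt K σ) (hr : Removal vt K σ R σ') (hS : IsTwoReg vt K σ S)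
    {C C' Y : Finset W} (hC : SClosed vt K σ S C) (hCC : Disjoint C C') (hY : Y ⊆ K \ R)
    (hland : ∀ d ∈ dcut vt σ' Y, vt (σ' d) ∈ C') {a b : D} (ha : a ∈ S) (hb : b ∈ S)
    (hab : a ≠ b) (haC : vt a ∈ C) (hbC : vt b ∈ C) (haR : vt (σ a) ∈ R) (hbR : vt (σ b) ∈ R)
    (hall : ∀ d ∈ S, vt d ∈ C → vt d ∉ R → vt (σ d) ∈ R → d = a ∨ d = b) :
    vt a ∈ Y ↔ vt b ∈ Y := by
  have hYR : ∀ v ∈ Y, v ∉ R := fun v hv => (mem_sdiff.1 (hY hv)).2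
  have key : ∀ d, d ∈ S ∩ dcut vt σ (C ∩ Y) ↔ (d = a ∨ d = b) ∧ vt d ∈ Y := by
    intro d
    simp only [mem_inter, mem_dcut]
    constructor
    · rintro ⟨q1, ⟨q2, q3⟩, q4⟩
      refine ⟨?_, q3⟩
      have q5 := hC.closed d q1 q2
      by_cases q6 : vt (σ d) ∈ R
      · exact hall d q1 q2 (hYR _ q3) q6
      · exfalso
        have q7 := hr.agree d (hC.sub q2) (hYR _ q3) q6
        have := hland d (mem_dcut.2 ⟨q3, by rw [q7]; tauto⟩)
        rw [q7] at this
        exact Finset.disjoint_left.1 hCC q5 this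
    · rintro ⟨rfl | rfl, q⟩
      · exact ⟨ha, ⟨haC, q⟩, fun k => hYR _ k.2 haR⟩
      · exact ⟨hb, ⟨hbC, q⟩, fun k => hYR _ k.2 hbR⟩
  have he := even_card_inter_dcut hc hS (inter_subset_left.trans hC.sub : C ∩ Y ⊆ K)
  by_cases h1 : vt a ∈ Y <;> by_cases h2 : vt b ∈ Y <;> simp only [h1, h2]
  · have : S ∩ dcut vt σ (C ∩ Y) = {a} := by ext d; rw [key, mem_singleton]; grind
    rw [this] at he
    simp at he
  · have : S ∩ dcut vt σ (C ∩ Y) = {b} := by ext d; rw [key, mem_singleton]; grind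
    rw [this] at he
    simp at he

theorem GirthFour.ends (hc : IsCubic vt K σ) (hG : GirthFour vt K σ) (ht : vt t ∈ K)
    (l : vt g₁ = vt t ∧ vt g₁' = vt t) (r : vt g₂ = vt (σ t) ∧ vt g₂' = vt (σ t))
    (dl : g₁ ≠ t ∧ g₁' ≠ t ∧ g₁ ≠ g₁') (dr : g₂ ≠ σ t ∧ g₂' ≠ σ t ∧ g₂ ≠ g₂')
    (all₁ : ∀ x, vt x = vt t → x = t ∨ x = g₁ ∨ x = g₁')
    (all₂ : ∀ x, vt x = vt (σ t) → x = σ t ∨ x = g₂ ∨ x = g₂') :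
    Ends vt K σ t g₁ g₁' g₂ g₂' := by
  have hi := hc.inv t ht
  have hm := hc.mem t ht
  have k1 : ∀ g, vt g = vt t → g ≠ t → vt (σ g) ≠ vt t ∧ vt (σ g) ≠ vt (σ t) := fun g q1 q2 =>
    ⟨q1 ▸ hG.loop g (q1 ▸ ht), fun q => q2 (hG.parallel g t (q1 ▸ ht) q1 q)⟩
  have k2 : ∀ g, vt g = vt (σ t) → g ≠ σ t → vt (σ g) ≠ vt t ∧ vt (σ g) ≠ vt (σ t) :=
    fun g q1 q2 => ⟨fun q => q2 (hG.parallel g (σ t) (q1 ▸ hm) q1 (by rw [hi, q])),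
      q1 ▸ hG.loop g (q1 ▸ hm)⟩
  exact ⟨ht, hG.loop t ht, l, r, dl, dr, k1 _ l.1 dl.1, k1 _ l.2 dl.2.1, k2 _ r.1 dr.1,
    k2 _ r.2 dr.2.1, all₁, all₂⟩

theorem Ends.sub (hc : IsCubic vt K σ) (he : Ends vt K σ t g₁ g₁' g₂ g₂') :
    ({vt t, vt (σ t)} : Finset W) ⊆ K := by
  intro v hv
  have := hc.mem t he.mem
  have := he.mem
  grind

theorem Ends.dcut_iff (hc : IsCubic vt K σ) (he : Ends vt K σ t g₁ g₁' g₂ g₂') (d : D) :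
    vt d ∈ ({vt t, vt (σ t)} : Finset W) ∧ vt (σ d) ∉ ({vt t, vt (σ t)} : Finset W) ↔
      d = g₁ ∨ d = g₁' ∨ d = g₂ ∨ d = g₂' := by
  obtain ⟨a1, a2, ⟨a3, a3'⟩, ⟨a4, a4'⟩, a5, a6, a7, a8, a9, a10, a11, a12⟩ := he
  have := a11 d
  have := a12 d
  have := hc.inv t
  simp only [mem_insert, mem_singleton]
  constructor
  · grind
  · rintro (rfl | rfl | rfl | rfl) <;> grind

theorem Ends.card_dcut (hc : IsCubic vt K σ) (he : Ends vt K σ t g₁ g₁' g₂ g₂') :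
    #(dcut vt σ {vt t, vt (σ t)}) ≤ 6 := by
  have : dcut vt σ {vt t, vt (σ t)} ⊆ {g₁, g₁', g₂, g₂'} := by
    intro d hd
    rw [mem_dcut, he.dcut_iff hc] at hd
    simpa using hd
  exact (Finset.card_le_card this).trans (Finset.card_le_four.trans (by norm_num))

theorem Ends.exists_removal (hc : IsCubic vt K σ) (he : Ends vt K σ t g₁ g₁' g₂ g₂') :
    ∃ σ', Removal vt K σ {vt t, vt (σ t)} σ' ∧ σ' (σ g₁) = σ g₂ ∧ σ' (σ g₂) = σ g₁ ∧
      σ' (σ g₁') = σ g₂' ∧ σ' (σ g₂') = σ g₁' := by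
  have hiff := he.dcut_iff hc
  have h1 := he.l
  have h2 := he.r
  have h3 := he.ne
  have h4 := he.dl
  have h5 := he.dr
  apply exists_removal_two hc (he.sub hc)
  all_goals first
    | exact (hiff _).2 (by tauto)
    | grind

theorem Ends.enter (hc : IsCubic vt K σ) (he : Ends vt K σ t g₁ g₁' g₂ g₂') {d : D}
    (hd : vt d ∈ K) (hR : vt d ∉ ({vt t, vt (σ t)} : Finset W))
    (hσ : vt (σ d) ∈ ({vt t, vt (σ t)} : Finset W)) :
    d = σ g₁ ∨ d = σ g₁' ∨ d = σ g₂ ∨ d = σ g₂' := by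
  have hi := hc.inv d hd
  have := (he.dcut_iff hc (σ d)).1 ⟨hσ, by rwa [hi]⟩
  grind

theorem Ends.no_loop (hc : IsCubic vt K σ) (hG : GirthFour vt K σ)
    (he : Ends vt K σ t g₁ g₁' g₂ g₂') (e1 : σ' (σ g₁) = σ g₂) (e2 : σ' (σ g₂) = σ g₁)
    (e3 : σ' (σ g₁') = σ g₂') (e4 : σ' (σ g₂') = σ g₁') (d : D) (hd : vt d ∈ K)
    (hR : vt d ∉ ({vt t, vt (σ t)} : Finset W)) (hσ : vt (σ d) ∈ ({vt t, vt (σ t)} : Finset W)) :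
    vt (σ' d) ≠ vt d := by
  have k1 : vt (σ g₂) ≠ vt (σ g₁) :=
    hG.triangle t g₁ g₂ he.mem he.l.1.symm he.dl.1.symm he.r.1
  have k2 : vt (σ g₂') ≠ vt (σ g₁') :=
    hG.triangle t g₁' g₂' he.mem he.l.2.symm he.dl.2.1.symm he.r.2
  rcases he.enter hc hd hR hσ with rfl | rfl | rfl | rfl
  · rwa [e1]
  · rwa [e3]
  · rw [e2]; exact k1.symm
  · rw [e4]; exact k2.symm

/-- Extending a perfect matching over a reduced edge. -/
theorem Ends.lift (hc : IsCubic vt K σ) (he : Ends vt K σ t g₁ g₁' g₂ g₂')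
    (hr : Removal vt K σ {vt t, vt (σ t)} σ') (e2 : σ' (σ g₂) = σ g₁)
    (e3 : σ' (σ g₁') = σ g₂') (e4 : σ' (σ g₂') = σ g₁') {F : Set D}
    (hF : IsPM vt (K \ {vt t, vt (σ t)}) σ' F) (hg : σ g₁ ∉ F) :
    ∃ F', IsPM vt K σ F' ∧ (∀ d, vt d ∉ ({vt t, vt (σ t)} : Finset W) → d ∈ F → d ∈ F') ∧
      (t ∈ F' ∨ g₁' ∈ F' ∧ g₂' ∈ F') := by
  have hiff := he.dcut_iff hc
  have hent := fun d => he.enter hc (d := d)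
  have hin : ∀ v, v ∈ ({vt t, vt (σ t)} : Finset W) ↔ v = vt t ∨ v = vt (σ t) := by simp
  have hRt : vt t ∈ ({vt t, vt (σ t)} : Finset W) := by simp
  have hRt' : vt (σ t) ∈ ({vt t, vt (σ t)} : Finset W) := by simp
  have hRK := he.sub hc
  generalize ({vt t, vt (σ t)} : Finset W) = R at *
  have it := hc.inv t he.mem
  have mt := hc.mem t he.mem
  obtain ⟨q1, q1'⟩ := (hiff g₁).2 (by simp)
  obtain ⟨q2, q2'⟩ := (hiff g₁').2 (by simp)
  obtain ⟨q3, q3'⟩ := (hiff g₂).2 (by simp)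
  obtain ⟨q4, q4'⟩ := (hiff g₂').2 (by simp)
  have m1 := hc.mem g₁ (hRK q1)
  have m2 := hc.mem g₁' (hRK q2)
  have m3 := hc.mem g₂ (hRK q3)
  have m4 := hc.mem g₂' (hRK q4)
  have i1 := hc.inv g₁ (hRK q1)
  have i2 := hc.inv g₁' (hRK q2)
  have i3 := hc.inv g₂ (hRK q3)
  have i4 := hc.inv g₂' (hRK q4)
  have hg2 : σ g₂ ∉ F := fun hh => hg (by
    have := hF.symm _ hh (mem_sdiff.2 ⟨m3, q3'⟩)
    rwa [e2] at this)
  have hg' : σ g₁' ∈ F ↔ σ g₂' ∈ F := by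
    constructor
    · intro hh
      have := hF.symm _ hh (mem_sdiff.2 ⟨m2, q2'⟩)
      rwa [e3] at this
    · intro hh
      have := hF.symm _ hh (mem_sdiff.2 ⟨m4, q4'⟩)
      rwa [e4] at this
  have hM : ∃ M : Set D, (∀ v ∈ R, ∃ d ∈ M, vt d = v) ∧
      (∀ d ∈ M, ∀ e ∈ M, vt d = vt e → d = e) ∧ (∀ d ∈ M, vt (σ d) ∈ R → σ d ∈ M) ∧
      (g₁ ∉ M ∧ g₂ ∉ M ∧ (g₁' ∈ M ↔ σ g₁' ∈ F) ∧ (g₂' ∈ M ↔ σ g₂' ∈ F)) ∧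
      (t ∈ M ∨ g₁' ∈ M ∧ g₂' ∈ M) := by
    obtain ⟨a1, a2, ⟨a3, a3'⟩, ⟨a4, a4'⟩, ⟨a5, a5', a5''⟩, ⟨a6, a6', a6''⟩, -, -, -, -, -, -⟩ := he
    by_cases hh : σ g₁' ∈ F
    · refine ⟨{g₁', g₂'}, ?_, ?_, ?_, ?_, by simp⟩
      all_goals simp only [Set.mem_insert_iff, Set.mem_singleton_iff]
      · intro v hv
        rcases (hin v).1 hv with rfl | rfl
        exacts [⟨g₁', by simp, a3'⟩, ⟨g₂', by simp, a4'⟩]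
      · rintro d (rfl | rfl) e (rfl | rfl) <;> grind
      · rintro d (rfl | rfl) <;> grind
      · refine ⟨?_, ?_, ?_, ?_⟩ <;> grind
    · refine ⟨{t, σ t}, ?_, ?_, ?_, ?_, by simp⟩
      all_goals simp only [Set.mem_insert_iff, Set.mem_singleton_iff]
      · intro v hv
        rcases (hin v).1 hv with rfl | rfl
        exacts [⟨t, by simp, rfl⟩, ⟨σ t, by simp, rfl⟩]
      · rintro d (rfl | rfl) e (rfl | rfl) <;> grind
      · rintro d (rfl | rfl) <;> grind
      · refine ⟨?_, ?_, ?_, ?_⟩ <;> grind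
  obtain ⟨M, M1, M2, M3, ⟨M4, M5, M6, M7⟩, M8⟩ := hM
  have hG := IsPM.glue hc (X := R) (F₁ := M) (F₂ := F) (fun v _ => M1 v)
    (fun v hv hvR => hF.ex v (mem_sdiff.2 ⟨hv, hvR⟩)) (fun d hd e he _ _ => M2 d hd e he)
    (fun d hd e he k1 k2 => hF.uniq d hd e he (mem_sdiff.2 ⟨k1, k2⟩))
    (fun d hd _ _ => M3 d hd)
    (fun d hd k1 k2 k3 => by
      rw [← hr.agree d k1 k2 k3]
      exact hF.symm d hd (mem_sdiff.2 ⟨k1, k2⟩))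
    (fun d k1 k2 k3 => by
      rcases (hiff d).1 ⟨k2, k3⟩ with rfl | rfl | rfl | rfl
      · exact iff_of_false M4 hg
      · exact M6
      · exact iff_of_false M5 hg2
      · exact M7)
  refine ⟨_, hG, fun d k1 k2 => Or.inr ⟨k1, k2⟩, ?_⟩
  rcases M8 with k | k
  · exact Or.inl (Or.inl ⟨hRt, k⟩)
  · exact Or.inr ⟨Or.inl ⟨q2, k.1⟩, Or.inl ⟨q4, k.2⟩⟩

end

section
variable {W D : Type*} [DecidableEq W] [DecidableEq D] [Fintype D] {vt : D → W}
  {K R X : Finset W} {σ σ' : D → D} {S : Finset D} {h t g₁ g₁' g₂ g₂' : D}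

theorem GirthFour.not_subset_pair (hc : IsCubic vt K σ) (hG : GirthFour vt K σ)
    (hS : IsTwoReg vt K σ S) {C : Finset W} (hC : IsComp vt K σ S C) (v w : W) :
    ¬ C ⊆ {v, w} := by
  intro hs
  obtain ⟨x, hx⟩ := hC.nonempty
  obtain ⟨d, hd, e, he, hne, rfl, e1, d2, e2⟩ := hC.exists_two hc hS hx
  have hK := hC.sub hx
  have k1 := hG.loop d hK
  have k2 := hG.loop e (e1 ▸ hK)
  have k3 := mt (hG.parallel d e hK e1.symm) hne
  have q1 := hs hx
  have q2 := hs d2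
  have q3 := hs e2
  simp only [mem_insert, mem_singleton] at q1 q2 q3
  grind

theorem Ends.good (hI : Inst vt K σ S h) (h3 : CutGe vt K σ 3) (h4 : CutGeFour vt K σ)
    (hG : GirthFour vt K σ)
    (IH : ∀ K' σ' S' h', #K' < #K → Inst vt K' σ' S' h' → Good vt K' σ' S' h')
    (he : Ends vt K σ t g₁ g₁' g₂ g₂') {C₀ : Finset W} (h0 : SClosed vt K σ S C₀)
    (hH : ∀ d ∈ S, vt d ∈ K → vt d ∉ ({vt t, vt (σ t)} : Finset W) → vt d ∉ C₀ →
      vt (σ d) ∉ ({vt t, vt (σ t)} : Finset W))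
    (hm : vt h ∉ ({vt t, vt (σ t)} : Finset W)) (hm' : vt (σ h) ∉ ({vt t, vt (σ t)} : Finset W))
    (hg : vt (σ g₁) = vt h) (hgh : σ g₁ ≠ h)
    (hu : ∀ C, IsComp vt K σ S C → Disjoint C C₀ → vt h ∉ C)
    (hhit : ∀ C, IsComp vt K σ S C → C ⊆ C₀ → (t ∈ S ∧ vt t ∈ C) ∧
      (g₁' ∈ S ∧ vt g₁' ∈ C ∨ g₂' ∈ S ∧ vt g₂' ∈ C))
    (hc2 : ∀ σ', Removal vt K σ {vt t, vt (σ t)} σ' → σ' (σ g₁) = σ g₂ → σ' (σ g₂) = σ g₁ →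
      σ' (σ g₁') = σ g₂' → σ' (σ g₂') = σ g₁' → ∀ C, IsComp vt K σ S C →
      Disjoint C {vt t, vt (σ t)} → Disjoint C C₀ → ∀ Y ⊆ K \ {vt t, vt (σ t)}, vt h ∈ Y →
      Disjoint Y C → (∀ d ∈ dcut vt σ' Y, vt (σ' d) ∈ C) → #(dcut vt σ' Y) ≤ 2 →
      vt (σ g₂) ∈ Y → vt (σ g₁') ∈ Y ∨ vt (σ g₂') ∈ Y) :
    Good vt K σ S h := by
  have hc := hI.cub
  obtain ⟨σ', hr, e1, e2, e3, e4⟩ := he.exists_removal hc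
  have hRK := he.sub hc
  have hI' : Inst vt (K \ {vt t, vt (σ t)}) σ' (dropComp vt S C₀) h := by
    apply hr.inst hI hRK (by rw [Finset.card_pair he.ne.symm]) h3 h4 (he.card_dcut hc)
      (he.no_loop hc hG e1 e2 e3 e4) h0 hH hm hm'
    intro C hC hCR hC0 Y hY hhY hdis hland hcard
    have hhY' : vt h ∈ Y := by
      rcases hhY with hh | hh
      · exact hh
      by_contra hcon
      have i := hc.inv h hI.mem
      have a := hr.agree (σ h) (hc.mem h hI.mem) hm' (by rwa [i])
      rw [i] at a
      have := hland (σ h) (mem_dcut.2 ⟨hh, by rwa [a]⟩)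
      rw [a] at this
      exact hu C hC hC0 this
    have key := hc2 σ' hr e1 e2 e3 e4 C hC hCR hC0 Y hY hhY' hdis hland hcard
    have hent := fun d => he.enter hc (d := d)
    by_cases hq : vt (σ g₁') ∈ Y ∨ vt (σ g₂') ∈ Y
    · left
      intro d k1 k2 k3
      rcases hent d k1 k2 k3 with rfl | rfl | rfl | rfl
      · rw [hg]; exact Or.inl hhY'
      · rw [e3]; exact hq
      · rw [e2, hg]; exact Or.inr hhY'
      · rw [e4]; exact hq.symm
    · right
      intro d k1 k2
      have hk := hY k1
      rw [mem_sdiff] at hk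
      rcases hent d hk.1 hk.2 k2 with rfl | rfl | rfl | rfl
      · rw [e1]; exact fun hh => hq (key hh)
      · exact absurd (Or.inl k1) hq
      · exact absurd (key k1) hq
      · exact absurd (Or.inr k1) hq
  have hlt : #(K \ {vt t, vt (σ t)}) < #K :=
    Finset.card_lt_card ((sdiff_subset).ssubset_of_ne (by
      intro hh
      have := he.mem
      rw [← hh] at this
      simp at this))
  obtain ⟨F, hF, hhF, hFC⟩ := IH _ _ _ _ hlt hI'
  have hgF : σ g₁ ∉ F := fun hh => hgh (hF.uniq _ hh _ hhF (by
    rw [hg]; exact mem_sdiff.2 ⟨hI.mem, hm⟩) hg)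
  obtain ⟨F', hF', hsub, hM⟩ := he.lift hc hr e2 e3 e4 hF hgF
  refine ⟨F', hF', hsub h hm hhF, fun C hC => ?_⟩
  rcases hr.comp_cases h0 hH hC with k | k | k
  · obtain ⟨q1, q2⟩ := hhit C hC k
    rcases hM with r | r
    · exact ⟨t, r, q1⟩
    · rcases q2 with q2 | q2
      exacts [⟨_, r.1, q2⟩, ⟨_, r.2, q2⟩]
  · exact absurd k (hG.not_subset_pair hc hI.reg hC _ _)
  · obtain ⟨d, d1, d2, d3⟩ := hFC C k
    have := (mem_sdiff.1 (k.sub d3)).2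
    exact ⟨d, hsub d this d1, (mem_dropComp.1 d2).1, d3⟩

/-- The start of `h` lies on a component. -/
theorem Inst.good_of_mem_comp (hI : Inst vt K σ S h) (h3 : CutGe vt K σ 3) (h4 : CutGeFour vt K σ)
    (hG : GirthFour vt K σ)
    (IH : ∀ K' σ' S' h', #K' < #K → Inst vt K' σ' S' h' → Good vt K' σ' S' h')
    {C₀ : Finset W} (hC : IsComp vt K σ S C₀) (hu : vt h ∈ C₀) : Good vt K σ S h := by
  have hc := hI.cub
  have hv := hI.c1 _ hC hu
  obtain ⟨s, hs, hsh⟩ := hC.on _ hu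
  have hsK : vt s ∈ K := hsh ▸ hI.mem
  have hs1 := hI.reg.symm s hs hsK
  have ms := hc.mem s hsK
  have is := hc.inv s hsK
  have hs2 := hC.closed s hs (hsh ▸ hu)
  obtain ⟨t, f₁, a1, a2, a3, a4, a5, a6, a7, a8⟩ := hI.reg.exists_of_mem hc ms hs1
  have htK : vt t ∈ K := a4 ▸ ms
  have ht1 := hI.reg.symm t a6 htK
  have mt := hc.mem t htK
  have it := hc.inv t htK
  have ht2 := hC.closed t a6 (a4 ▸ hs2)
  obtain ⟨r, f₂, b1, b2, b3, b4, b5, b6, b7, b8⟩ := hI.reg.exists_of_mem hc mt ht1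
  have he : Ends vt K σ t (σ s) f₁ f₂ r := hG.ends hc htK ⟨a4.symm, a5.trans a4.symm⟩ ⟨b5, b4⟩
    ⟨a1.symm, a3.symm, a2.symm⟩ ⟨b2, b1, b3.symm⟩
    (fun x hx => by have := a8 x (hx.trans a4); tauto) (fun x hx => by have := b8 x hx; tauto)
  have o1 := he.out₁
  have ht3 : vt t ∈ C₀ := a4 ▸ hs2
  have hrK : vt r ∈ K := b4 ▸ mt
  have hr1 := hI.reg.symm r b6 hrK
  have ir := hc.inv r hrK
  have hr3 := hC.closed r b6 (b4 ▸ ht2)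
  have hRC : ∀ v ∈ ({vt t, vt (σ t)} : Finset W), v ∈ C₀ := by
    intro v hv
    simp only [mem_insert, mem_singleton] at hv
    rcases hv with rfl | rfl <;> assumption
  refine he.good hI h3 h4 hG IH hC.toSClosed ?_ ?_ ?_ (by rw [is, hsh]) ?_ ?_ ?_ ?_
  · intro d hd hK _ hdC hσ
    have := hC.closed _ (hI.reg.symm d hd hK) (hRC _ hσ)
    rw [hc.inv d hK] at this
    exact hdC this
  · rw [is, hsh] at o1
    simp only [mem_insert, mem_singleton]; tauto
  · exact fun hh => hv (hRC _ hh)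
  · rw [is]; rintro rfl; exact hI.notMem hs
  · exact fun C _ hd hh => Finset.disjoint_left.1 hd hh hu
  · intro C hC' hs
    have := hC.min C hs hC'.nonempty hC'.toSClosed
    subst this
    exact ⟨⟨a6, ht3⟩, Or.inr ⟨b6, b4 ▸ ht2⟩⟩
  · intro σ' hr _ _ _ _ C hC' hCR hC0 Y hY hhY hdis hland _ _
    right
    rw [← hr.parity hc hI.reg hC.toSClosed hC0.symm hY hland hs hr1 (a := s) (b := σ r) ?_
      (hsh ▸ hu) hr3 ?_ ?_ ?_, hsh]
    · exact hhY
    · intro hh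
      have q := he.ne
      rw [hh, ir] at a4
      exact q (b4.symm.trans a4.symm)
    · simp [a4]
    · simp [ir, b4]
    · intro d k1 k2 k3 k4
      have hdK := hC.sub k2
      have := hI.reg.symm d k1 hdK
      rcases he.enter hc hdK k3 k4 with rfl | rfl | rfl | rfl
      · left; exact is
      · rw [hc.inv f₁ (a5 ▸ ms)] at this; exact absurd this a7
      · rw [hc.inv f₂ (b5 ▸ mt)] at this; exact absurd this b7
      · right; rfl

/-- The vertices `vt h`, `vt (σ h)` are off all components and a neighbour of `vt h` is on one. -/
theorem Inst.good_of_adj_comp (hI : Inst vt K σ S h) (h3 : CutGe vt K σ 3)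
    (h4 : CutGeFour vt K σ) (hG : GirthFour vt K σ)
    (IH : ∀ K' σ' S' h', #K' < #K → Inst vt K' σ' S' h' → Good vt K' σ' S' h')
    (hu : ∀ e ∈ S, vt e ≠ vt h) (hv : ∀ e ∈ S, vt e ≠ vt (σ h)) {d : D} (hd : vt d = vt h)
    {C₀ : Finset W} (hC : IsComp vt K σ S C₀) (hdC : vt (σ d) ∈ C₀) : Good vt K σ S h := by
  have hc := hI.cub
  have hdK : vt d ∈ K := hd ▸ hI.mem
  have md := hc.mem d hdK
  have jd := hc.inv d hdK
  have hd1 : σ d ∉ S := fun hh => by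
    have := hI.reg.symm _ hh md
    rw [jd] at this
    exact hu _ this hd
  have hon : ∀ v ∈ C₀, v ≠ vt h ∧ v ≠ vt (σ h) := by
    intro v hv'
    obtain ⟨e, he, rfl⟩ := hC.on v hv'
    exact ⟨hu e he, hv e he⟩
  have hdh : d ≠ h := by rintro rfl; exact (hon _ hdC).2 rfl
  obtain ⟨t, s, a1, a2, a3, a4, a5, a6, a7, a8⟩ := hI.reg.exists_of_notMem hc md hd1 (hC.on _ hdC)
  have htK : vt t ∈ K := a4 ▸ md
  have ht1 := hI.reg.symm t a6 htK
  have mt := hc.mem t htK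
  have it := hc.inv t htK
  have ht2 := hC.closed t a6 (a4 ▸ hdC)
  have hsK : vt s ∈ K := a5 ▸ md
  have hs1 := hI.reg.symm s a7 hsK
  have is := hc.inv s hsK
  have hs2 := hC.closed s a7 (a5 ▸ hdC)
  obtain ⟨r, f₂, b1, b2, b3, b4, b5, b6, b7, b8⟩ := hI.reg.exists_of_mem hc mt ht1
  have he : Ends vt K σ t (σ d) s r f₂ := hG.ends hc htK ⟨a4.symm, a5.trans a4.symm⟩ ⟨b4, b5⟩
    ⟨a1.symm, a3.symm, a2.symm⟩ ⟨b1, b2, b3⟩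
    (fun x hx => by have := a8 x (hx.trans a4); tauto) (fun x hx => by have := b8 x hx; tauto)
  have hrK : vt r ∈ K := b4 ▸ mt
  have hr1 := hI.reg.symm r b6 hrK
  have ir := hc.inv r hrK
  have hr3 := hC.closed r b6 (b4 ▸ ht2)
  have ht3 : vt t ∈ C₀ := a4 ▸ hdC
  have hRC : ∀ v ∈ ({vt t, vt (σ t)} : Finset W), v ∈ C₀ := by
    intro v hv
    simp only [mem_insert, mem_singleton] at hv
    rcases hv with rfl | rfl <;> assumption
  refine he.good hI h3 h4 hG IH hC.toSClosed ?_ ?_ ?_ (by rw [jd, hd]) (by rwa [jd]) ?_ ?_ ?_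
  · intro d hd hK _ hdC hσ
    have := hC.closed _ (hI.reg.symm d hd hK) (hRC _ hσ)
    rw [hc.inv d hK] at this
    exact hdC this
  · exact fun hh => (hon _ (hRC _ hh)).1 rfl
  · exact fun hh => (hon _ (hRC _ hh)).2 rfl
  · intro C hC' _ hh
    obtain ⟨e, he, he'⟩ := hC'.on _ hh
    exact hu e he he'
  · intro C hC' hs
    have := hC.min C hs hC'.nonempty hC'.toSClosed
    subst this
    exact ⟨⟨a6, ht3⟩, Or.inl ⟨a7, a5 ▸ hdC⟩⟩
  · intro σ' hr _ _ _ _ C hC' hCR hC0 Y hY hhY hdis hland _ hrY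
    left
    rw [← hr.parity hc hI.reg hC.toSClosed hC0.symm hY hland hr1 hs1 (a := σ r) (b := σ s) ?_
      hr3 hs2 ?_ ?_ ?_]
    · exact hrY
    · intro hh
      have : r = s := by rw [← ir, hh, is]
      have q := he.ne
      subst this
      exact q (by rw [← b4, a5, a4])
    · simp [ir, b4]
    · simp [is, a5, a4]
    · intro e k1 k2 k3 k4
      have heK := hC.sub k2
      have := hI.reg.symm e k1 heK
      rcases he.enter hc heK k3 k4 with rfl | rfl | rfl | rfl
      · rw [jd] at this; rw [jd] at k1; exact absurd hd (hu _ k1)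
      · right; rfl
      · left; rfl
      · rw [hc.inv f₂ (b5 ▸ mt)] at this; exact absurd this b7

end

section
variable {W D : Type*} [DecidableEq W] [DecidableEq D] [Fintype D] {vt : D → W}
  {K R Y X₁ X₂ C C₁ C₂ : Finset W} {σ σ' : D → D} {S : Finset D} {e₀ e₁ e₂ : D}

/-- A set whose boundary has four darts: two prescribed ones, and others landing in a component
disjoint from the set. -/
structure Tight (vt : D → W) (K : Finset W) (σ : D → D) (S : Finset D) (X C : Finset W)
    (e₀ e₁ : D) : Prop where
  sub : X ⊆ K
  comp : IsComp vt K σ S C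
  disj : Disjoint X C
  card : #(dcut vt σ X) = 4
  land : ∀ d ∈ dcut vt σ X, d = e₀ ∨ d = e₁ ∨ vt (σ d) ∈ C
  mem₀ : vt e₀ ∈ X
  mem₁ : vt e₁ ∈ X
  out₀ : vt (σ e₀) ∉ X
  out₁ : vt (σ e₁) ∉ X

theorem Tight.not_disjoint (hc : IsCubic vt K σ) (h3 : CutGe vt K σ 3)
    (h1 : Tight vt K σ S X₁ C₁ e₀ e₁)
    (h2 : Tight vt K σ S X₂ C₂ e₀ e₂) (hne₁ : e₂ ≠ e₁) (hne₀ : e₂ ≠ e₀) (o₁ : vt (σ e₁) ∉ X₂)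
    (o₂ : vt (σ e₂) ∉ X₁) (l₂ : vt (σ e₂) ∉ C₁) : ¬ Disjoint C₁ X₂ := by
  intro hd
  have hlt : ∀ d, vt d ∈ X₁ → vt (σ d) ∈ X₂ → vt (σ d) ∈ X₁ := by
    intro d k1 k2
    by_contra k3
    rcases h1.land d (mem_dcut.2 ⟨k1, k3⟩) with rfl | rfl | k
    · exact h2.out₀ k2
    · exact o₁ k2
    · exact Finset.disjoint_left.1 hd k k2
  have hK : ∀ Y ⊆ X₂, Y ≠ K := by
    rintro Y hY rfl
    obtain ⟨v, hv⟩ := h2.comp.nonempty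
    exact Finset.disjoint_left.1 h2.disj (hY (h2.comp.sub hv)) hv
  have hsplit : #(dcut vt σ (X₁ ∩ X₂)) + #(dcut vt σ (X₂ \ X₁)) = #(dcut vt σ X₂) := by
    have hlt' : ∀ d, vt d ∈ X₂ → vt d ∉ X₁ → vt (σ d) ∈ X₂ → vt (σ d) ∉ X₁ := by
      intro d k1 k2 k3 k4
      have i := hc.inv d (h2.sub k1)
      have := hlt (σ d) k4 (by rwa [i])
      rw [i] at this
      exact k2 this
    rw [← card_union_of_disjoint]
    · congr 1
      ext d
      have := hlt d
      have := hlt' d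
      simp only [mem_union, mem_dcut, mem_inter, mem_sdiff]
      tauto
    · rw [Finset.disjoint_left]
      intro d
      simp only [mem_dcut, mem_inter, mem_sdiff]
      tauto
  have := h3 (X₁ ∩ X₂) (inter_subset_right.trans h2.sub) ⟨vt e₀, mem_inter.2 ⟨h1.mem₀, h2.mem₀⟩⟩
    (hK _ inter_subset_right)
  have h2c := h2.card
  rcases (X₂ \ X₁).eq_empty_or_nonempty with hE | hE
  · have hm : vt e₂ ∈ X₁ := Finset.sdiff_eq_empty_iff_subset.1 hE h2.mem₁
    rcases h1.land e₂ (mem_dcut.2 ⟨hm, o₂⟩) with k | k | k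
    exacts [hne₀ k, hne₁ k, l₂ k]
  · have := h3 _ (sdiff_subset.trans h2.sub) hE (hK _ sdiff_subset)
    omega

theorem Tight.subset (h1 : Tight vt K σ S X₁ C₁ e₀ e₁) (h2 : Tight vt K σ S X₂ C₂ e₀ e₂)
    (l₀ : vt (σ e₀) ∉ C₁) (l₂ : vt (σ e₂) ∉ C₁) (hn : ¬ Disjoint C₁ X₂) : C₁ ⊆ X₂ := by
  intro w hw
  by_contra hwX
  obtain ⟨v, hv, hvX⟩ := Finset.not_disjoint_iff.1 hn
  obtain ⟨d, k1, k2, k3, k4⟩ := h1.comp.exists_cross hv hw hvX hwX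
  have k5 := h1.comp.closed d k1 k2
  rcases h2.land d (mem_dcut.2 ⟨k3, k4⟩) with rfl | rfl | k
  · exact l₀ k5
  · exact l₂ k5
  · have := h1.comp.eq_of_mem h2.comp k5 k
    subst this
    exact Finset.disjoint_left.1 h2.disj k3 k2

theorem Tight.uncross (hc : IsCubic vt K σ) (h3 : CutGe vt K σ 3) (h4 : CutGeFour vt K σ)
    (h1 : Tight vt K σ S X₁ C₁ e₀ e₁)
    (h2 : Tight vt K σ S X₂ C₂ e₀ e₂) (hne : vt (σ e₁) ≠ vt (σ e₀)) (hne₁ : e₂ ≠ e₁)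
    (hne₀ : e₂ ≠ e₀)
    (o₁ : vt (σ e₁) ∉ X₂) (o₂ : vt (σ e₂) ∉ X₁)
    (l₀ : ∀ C, C = C₁ ∨ C = C₂ → vt (σ e₀) ∉ C)
    (l₁ : ∀ C, C = C₁ ∨ C = C₂ → vt (σ e₁) ∉ C)
    (l₂ : ∀ C, C = C₁ ∨ C = C₂ → vt (σ e₂) ∉ C) : False := by
  have hne' : e₁ ≠ e₀ := by rintro rfl; exact hne rfl
  have s1 := h1.subset h2 (l₀ _ (.inl rfl)) (l₂ _ (.inl rfl))
    (h1.not_disjoint hc h3 h2 hne₁ hne₀ o₁ o₂ (l₂ _ (.inl rfl)))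
  have s2 := h2.subset h1 (l₀ _ (.inr rfl)) (l₁ _ (.inr rfl))
    (h2.not_disjoint hc h3 h1 hne₁.symm hne' o₂ o₁ (l₁ _ (.inr rfl)))
  have hsub : dcut vt σ (X₁ ∪ X₂) ⊆ {e₀, e₁, e₂} := by
    intro d hd
    simp only [mem_dcut, mem_union, not_or] at hd
    have k1 := h1.land d
    have k2 := h2.land d
    simp only [mem_dcut, mem_insert, mem_singleton] at *
    have := @s1 (vt (σ d))
    have := @s2 (vt (σ d))
    tauto
  have hX : 2 ≤ #X₁ := by
    have q := even_card_add_dcut hc h1.sub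
    rw [h1.card] at q
    have : 0 < #X₁ := card_pos.2 ⟨_, h1.mem₀⟩
    obtain ⟨r, hr⟩ := q
    omega
  have m1 := hc.mem _ (h1.sub h1.mem₀)
  have m2 := hc.mem _ (h1.sub h1.mem₁)
  have hK : 2 ≤ #(K \ (X₁ ∪ X₂)) := by
    rw [← Finset.card_pair hne]
    apply card_le_card
    intro v hv
    simp only [mem_insert, mem_singleton] at hv
    have := h1.out₀
    have := h2.out₀
    have := h1.out₁
    rcases hv with rfl | rfl <;> simp_all
  have := h4 _ (union_subset h1.sub h2.sub) (hX.trans (card_le_card subset_union_left)) hK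
  have := (card_le_card hsub).trans card_le_three
  omega

theorem Tight.disjoint (hT : Tight vt K σ S X₁ C₁ e₀ e₁) (hC : IsComp vt K σ S C)
    (hCC : Disjoint C C₁) (n₀ : e₀ ∉ S) (n₁ : e₁ ∉ S) {w : W} (hw : w ∈ C) (hwX : w ∉ X₁) :
    Disjoint X₁ C := by
  rw [Finset.disjoint_left]
  intro v hv hvC
  obtain ⟨d, k1, k2, k3, k4⟩ := hC.exists_cross hvC hw hv hwX
  rcases hT.land d (mem_dcut.2 ⟨k3, k4⟩) with rfl | rfl | k
  · exact n₀ k1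
  · exact n₁ k1
  · exact Finset.disjoint_left.1 hCC (hC.closed d k1 k2) k

/-- A set with a small boundary after a removal, which meets only two of the deleted edges. -/
theorem Removal.tight (hr : Removal vt K σ R σ') (h4 : CutGeFour vt K σ)
    (hRK : R ⊆ K) (hR : 2 ≤ #R) (hY : Y ⊆ K \ R) (hC : IsComp vt K σ S C) (hdis : Disjoint Y C)
    (hland : ∀ d ∈ dcut vt σ' Y, vt (σ' d) ∈ C) (hcard : #(dcut vt σ' Y) ≤ 2)
    (m₀ : vt e₀ ∈ Y) (m₁ : vt e₁ ∈ Y) (o₀ : vt (σ e₀) ∈ R) (o₁ : vt (σ e₁) ∈ R)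
    (hne : vt e₀ ≠ vt e₁) (hall : ∀ d, vt d ∈ Y → vt (σ d) ∈ R → d = e₀ ∨ d = e₁) :
    Tight vt K σ S Y C e₀ e₁ := by
  have hYK := hY.trans sdiff_subset
  have hYR : ∀ v ∈ Y, v ∉ R := fun v hv => (mem_sdiff.1 (hY hv)).2
  have hcutd : ∀ d ∈ dcut vt σ Y,
      d ∈ dcut vt σ' Y ∧ vt (σ' d) = vt (σ d) ∨ d = e₀ ∨ d = e₁ := by
    intro d hd
    rw [mem_dcut] at hd
    by_cases q : vt (σ d) ∈ R
    · exact Or.inr (hall d hd.1 q)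
    · have := hr.agree d (hYK hd.1) (hYR _ hd.1) q
      left
      rw [mem_dcut, this]
      exact ⟨hd, rfl⟩
  have hle : #(dcut vt σ Y) ≤ 4 := by
    have : dcut vt σ Y ⊆ dcut vt σ' Y ∪ {e₀, e₁} := by
      intro d hd
      have := hcutd d hd
      simp only [mem_union, mem_insert, mem_singleton]
      tauto
    exact (card_le_card this).trans ((card_union_le _ _).trans (by
      have := card_le_two (a := e₀) (b := e₁)
      omega))
  have hge : 4 ≤ #(dcut vt σ Y) := by
    apply h4 _ hYK
    · rw [← card_pair hne]
      apply card_le_card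
      intro v hv
      simp only [mem_insert, mem_singleton] at hv
      rcases hv with rfl | rfl <;> assumption
    · exact hR.trans (card_le_card fun v hv => mem_sdiff.2 ⟨hRK hv, fun q => hYR _ q hv⟩)
  refine ⟨hYK, hC, hdis, le_antisymm hle hge, ?_, m₀, m₁, fun q => hYR _ q o₀,
    fun q => hYR _ q o₁⟩
  intro d hd
  rcases hcutd d hd with ⟨q, q'⟩ | q | q
  · right; right
    rw [← q']
    exact hland d q
  · exact Or.inl q
  · exact Or.inr (Or.inl q)

end

section
variable {W D : Type*} [DecidableEq W] [DecidableEq D] [Fintype D] {vt : D → W}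
  {K R X : Finset W} {σ σ' : D → D} {S : Finset D} {h t g₁ g₁' g₂ g₂' : D}

theorem Ends.swap_right (he : Ends vt K σ t g₁ g₁' g₂ g₂') : Ends vt K σ t g₁ g₁' g₂' g₂ := by
  obtain ⟨a1, a2, a3, ⟨a4, a4'⟩, a5, ⟨a6, a6', a6''⟩, a7, a8, a9, a10, a11, a12⟩ := he
  exact ⟨a1, a2, a3, ⟨a4', a4⟩, a5, ⟨a6', a6, a6''.symm⟩, a7, a8, a10, a9, a11,
    fun x hx => by have := a12 x hx; tauto⟩

theorem Ends.good_or_tight (hI : Inst vt K σ S h) (h3 : CutGe vt K σ 3) (h4 : CutGeFour vt K σ)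
    (hG : GirthFour vt K σ)
    (IH : ∀ K' σ' S' h', #K' < #K → Inst vt K' σ' S' h' → Good vt K' σ' S' h')
    (he : Ends vt K σ t g₁ g₁' g₂ g₂') (hu : ∀ e ∈ S, vt e ≠ vt h)
    (ht : ∀ e ∈ S, vt e ≠ vt t) (ht' : ∀ e ∈ S, vt e ≠ vt (σ t))
    (hg : vt (σ g₁) = vt h) (hgh : σ g₁ ≠ h) :
    Good vt K σ S h ∨
      ∃ Y C, Tight vt K σ S Y C (σ g₁) (σ g₂) ∧ vt t ∉ Y ∧ vt (σ t) ∉ Y := by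
  have hc := hI.cub
  by_contra! ⟨hgood, hT⟩
  apply hgood
  have hRK := he.sub hc
  have k1 : vt (σ g₂) ≠ vt (σ g₁) :=
    hG.triangle t g₁ g₂ he.mem he.l.1.symm he.dl.1.symm he.r.1
  have i1 := hc.inv g₁ (he.l.1 ▸ he.mem)
  have i2 := hc.inv g₂ (he.r.1 ▸ hc.mem _ he.mem)
  have o1 := he.out₁
  rw [hg] at o1
  have hvt : vt (σ h) ≠ vt t := by
    intro q
    exact hgh (hG.parallel (σ g₁) h (hg ▸ hI.mem) hg (by rw [i1, q, he.l.1]))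
  have hvt' : vt (σ h) ≠ vt (σ t) := by
    intro q
    exact hG.triangle (σ g₁) h t (hg ▸ hI.mem) hg hgh (by rw [i1, he.l.1]) q.symm
  refine he.good hI h3 h4 hG IH (sclosed_empty) ?_ ?_ ?_ hg hgh ?_ ?_ ?_
  · intro d hd hK _ _ hσ
    have := hI.reg.symm d hd hK
    simp only [mem_insert, mem_singleton] at hσ
    exact hσ.elim (ht _ this) (ht' _ this)
  · simp only [mem_insert, mem_singleton]; tauto
  · simp only [mem_insert, mem_singleton]; tauto
  · intro C hC _ hh
    obtain ⟨e, he, he'⟩ := hC.on _ hh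
    exact hu e he he'
  · intro C hC hs
    obtain ⟨v, hv⟩ := hC.nonempty
    exact absurd (hs hv) (notMem_empty v)
  · intro σ' hr e1 e2 e3 e4 C hC hCR _ Y hY hhY hdis hland hcard hg2
    by_contra! ⟨hw, hy⟩
    have hYR : ∀ v ∈ Y, v ∉ ({vt t, vt (σ t)} : Finset W) := fun v hv => (mem_sdiff.1 (hY hv)).2
    refine hYR _ (hT Y C (hr.tight h4 hRK (by rw [card_pair he.ne.symm]) hY hC hdis hland hcard
      (hg ▸ hhY) hg2 (by simp [i1, he.l.1]) (by simp [i2, he.r.1]) k1.symm fun d q1 q2 => ?_)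
      (fun q => hYR _ q (by simp))) (by simp)
    rcases he.enter hc (sdiff_subset (hY q1)) (hYR _ q1) q2 with rfl | rfl | rfl | rfl
    · simp
    · exact absurd q1 hw
    · simp
    · exact absurd q1 hy

/-- There is a path of two further vertices off all components starting at `vt h`. -/
theorem Inst.good_of_path (hI : Inst vt K σ S h) (h3 : CutGe vt K σ 3) (h4 : CutGeFour vt K σ)
    (hG : GirthFour vt K σ)
    (IH : ∀ K' σ' S' h', #K' < #K → Inst vt K' σ' S' h' → Good vt K' σ' S' h')
    (hu : ∀ e ∈ S, vt e ≠ vt h) {d : D} (hd : vt d = vt h) (hdh : d ≠ h)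
    (hp : ∀ e ∈ S, vt e ≠ vt (σ d)) (ht : vt t = vt (σ d)) (htd : t ≠ σ d)
    (ht' : ∀ e ∈ S, vt e ≠ vt (σ t)) : Good vt K σ S h := by
  have hc := hI.cub
  have hdK : vt d ∈ K := hd ▸ hI.mem
  have md := hc.mem d hdK
  have jd := hc.inv d hdK
  have htK : vt t ∈ K := ht ▸ md
  have mt := hc.mem t htK
  obtain ⟨a, b, a1, a2, a3, a4, a5, a6⟩ := hc.exists_three htK
  obtain ⟨g, g', b1, b2, b3, b4, b5, b6⟩ := hc.exists_three mt
  obtain ⟨s, hs1, hs2, hs3, hs4⟩ : ∃ s, s ≠ t ∧ s ≠ σ d ∧ vt s = vt t ∧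
      ∀ x, vt x = vt t → x = t ∨ x = σ d ∨ x = s := by
    rcases a6 (σ d) ht.symm with q | q | q
    · exact absurd q.symm htd
    · exact ⟨b, by grind⟩
    · exact ⟨a, by grind⟩
  have he : Ends vt K σ t (σ d) s g g' := hG.ends hc htK ⟨ht.symm, hs3⟩ ⟨by grind, by grind⟩
    ⟨htd.symm, hs1, hs2.symm⟩ ⟨by grind, by grind, by grind⟩ hs4 (by grind)
  have hp' : ∀ e ∈ S, vt e ≠ vt t := ht ▸ hp
  rcases he.good_or_tight hI h3 h4 hG IH hu hp' ht' (by rw [jd, hd]) (by rwa [jd])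
    with k | ⟨X₁, C₁, T₁, x1, y1⟩
  · exact k
  rcases he.swap_right.good_or_tight hI h3 h4 hG IH hu hp' ht' (by rw [jd, hd]) (by rwa [jd])
    with k | ⟨X₂, C₂, T₂, x2, y2⟩
  · exact k
  exfalso
  have ig := hc.inv g (he.r.1 ▸ mt)
  have ig' := hc.inv g' (he.r.2 ▸ mt)
  have hoff : ∀ C, C = C₁ ∨ C = C₂ → vt t ∉ C ∧ vt (σ t) ∉ C := by
    rintro C (rfl | rfl)
    · exact ⟨fun q => by obtain ⟨e, k1, k2⟩ := T₁.comp.on _ q; exact hp' e k1 k2,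
        fun q => by obtain ⟨e, k1, k2⟩ := T₁.comp.on _ q; exact ht' e k1 k2⟩
    · exact ⟨fun q => by obtain ⟨e, k1, k2⟩ := T₂.comp.on _ q; exact hp' e k1 k2,
        fun q => by obtain ⟨e, k1, k2⟩ := T₂.comp.on _ q; exact ht' e k1 k2⟩
  have r1 := he.r.1
  have r2 := he.r.2
  refine T₁.uncross hc h3 h4 T₂ ?_ ?_ ?_ ?_ ?_ ?_ ?_ ?_
  · rw [ig, r1, jd, ← ht]; exact he.ne
  · intro q
    have : σ (σ g') = σ (σ g) := by rw [q]
    rw [ig, ig'] at this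
    exact he.dr.2.2 this.symm
  · intro q
    have : σ (σ g') = σ (σ (σ d)) := by rw [q]
    rw [ig', jd] at this
    exact he.ne (r2.symm.trans ((congrArg vt this).trans ht.symm))
  · rwa [ig, r1]
  · rwa [ig', r2]
  · intro C hC; rw [jd, ← ht]; exact (hoff C hC).1
  · intro C hC; rw [ig, r1]; exact (hoff C hC).2
  · intro C hC; rw [ig', r2]; exact (hoff C hC).2

end

section
variable {W D : Type*} [DecidableEq W] [DecidableEq D] [Fintype D] {vt : D → W}
  {K R X : Finset W} {σ σ' : D → D} {S : Finset D} {h : D}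

theorem Removal.glue (hc : IsCubic vt K σ) (hr : Removal vt K σ R σ') {F M : Set D}
    (hF : IsPM vt (K \ R) σ' F) (M₁ : ∀ v ∈ R, ∃ d ∈ M, vt d = v)
    (M₂ : ∀ d ∈ M, ∀ e ∈ M, vt d = vt e → d = e) (M₃ : ∀ d ∈ M, vt (σ d) ∈ R → σ d ∈ M)
    (hx : ∀ d, vt d ∈ R → vt (σ d) ∉ R → (d ∈ M ↔ σ d ∈ F)) :
    ∃ F', IsPM vt K σ F' ∧ (∀ d, vt d ∉ R → d ∈ F → d ∈ F') ∧
      ∀ d ∈ M, vt d ∈ R → d ∈ F' :=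
  ⟨_, IsPM.glue hc (X := R) (F₁ := M) (F₂ := F) (fun v _ => M₁ v)
    (fun v hv hvR => hF.ex v (mem_sdiff.2 ⟨hv, hvR⟩)) (fun d hd e he _ _ => M₂ d hd e he)
    (fun d hd e he k1 k2 => hF.uniq d hd e he (mem_sdiff.2 ⟨k1, k2⟩))
    (fun d hd _ _ => M₃ d hd)
    (fun d hd k1 k2 k3 => by
      rw [← hr.agree d k1 k2 k3]
      exact hF.symm d hd (mem_sdiff.2 ⟨k1, k2⟩))
    (fun d _ k2 k3 => hx d k2 k3), fun _ k1 k2 => Or.inr ⟨k1, k2⟩,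
    fun _ k1 k2 => Or.inl ⟨k2, k1⟩⟩

theorem Removal.good (hI : Inst vt K σ S h) (h3 : CutGe vt K σ 3) (h4 : CutGeFour vt K σ)
    (IH : ∀ K' σ' S' h', #K' < #K → Inst vt K' σ' S' h' → Good vt K' σ' S' h')
    (hr : Removal vt K σ R σ') (hRK : R ⊆ K) (hR : 2 ≤ #R) (hN : #(dcut vt σ R) ≤ 6)
    (hl : ∀ d, vt d ∈ K → vt d ∉ R → vt (σ d) ∈ R → vt (σ' d) ≠ vt d) {C₀ : Finset W}
    (hC : IsComp vt K σ S C₀) (hon : ∀ e ∈ S, vt e ∈ R → vt e ∈ C₀)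
    (hu : ∀ e ∈ S, vt e ≠ vt h) (hm : vt h ∉ R) (hm' : vt (σ h) ∉ R)
    (hlift : ∀ F, IsPM vt (K \ R) σ' F → h ∈ F → ∃ F', IsPM vt K σ F' ∧
      (∀ d, vt d ∉ R → vt d ∉ C₀ → d ∈ F → d ∈ F') ∧ ∃ d ∈ F', d ∈ S ∧ vt d ∈ C₀)
    (hc2 : ∀ C, IsComp vt K σ S C → Disjoint C C₀ → ∀ Y ⊆ K \ R, vt h ∈ Y → Disjoint Y C →
      (∀ d ∈ dcut vt σ' Y, vt (σ' d) ∈ C) → #(dcut vt σ' Y) ≤ 2 →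
      (∀ d, vt d ∈ K → vt d ∉ R → vt (σ d) ∈ R → vt d ∈ Y ∨ vt (σ' d) ∈ Y) ∨
        ∀ d, vt d ∈ Y → vt (σ d) ∈ R → vt (σ' d) ∉ Y) : Good vt K σ S h := by
  have hc := hI.cub
  have hoff : ∀ C, IsComp vt K σ S C → vt h ∉ C := by
    intro C hC hh
    obtain ⟨e, he, he'⟩ := hC.on _ hh
    exact hu e he he'
  have hH : ∀ d ∈ S, vt d ∈ K → vt d ∉ R → vt d ∉ C₀ → vt (σ d) ∉ R := by
    intro d hd hK _ hdC hσ
    have q := hI.reg.symm d hd hK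
    have := hC.closed _ q (hon _ q hσ)
    rw [hc.inv d hK] at this
    exact hdC this
  have hI' : Inst vt (K \ R) σ' (dropComp vt S C₀) h := by
    apply hr.inst hI hRK hR h3 h4 hN hl hC.toSClosed hH hm hm'
    intro C hC' hCR hC0 Y hY hhY hdis hland hcard
    refine hc2 C hC' hC0 Y hY ?_ hdis hland hcard
    rcases hhY with hh | hh
    · exact hh
    by_contra hcon
    have i := hc.inv h hI.mem
    have a := hr.agree (σ h) (hc.mem h hI.mem) hm' (by rwa [i])
    rw [i] at a
    have := hland (σ h) (mem_dcut.2 ⟨hh, by rwa [a]⟩)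
    rw [a] at this
    exact hoff C hC' this
  have hlt : #(K \ R) < #K := by
    rw [card_sdiff_of_subset hRK]
    have := card_le_card hRK
    omega
  obtain ⟨F, hF, hhF, hFC⟩ := IH _ _ _ _ hlt hI'
  obtain ⟨F', hF', hsub, hM⟩ := hlift F hF hhF
  refine ⟨F', hF', hsub h hm (hoff _ hC) hhF, fun C hC' => ?_⟩
  have hsub0 : C ⊆ C₀ → ∃ d ∈ F', d ∈ S ∧ vt d ∈ C := by
    intro k
    rwa [hC.min C k hC'.nonempty hC'.toSClosed]
  rcases hr.comp_cases hC.toSClosed hH hC' with k | k | k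
  · exact hsub0 k
  · apply hsub0
    intro v hv
    obtain ⟨e, he, rfl⟩ := hC'.on v hv
    exact hon e he (k hv)
  · obtain ⟨d, d1, d2, d3⟩ := hFC C k
    have hR' := (mem_sdiff.1 (k.sub d3)).2
    rw [mem_dropComp] at d2
    exact ⟨d, hsub d hR' d2.2 d1, d2.1, d3⟩

/-- A path of three vertices on a component `C`, starting at a vertex whose third neighbour
`vt (σ q)` is off all components and adjacent to `vt d`. -/
structure Fork {W D : Type*} (vt : D → W) (K : Finset W) (S : Finset D) (C : Finset W) (σ : D → D)
    (d b q r₀ s₀ s₁ f₁ s₂ f₂ : D) : Prop where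
  mem : vt s₀ ∈ C
  hr₀ : r₀ ∈ S
  hs₀ : s₀ ∈ S
  hq : q ∉ S
  hs₁ : s₁ ∈ S
  hf₁ : f₁ ∉ S
  hs₂ : s₂ ∈ S
  hf₂ : f₂ ∉ S
  vr₀ : vt r₀ = vt s₀
  vq : vt q = vt s₀
  vs₁ : vt s₁ = vt (σ s₀)
  vf₁ : vt f₁ = vt (σ s₀)
  vs₂ : vt s₂ = vt (σ s₁)
  vf₂ : vt f₂ = vt (σ s₁)
  n₀ : r₀ ≠ s₀
  n₁ : s₁ ≠ σ s₀
  n₂ : s₂ ≠ σ s₁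
  all₀ : ∀ x, vt x = vt s₀ → x = s₀ ∨ x = r₀ ∨ x = q
  all₁ : ∀ x, vt x = vt (σ s₀) → x = σ s₀ ∨ x = s₁ ∨ x = f₁
  all₂ : ∀ x, vt x = vt (σ s₁) → x = σ s₁ ∨ x = s₂ ∨ x = f₂
  hd : vt d ∈ K
  vd : vt (σ d) = vt (σ q)
  vb : vt b = vt (σ q)
  ndq : σ d ≠ σ q
  nbd : b ≠ σ d
  nbq : b ≠ σ q
  allp : ∀ x, vt x = vt (σ q) → x = σ d ∨ x = σ q ∨ x = b
  offp : ∀ e ∈ S, vt e ≠ vt (σ q)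
  offu : ∀ e ∈ S, vt e ≠ vt d
  offN : ∀ x, vt x = vt d → ∀ e ∈ S, vt e ≠ vt (σ x)

variable {C₀ : Finset W} {d b q r₀ s₀ s₁ f₁ s₂ f₂ : D}

theorem Fork.basic (hc : IsCubic vt K σ) (hS : IsTwoReg vt K σ S) (hC : IsComp vt K σ S C₀)
    (hf : Fork vt K S C₀ σ d b q r₀ s₀ s₁ f₁ s₂ f₂) :
    (vt (σ q) ∈ K ∧ vt s₀ ∈ K ∧ vt (σ s₀) ∈ K ∧ vt (σ s₁) ∈ K) ∧
    (vt (σ s₀) ∈ C₀ ∧ vt (σ s₁) ∈ C₀ ∧ vt (σ s₂) ∈ C₀ ∧ vt (σ r₀) ∈ C₀ ∧ vt (σ q) ∉ C₀) ∧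
    (σ s₀ ∈ S ∧ σ s₁ ∈ S ∧ σ s₂ ∈ S ∧ σ r₀ ∈ S) ∧
    (σ (σ d) = d ∧ σ (σ q) = q ∧ σ (σ b) = b ∧ σ (σ r₀) = r₀ ∧ σ (σ s₀) = s₀ ∧ σ (σ s₁) = s₁ ∧
      σ (σ s₂) = s₂ ∧ σ (σ f₁) = f₁ ∧ σ (σ f₂) = f₂) := by
  have m0 := hf.mem
  have k0 := hC.sub m0
  have m1 := hC.closed _ hf.hs₀ m0
  have k1 := hC.sub m1
  have m2 := hC.closed _ hf.hs₁ (hf.vs₁ ▸ m1)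
  have k2 := hC.sub m2
  have m3 := hC.closed _ hf.hs₂ (hf.vs₂ ▸ m2)
  have my := hC.closed _ hf.hr₀ (hf.vr₀ ▸ m0)
  have kp := hc.mem q (hf.vq ▸ k0)
  refine ⟨⟨kp, k0, k1, k2⟩, ⟨m1, m2, m3, my, ?_⟩, ⟨hS.symm _ hf.hs₀ k0,
    hS.symm _ hf.hs₁ (hf.vs₁ ▸ k1), hS.symm _ hf.hs₂ (hf.vs₂ ▸ k2), hS.symm _ hf.hr₀ (hf.vr₀ ▸ k0)⟩,
    hc.inv _ hf.hd, hc.inv _ (hf.vq ▸ k0), hc.inv _ (hf.vb ▸ kp), hc.inv _ (hf.vr₀ ▸ k0),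
    hc.inv _ k0, hc.inv _ (hf.vs₁ ▸ k1), hc.inv _ (hf.vs₂ ▸ k2), hc.inv _ (hf.vf₁ ▸ k1),
    hc.inv _ (hf.vf₂ ▸ k2)⟩
  intro hh
  obtain ⟨e, he, he'⟩ := hC.on _ hh
  exact hf.offp e he he'

end

section
variable {W D : Type*} [DecidableEq W] [DecidableEq D] [Fintype D] {vt : D → W}
  {K R X : Finset W} {σ σ' : D → D} {S : Finset D} {h : D}
variable {C₀ : Finset W} {d b q r₀ s₀ s₁ f₁ s₂ f₂ : D}

/-- The heads of the darts around a fork are distinct, up to one possible coincidence. -/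
theorem Fork.heads (hc : IsCubic vt K σ) (hG : GirthFour vt K σ) (hS : IsTwoReg vt K σ S)
    (hC : IsComp vt K σ S C₀) (hf : Fork vt K S C₀ σ d b q r₀ s₀ s₁ f₁ s₂ f₂) :
    (vt (σ q) ≠ vt s₀ ∧ vt (σ q) ≠ vt (σ s₀) ∧ vt (σ q) ≠ vt (σ s₁) ∧ vt s₀ ≠ vt (σ s₀) ∧
      vt s₀ ≠ vt (σ s₁) ∧ vt (σ s₀) ≠ vt (σ s₁)) ∧
    (vt d ≠ vt (σ q) ∧ vt d ≠ vt s₀ ∧ vt d ≠ vt (σ s₀) ∧ vt d ≠ vt (σ s₁)) ∧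
    (vt (σ b) ≠ vt (σ q) ∧ vt (σ b) ≠ vt s₀ ∧ vt (σ b) ≠ vt (σ s₀) ∧
      (vt (σ b) = vt (σ s₁) → σ b = f₂)) ∧
    (vt (σ r₀) ≠ vt (σ q) ∧ vt (σ r₀) ≠ vt s₀ ∧ vt (σ r₀) ≠ vt (σ s₀) ∧
      vt (σ r₀) ≠ vt (σ s₁)) ∧
    (vt (σ f₁) ≠ vt (σ q) ∧ vt (σ f₁) ≠ vt s₀ ∧ vt (σ f₁) ≠ vt (σ s₀) ∧
      vt (σ f₁) ≠ vt (σ s₁)) ∧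
    (vt (σ f₂) ≠ vt s₀ ∧ vt (σ f₂) ≠ vt (σ s₀) ∧ vt (σ f₂) ≠ vt (σ s₁)) ∧
    (vt (σ s₂) ≠ vt (σ q) ∧ vt (σ s₂) ≠ vt s₀ ∧ vt (σ s₂) ≠ vt (σ s₀) ∧
      vt (σ s₂) ≠ vt (σ s₁)) ∧
    (vt (σ b) ≠ vt (σ r₀) ∧ vt (σ f₁) ≠ vt (σ s₂) ∧ vt (σ f₁) ≠ vt (σ r₀) ∧
      vt d ≠ vt (σ f₂) ∧ vt d ≠ vt (σ s₂)) ∧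
    (vt (σ f₂) = vt (σ q) → σ f₂ = b) := by
  obtain ⟨⟨kp, k0, k1, k2⟩, ⟨m1, m2, m3, my, mp⟩, ⟨t1, t2, t3, t4⟩,
    i1, i2, i3, i4, i5, i6, i7, i8, i9⟩ := hf.basic hc hS hC
  have m0 := hf.mem
  have hoff : ∀ v ∈ C₀, v ≠ vt d := by
    intro v hv hvd
    obtain ⟨e, he, rfl⟩ := hC.on v hv
    exact hf.offu e he hvd
  have hfN := hf.offN
  obtain ⟨-, hr₀, hs₀, hq, hs₁, hf₁, hs₂, hf₂, vr₀, vq, vs₁, vf₁, vs₂, vf₂, n₀, n₁, n₂, all₀, all₁,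
    all₂, hd, vd, vb, ndq, nbd, nbq, allp, offp, offu, -⟩ := hf
  have l1 := hG.loop s₀ k0
  have l2 := hG.loop s₁ (vs₁ ▸ k1)
  have l3 := hG.loop q (vq ▸ k0)
  have l4 := hG.loop d hd
  have l5 := hG.loop b (vb ▸ kp)
  have l6 := hG.loop r₀ (vr₀ ▸ k0)
  have l7 := hG.loop f₁ (vf₁ ▸ k1)
  have l8 := hG.loop f₂ (vf₂ ▸ k2)
  have l9 := hG.loop s₂ (vs₂ ▸ k2)
  have p1 := hG.parallel s₀ r₀ k0 vr₀.symm
  have p2 := hG.parallel s₁ (σ s₀) (vs₁ ▸ k1) vs₁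
  have p3 := hG.parallel f₁ (σ s₀) (vf₁ ▸ k1) vf₁
  have p4 := hG.parallel s₁ f₁ (vs₁ ▸ k1) (vs₁.trans vf₁.symm)
  have p5 := hG.parallel s₂ (σ s₁) (vs₂ ▸ k2) vs₂
  have p6 := hG.parallel f₂ (σ s₁) (vf₂ ▸ k2) vf₂
  have p7 := hG.parallel b (σ q) (vb ▸ kp) vb
  have q1 := hG.triangle s₀ r₀ s₁ k0 vr₀.symm n₀.symm vs₁
  have q2 := hG.triangle s₀ r₀ f₁ k0 vr₀.symm n₀.symm vf₁
  have nsq : s₀ ≠ q := by rintro rfl; exact hq hs₀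
  have nrq : r₀ ≠ q := by rintro rfl; exact hq hr₀
  have nsf : s₁ ≠ f₁ := by rintro rfl; exact hf₁ hs₁
  have nsf' : σ s₀ ≠ f₁ := by rintro rfl; exact hf₁ t1
  have q3 := hG.triangle s₀ q f₁ k0 vq.symm nsq vf₁
  have q4 := hG.triangle q s₀ b (vq ▸ k0) vq nsq.symm vb
  have q5 := hG.triangle q r₀ b (vq ▸ k0) (vq.trans vr₀.symm) nrq.symm vb
  have q6 := hG.triangle s₁ (σ s₀) s₂ (vs₁ ▸ k1) vs₁ n₁ vs₂
  have q7 := hG.triangle s₁ (σ s₀) f₂ (vs₁ ▸ k1) vs₁ n₁ vf₂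
  have q8 := hG.triangle s₁ f₁ s₂ (vs₁ ▸ k1) (vs₁.trans vf₁.symm) nsf vs₂
  have hb : σ b ∉ S := by
    intro hh
    have := hS.symm _ hh (hc.mem _ (vb ▸ kp))
    rw [i3] at this
    exact offp _ this vb
  have o0 := hoff _ m0
  have o1 := hoff _ m1
  have o2 := hoff _ m2
  have o3 := hoff _ m3
  have hN2 : vt d ≠ vt (σ f₂) := by
    intro hh
    have := hfN (σ f₂) hh.symm s₂ hs₂
    rw [i9, vf₂, vs₂] at this
    exact this rfl
  rw [i5] at p2 p3 q6 q7
  rw [i6] at p5 p6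
  rw [i2] at p7
  refine ⟨⟨?_, ?_, ?_, ?_, ?_, ?_⟩, ⟨?_, ?_, ?_, ?_⟩, ⟨?_, ?_, ?_, ?_⟩, ⟨?_, ?_, ?_, ?_⟩,
    ⟨?_, ?_, ?_, ?_⟩, ⟨?_, ?_, ?_⟩, ⟨?_, ?_, ?_, ?_⟩, ⟨?_, ?_, ?_, ?_, ?_⟩, ?_⟩
  all_goals first
    | exact hN2
    | (intro hh; grind)

end

section
variable {W D : Type*} [DecidableEq W] [DecidableEq D] [Fintype D] {vt : D → W}
  {K R X : Finset W} {σ σ' : D → D} {S : Finset D} {h : D}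
variable {C₀ : Finset W} {d b q r₀ s₀ s₁ f₁ s₂ f₂ : D}

theorem four_darts_inj {x₀ x₁ x₂ x₃ : D} (h₀₁ : vt x₀ ≠ vt x₁) (h₀₂ : vt x₀ ≠ vt x₂)
    (h₀₃ : vt x₀ ≠ vt x₃) (h₁₂ : vt x₁ ≠ vt x₂) (h₁₃ : vt x₁ ≠ vt x₃) (h₂₃ : vt x₂ ≠ vt x₃) :
    ∀ d ∈ ({x₀, x₁, x₂, x₃} : Set D), ∀ e ∈ ({x₀, x₁, x₂, x₃} : Set D), vt d = vt e → d = e := by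
  simp only [Set.mem_insert_iff, Set.mem_singleton_iff]
  rintro d (rfl | rfl | rfl | rfl) e (rfl | rfl | rfl | rfl) hde <;>
    first | rfl | exact absurd hde ‹_› | exact absurd hde.symm ‹_›

theorem Fork.leave (hc : IsCubic vt K σ) (hG : GirthFour vt K σ) (hS : IsTwoReg vt K σ S)
    (hC : IsComp vt K σ S C₀) (hf : Fork vt K S C₀ σ d b q r₀ s₀ s₁ f₁ s₂ f₂) (x : D) :
    vt x ∈ ({vt (σ q), vt s₀, vt (σ s₀), vt (σ s₁)} : Finset W) ∧
      vt (σ x) ∉ ({vt (σ q), vt s₀, vt (σ s₀), vt (σ s₁)} : Finset W) ↔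
    x = σ d ∨ x = r₀ ∨ x = f₁ ∨ x = s₂ ∨ (x = b ∨ x = f₂) ∧ vt (σ f₂) ≠ vt (σ q) := by
  obtain ⟨-, -, -, i1, i2, i3, i4, i5, i6, i7, i8, i9⟩ := hf.basic hc hS hC
  obtain ⟨⟨a1, a2, a3, a4, a5, a6⟩, ⟨b1, b2, b3, b4⟩, ⟨c1, c2, c3, c4⟩, ⟨d1, d2, d3, d4⟩,
    ⟨e1, e2, e3, e4⟩, ⟨f1, f2, f3⟩, ⟨g1, g2, g3, g4⟩, -, j⟩ := hf.heads hc hG hS hC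
  obtain ⟨-, -, -, -, -, -, -, -, vr₀, vq, vs₁, vf₁, vs₂, vf₂, n₀, n₁, n₂, all₀, all₁,
    all₂, hd, vd, vb, ndq, nbd, nbq, allp, -, -, -⟩ := hf
  simp only [mem_insert, mem_singleton]
  constructor
  · rintro ⟨k1, k2⟩
    push Not at k2
    obtain ⟨k2, k3, k4, k5⟩ := k2
    rcases k1 with k1 | k1 | k1 | k1
    · rcases allp x k1 with rfl | rfl | rfl <;> grind
    · rcases all₀ x k1 with rfl | rfl | rfl <;> grind
    · rcases all₁ x k1 with rfl | rfl | rfl <;> grind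
    · rcases all₂ x k1 with rfl | rfl | rfl <;> grind
  · rintro (rfl | rfl | rfl | rfl | ⟨rfl | rfl, k⟩)
    · rw [i1]; simp_all
    · simp_all
    · simp_all
    · simp_all
    · have : vt (σ x) ≠ vt (σ s₁) := by
        intro hh
        apply k
        rw [← c4 hh, i3, vb]
      simp_all
    · simp_all

theorem Fork.sub (hc : IsCubic vt K σ) (hS : IsTwoReg vt K σ S)
    (hC : IsComp vt K σ S C₀) (hf : Fork vt K S C₀ σ d b q r₀ s₀ s₁ f₁ s₂ f₂) :
    ({vt (σ q), vt s₀, vt (σ s₀), vt (σ s₁)} : Finset W) ⊆ K := by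
  obtain ⟨⟨k1, k2, k3, k4⟩, -⟩ := hf.basic hc hS hC
  intro v hv
  simp only [mem_insert, mem_singleton] at hv
  rcases hv with rfl | rfl | rfl | rfl <;> assumption

theorem Fork.enter (hc : IsCubic vt K σ) (hG : GirthFour vt K σ) (hS : IsTwoReg vt K σ S)
    (hC : IsComp vt K σ S C₀) (hf : Fork vt K S C₀ σ d b q r₀ s₀ s₁ f₁ s₂ f₂) {x : D}
    (hx : vt x ∈ K) (hR : vt x ∉ ({vt (σ q), vt s₀, vt (σ s₀), vt (σ s₁)} : Finset W))
    (hσ : vt (σ x) ∈ ({vt (σ q), vt s₀, vt (σ s₀), vt (σ s₁)} : Finset W)) :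
    x = d ∨ x = σ r₀ ∨ x = σ f₁ ∨ x = σ s₂ ∨
      (x = σ b ∨ x = σ f₂) ∧ vt (σ f₂) ≠ vt (σ q) := by
  obtain ⟨-, -, -, i1, -⟩ := hf.basic hc hS hC
  have hi := hc.inv x hx
  have := (hf.leave hc hG hS hC (σ x)).1 ⟨hσ, by rwa [hi]⟩
  grind

theorem Fork.on (hf : Fork vt K S C₀ σ d b q r₀ s₀ s₁ f₁ s₂ f₂) (hc : IsCubic vt K σ)
    (hS : IsTwoReg vt K σ S) (hC : IsComp vt K σ S C₀) :
    ∀ e ∈ S, vt e ∈ ({vt (σ q), vt s₀, vt (σ s₀), vt (σ s₁)} : Finset W) → vt e ∈ C₀ := by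
  obtain ⟨-, ⟨m1, m2, -⟩, -⟩ := hf.basic hc hS hC
  intro e he hR
  have m0 := hf.mem
  simp only [mem_insert, mem_singleton] at hR
  rcases hR with k | k | k | k
  · exact absurd k (hf.offp e he)
  all_goals rwa [k]

theorem Fork.notMem (hf : Fork vt K S C₀ σ d b q r₀ s₀ s₁ f₁ s₂ f₂) (hc : IsCubic vt K σ)
    (hG : GirthFour vt K σ) (hS : IsTwoReg vt K σ S) (hC : IsComp vt K σ S C₀) (hd : vt d = vt h)
    (hdh : d ≠ h) :
    vt h ∉ ({vt (σ q), vt s₀, vt (σ s₀), vt (σ s₁)} : Finset W) ∧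
      vt (σ h) ∉ ({vt (σ q), vt s₀, vt (σ s₀), vt (σ s₁)} : Finset W) := by
  obtain ⟨-, b, -⟩ := hf.heads hc hG hS hC
  have := hG.parallel d h hf.hd hd
  have k0 := hf.offN h hd.symm s₀ hf.hs₀
  have k1 := hf.offN h hd.symm s₁ hf.hs₁
  have k2 := hf.offN h hd.symm s₂ hf.hs₂
  rw [hf.vs₁] at k1
  rw [hf.vs₂] at k2
  rw [hf.vd] at this
  simp only [mem_insert, mem_singleton, not_or]
  rw [← hd]
  refine ⟨b, fun q => hdh (this q.symm), k0.symm, k1.symm, k2.symm⟩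

set_option maxHeartbeats 1000000 in
/-- The vertex off the component closes the fork to a quadrangle. -/
theorem Fork.good_of_quadrangle (hI : Inst vt K σ S h) (h3 : CutGe vt K σ 3)
    (h4 : CutGeFour vt K σ) (hG : GirthFour vt K σ)
    (IH : ∀ K' σ' S' h', #K' < #K → Inst vt K' σ' S' h' → Good vt K' σ' S' h')
    (hu : ∀ e ∈ S, vt e ≠ vt h) (hC : IsComp vt K σ S C₀)
    (hf : Fork vt K S C₀ σ d b q r₀ s₀ s₁ f₁ s₂ f₂) (hd : vt d = vt h) (hdh : d ≠ h)
    (hq : vt (σ f₂) = vt (σ q)) : Good vt K σ S h := by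
  have hc := hI.cub
  have hS := hI.reg
  obtain ⟨-, ⟨m1, m2, m3, my, mp⟩, ⟨t1, t2, t3, t4⟩, i1, i2, i3, i4, i5, i6, i7, i8, i9⟩ :=
    hf.basic hc hS hC
  have hleave := hf.leave hc hG hS hC
  have henter := fun x => hf.enter hc hG hS hC (x := x)
  have hRK := hf.sub hc hS hC
  have hon := hf.on hc hS hC
  obtain ⟨hm, hm'⟩ := hf.notMem hc hG hS hC hd hdh
  obtain ⟨⟨a1, a2, a3, a4, a5, a6⟩, ⟨b1, b2, b3, b4⟩, -, ⟨d1, d2, d3, d4⟩,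
    ⟨e1, e2, e3, e4⟩, ⟨f1, f2, f3⟩, ⟨g1, g2, g3, g4⟩, ⟨-, -, hl1, -, hl2⟩, j⟩ :=
    hf.heads hc hG hS hC
  have hb := j hq
  have hin : ∀ v, v ∈ ({vt (σ q), vt s₀, vt (σ s₀), vt (σ s₁)} : Finset W) ↔
    v = vt (σ q) ∨ v = vt s₀ ∨ v = vt (σ s₀) ∨ v = vt (σ s₁) := by simp
  have hcard : 2 ≤ #({vt (σ q), vt s₀, vt (σ s₀), vt (σ s₁)} : Finset W) := by
    rw [← card_pair a1]
    exact card_le_card (by intro v; simp; tauto)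
  generalize ({vt (σ q), vt s₀, vt (σ s₀), vt (σ s₁)} : Finset W) = R at *
  obtain ⟨m0, hr₀, hs₀, hq', hs₁, hf₁, hs₂, hf₂, vr₀, vq, vs₁, vf₁, vs₂, vf₂, n₀, n₁, n₂, all₀,
    all₁, all₂, hdK, vd, vb, ndq, nbd, nbq, allp, offp, offu, offN⟩ := hf
  simp only [hq, ne_eq, not_true_eq_false, and_false, or_false] at hleave henter
  obtain ⟨σ', hr, x1, x2, x3, x4⟩ : ∃ σ', Removal vt K σ R σ' ∧ σ' (σ (σ d)) = σ s₂ ∧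
      σ' (σ s₂) = σ (σ d) ∧ σ' (σ r₀) = σ f₁ ∧ σ' (σ f₁) = σ r₀ := by
    have z1 : σ d ≠ s₂ := ne_of_apply_ne vt (by rwa [vd, vs₂])
    have z2 : r₀ ≠ f₁ := ne_of_apply_ne vt (by rwa [vr₀, vf₁])
    have z3 : σ d ≠ r₀ := ne_of_apply_ne vt (by rwa [vd, vr₀])
    have z4 : s₂ ≠ f₁ := ne_of_apply_ne vt (by rw [vs₂, vf₁]; exact a6.symm)
    have z5 : σ d ≠ f₁ := ne_of_apply_ne vt (by rwa [vd, vf₁])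
    have z6 : s₂ ≠ r₀ := ne_of_apply_ne vt (by rw [vs₂, vr₀]; exact a5.symm)
    refine exists_removal_two hc hRK z1 z2 z3 z4 z5 z6 ((hleave _).2 ?_) ((hleave _).2 ?_)
      ((hleave _).2 ?_) ((hleave _).2 ?_) ?_
    iterate 4 simp
    intro x y z
    have := (hleave x).1 ⟨y, z⟩
    tauto
  rw [i1] at x1 x2
  refine hr.good hI h3 h4 IH hRK hcard ?_ ?_ hC hon hu hm hm' ?_ ?_
  · have : dcut vt σ R ⊆ {σ d, r₀, f₁, s₂} := by
      intro x hx
      have := (hleave x).1 (mem_dcut.1 hx)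
      simpa using this
    exact (card_le_card this).trans (card_le_four.trans (by norm_num))
  · intro x y1 y2 y3
    rcases henter x y1 y2 y3 with rfl | rfl | rfl | rfl
    · rw [x1]; exact hl2.symm
    · rw [x3]; exact hl1
    · rw [x4]; exact hl1.symm
    · rw [x2]; exact hl2
  · intro F hF hhF
    have hdF : d ∉ F := fun hh => hdh (hF.uniq _ hh _ hhF (by
      rw [hd]; exact mem_sdiff.2 ⟨hI.mem, hm⟩) hd)
    have hKR : ∀ x, vt x ∈ R → vt (σ x) ∉ R → vt (σ x) ∈ K \ R := fun x k k' =>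
      mem_sdiff.2 ⟨hc.mem _ (hRK k), k'⟩
    have y1 : σ s₂ ∉ F := by
      intro hh
      have k := (hleave s₂).2 (by simp)
      have := hF.symm _ hh (hKR _ k.1 k.2)
      rw [x2] at this
      exact hdF this
    have y2 : σ r₀ ∈ F ↔ σ f₁ ∈ F := by
      have k := (hleave r₀).2 (by simp)
      have k' := (hleave f₁).2 (by simp)
      constructor
      · intro hh
        have := hF.symm _ hh (hKR _ k.1 k.2)
        rwa [x3] at this
      · intro hh
        have := hF.symm _ hh (hKR _ k'.1 k'.2)
        rwa [x4] at this
    have hM : ∃ M : Set D, (∀ v ∈ R, ∃ d ∈ M, vt d = v) ∧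
        (∀ d ∈ M, ∀ e ∈ M, vt d = vt e → d = e) ∧ (∀ d ∈ M, vt (σ d) ∈ R → σ d ∈ M) ∧
        (σ d ∉ M ∧ s₂ ∉ M ∧ (r₀ ∈ M ↔ σ f₁ ∈ F) ∧ (f₁ ∈ M ↔ σ f₁ ∈ F)) ∧
        (r₀ ∈ M ∨ s₁ ∈ M) := by
      by_cases hh : σ f₁ ∈ F
      · have hM2 := four_darts_inj (vt := vt) (x₀ := r₀) (x₁ := f₁) (x₂ := σ f₂) (x₃ := f₂)
          (by rwa [vr₀, vf₁]) (by rw [vr₀, hq]; exact a1.symm) (by rwa [vr₀, vf₂])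
          (by rw [vf₁, hq]; exact a2.symm) (by rwa [vf₁, vf₂]) (by rwa [hq, vf₂])
        refine ⟨{r₀, f₁, σ f₂, f₂}, ?_, hM2, ?_, ⟨?_, ?_, ?_, ?_⟩, by simp⟩
        · intro v hv
          rcases (hin v).1 hv with rfl | rfl | rfl | rfl
          exacts [⟨σ f₂, by simp, hq⟩, ⟨r₀, by simp, vr₀⟩, ⟨f₁, by simp, vf₁⟩, ⟨f₂, by simp, vf₂⟩]
        · simp only [Set.mem_insert_iff, Set.mem_singleton_iff]
          rintro x (rfl | rfl | rfl | rfl) hx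
          · exact absurd hx ((hleave x).2 (by simp)).2
          · exact absurd hx ((hleave x).2 (by simp)).2
          · simp [i9]
          · simp
        · exact fun k => nbd (hb ▸ (hM2 _ k (σ f₂) (by simp) (vd.trans hq.symm)).symm)
        · intro k
          have := hM2 _ k f₂ (by simp) (vs₂.trans vf₂.symm)
          exact hf₂ (this ▸ hs₂)
        · exact iff_of_true (by simp) hh
        · exact iff_of_true (by simp) hh
      · have hM2 := four_darts_inj (vt := vt) (x₀ := q) (x₁ := σ q) (x₂ := s₁) (x₃ := σ s₁)
          (by rw [vq]; exact a1.symm) (by rwa [vq, vs₁]) (by rwa [vq])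
          (by rwa [vs₁]) a3 (by rwa [vs₁])
        refine ⟨{q, σ q, s₁, σ s₁}, ?_, hM2, ?_, ⟨?_, ?_, ?_, ?_⟩, by simp⟩
        · intro v hv
          rcases (hin v).1 hv with rfl | rfl | rfl | rfl
          exacts [⟨σ q, by simp, rfl⟩, ⟨q, by simp, vq⟩, ⟨s₁, by simp, vs₁⟩, ⟨σ s₁, by simp, rfl⟩]
        · simp only [Set.mem_insert_iff, Set.mem_singleton_iff]
          rintro x (rfl | rfl | rfl | rfl) _
          · simp
          · simp [i2]
          · simp
          · simp [i6]
        · exact fun k => ndq (hM2 _ k (σ q) (by simp) vd)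
        · exact fun k => n₂ (hM2 _ k (σ s₁) (by simp) vs₂)
        · refine iff_of_false (fun k => ?_) hh
          have := hM2 _ k q (by simp) (vr₀.trans vq.symm)
          exact hq' (this ▸ hr₀)
        · refine iff_of_false (fun k => ?_) hh
          have := hM2 _ k s₁ (by simp) (vf₁.trans vs₁.symm)
          exact hf₁ (this ▸ hs₁)
    obtain ⟨M, M1, M2, M3, ⟨M4, M5, M6, M7⟩, M8⟩ := hM
    obtain ⟨F', hF', G1, G2⟩ := hr.glue hc hF M1 M2 M3 (fun x k1 k2 => by
      rcases (hleave x).1 ⟨k1, k2⟩ with rfl | rfl | rfl | rfl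
      · rw [i1]; exact iff_of_false M4 hdF
      · rw [y2]; exact M6
      · exact M7
      · exact iff_of_false M5 y1)
    refine ⟨F', hF', fun x k _ => G1 x k, ?_⟩
    rcases M8 with k | k
    · exact ⟨r₀, G2 _ k ((hleave r₀).2 (by simp)).1, hr₀, vr₀ ▸ m0⟩
    · exact ⟨s₁, G2 _ k ((hin _).2 (by rw [vs₁]; simp)), hs₁, vs₁ ▸ m1⟩
  · intro C hC' hCC Y hY hhY hdis hland _
    have key := hr.parity hc hS hC.toSClosed hCC.symm hY hland t4 t3 (a := σ r₀) (b := σ s₂)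
      ?_ my m3 ?_ ?_ ?_
    · have hdY : vt d ∈ Y := hd ▸ hhY
      by_cases hs : vt (σ s₂) ∈ Y
      · left
        intro x y1 y2 y3
        rcases henter x y1 y2 y3 with rfl | rfl | rfl | rfl
        · exact Or.inl hdY
        · exact Or.inl (key.2 hs)
        · rw [x4]; exact Or.inr (key.2 hs)
        · exact Or.inl hs
      · right
        intro x y2 y3
        have y1 := mem_sdiff.1 (hY y2)
        rcases henter x y1.1 y1.2 y3 with rfl | rfl | rfl | rfl
        · rwa [x1]
        · exact absurd (key.1 y2) hs
        · rw [x4]; exact mt key.1 hs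
        · exact absurd y2 hs
    · intro hh
      have : r₀ = s₂ := by rw [← i4, hh, i7]
      exact a5 (by rw [← vr₀, this, vs₂])
    · rw [i4]; exact ((hleave r₀).2 (by simp)).1
    · rw [i7]; exact ((hleave s₂).2 (by simp)).1
    · intro x y0 y1 y2 y3
      have := hS.symm x y0 (hC.sub y1)
      rcases henter x (hC.sub y1) y2 y3 with rfl | rfl | rfl | rfl
      · exact absurd rfl (offu _ y0)
      · exact Or.inl rfl
      · rw [i8] at this; exact absurd this hf₁
      · exact Or.inr rfl

end

section
variable {W D : Type*} [DecidableEq W] [DecidableEq D] [Fintype D] {vt : D → W}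
  {K R X : Finset W} {σ σ' : D → D} {S : Finset D} {h : D}
variable {C₀ : Finset W} {d b q r₀ s₀ s₁ f₁ s₂ f₂ : D}

set_option maxHeartbeats 2000000 in
/-- Removing a nondegenerate fork works unless a tight set blocks it. -/
theorem Fork.good_or_tight (hI : Inst vt K σ S h) (h3 : CutGe vt K σ 3)
    (h4 : CutGeFour vt K σ) (hG : GirthFour vt K σ)
    (IH : ∀ K' σ' S' h', #K' < #K → Inst vt K' σ' S' h' → Good vt K' σ' S' h')
    (hu : ∀ e ∈ S, vt e ≠ vt h) (hC : IsComp vt K σ S C₀)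
    (hf : Fork vt K S C₀ σ d b q r₀ s₀ s₁ f₁ s₂ f₂) (hd : vt d = vt h) (hdh : d ≠ h)
    (hq : vt (σ f₂) ≠ vt (σ q)) : Good vt K σ S h ∨
      ∃ Y C, Tight vt K σ S Y C d (σ f₂) ∧ Disjoint C C₀ ∧ vt s₀ ∉ Y := by
  by_contra! hcon
  obtain ⟨hgood, hcon⟩ := hcon
  apply hgood
  have hc := hI.cub
  have hS := hI.reg
  obtain ⟨-, ⟨m1, m2, m3, my, mp⟩, ⟨t1, t2, t3, t4⟩, i1, i2, i3, i4, i5, i6, i7, i8, i9⟩ :=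
    hf.basic hc hS hC
  have hleave := hf.leave hc hG hS hC
  have henter := fun x => hf.enter hc hG hS hC (x := x)
  have hRK := hf.sub hc hS hC
  have hon := hf.on hc hS hC
  obtain ⟨hm, hm'⟩ := hf.notMem hc hG hS hC hd hdh
  obtain ⟨⟨a1, a2, a3, a4, a5, a6⟩, ⟨b1, b2, b3, b4⟩, -, ⟨d1, d2, d3, d4⟩,
    ⟨e1, e2, e3, e4⟩, ⟨f1, f2, f3⟩, ⟨g1, g2, g3, g4⟩, ⟨hl1, hl2, -, hl3, -⟩, -⟩ :=
    hf.heads hc hG hS hC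
  have hin : ∀ v, v ∈ ({vt (σ q), vt s₀, vt (σ s₀), vt (σ s₁)} : Finset W) ↔
    v = vt (σ q) ∨ v = vt s₀ ∨ v = vt (σ s₀) ∨ v = vt (σ s₁) := by simp
  have hcard : 2 ≤ #({vt (σ q), vt s₀, vt (σ s₀), vt (σ s₁)} : Finset W) := by
    rw [← card_pair a1]
    exact card_le_card (by intro v; simp; tauto)
  generalize ({vt (σ q), vt s₀, vt (σ s₀), vt (σ s₁)} : Finset W) = R at *
  obtain ⟨m0, hr₀, hs₀, hq', hs₁, hf₁, hs₂, hf₂, vr₀, vq, vs₁, vf₁, vs₂, vf₂, n₀, n₁, n₂, all₀,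
    all₁, all₂, hdK, vd, vb, ndq, nbd, nbq, allp, offp, offu, offN⟩ := hf
  simp only [hq, ne_eq, not_false_eq_true, and_true] at hleave henter
  obtain ⟨σ', hr, x1, x2, x3, x4, x5, x6⟩ : ∃ σ', Removal vt K σ R σ' ∧ σ' (σ (σ d)) = σ f₂ ∧
      σ' (σ f₂) = σ (σ d) ∧ σ' (σ b) = σ r₀ ∧ σ' (σ r₀) = σ b ∧ σ' (σ f₁) = σ s₂ ∧
      σ' (σ s₂) = σ f₁ := by
    refine exists_removal_three hc hRK ?_ ((hleave _).2 ?_) ((hleave _).2 ?_)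
      ((hleave _).2 ?_) ((hleave _).2 ?_) ((hleave _).2 ?_) ((hleave _).2 ?_) ?_
    · have z1 : σ d ≠ f₂ := ne_of_apply_ne vt (by rwa [vd, vf₂])
      have z2 : σ d ≠ r₀ := ne_of_apply_ne vt (by rwa [vd, vr₀])
      have z3 : σ d ≠ f₁ := ne_of_apply_ne vt (by rwa [vd, vf₁])
      have z4 : σ d ≠ s₂ := ne_of_apply_ne vt (by rwa [vd, vs₂])
      have z5 : f₂ ≠ b := ne_of_apply_ne vt (by rw [vf₂, vb]; exact a3.symm)
      have z6 : f₂ ≠ r₀ := ne_of_apply_ne vt (by rw [vf₂, vr₀]; exact a5.symm)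
      have z7 : f₂ ≠ f₁ := ne_of_apply_ne vt (by rw [vf₂, vf₁]; exact a6.symm)
      have z8 : f₂ ≠ s₂ := fun k => hf₂ (k ▸ hs₂)
      have z9 : b ≠ r₀ := ne_of_apply_ne vt (by rwa [vb, vr₀])
      have w1 : b ≠ f₁ := ne_of_apply_ne vt (by rwa [vb, vf₁])
      have w2 : b ≠ s₂ := ne_of_apply_ne vt (by rwa [vb, vs₂])
      have w3 : r₀ ≠ f₁ := ne_of_apply_ne vt (by rwa [vr₀, vf₁])
      have w4 : r₀ ≠ s₂ := ne_of_apply_ne vt (by rwa [vr₀, vs₂])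
      have w5 : f₁ ≠ s₂ := ne_of_apply_ne vt (by rwa [vf₁, vs₂])
      simp [z1, z2, z3, z4, z5, z6, z7, z8, z9, w1, w2, w3, w4, w5, nbd.symm]
    iterate 6 simp
    intro x y z
    have := (hleave x).1 ⟨y, z⟩
    tauto
  rw [i1] at x1 x2
  refine hr.good hI h3 h4 IH hRK hcard ?_ ?_ hC hon hu hm hm' ?_ ?_
  · have : dcut vt σ R ⊆ {σ d, r₀, f₁, s₂, b, f₂} := by
      intro x hx
      have := (hleave x).1 (mem_dcut.1 hx)
      simpa using this
    exact (card_le_card this).trans card_le_six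
  · intro x y1 y2 y3
    rcases henter x y1 y2 y3 with rfl | rfl | rfl | rfl | rfl | rfl
    · rw [x1]; exact hl3.symm
    · rw [x4]; exact hl1
    · rw [x5]; exact hl2.symm
    · rw [x6]; exact hl2
    · rw [x3]; exact hl1.symm
    · rw [x2]; exact hl3
  · intro F hF hhF
    have hdF : d ∉ F := fun hh => hdh (hF.uniq _ hh _ hhF (by
      rw [hd]; exact mem_sdiff.2 ⟨hI.mem, hm⟩) hd)
    have hKR : ∀ x, vt x ∈ R → vt (σ x) ∉ R → vt (σ x) ∈ K \ R := fun x k k' =>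
      mem_sdiff.2 ⟨hc.mem _ (hRK k), k'⟩
    have y1 : σ f₂ ∉ F := by
      intro hh
      have k := (hleave f₂).2 (by simp)
      have := hF.symm _ hh (hKR _ k.1 k.2)
      rw [x2] at this
      exact hdF this
    have y2 : σ b ∈ F ↔ σ r₀ ∈ F := by
      have k := (hleave r₀).2 (by simp)
      have k' := (hleave b).2 (by simp)
      constructor
      · intro hh
        have := hF.symm _ hh (hKR _ k'.1 k'.2)
        rwa [x3] at this
      · intro hh
        have := hF.symm _ hh (hKR _ k.1 k.2)
        rwa [x4] at this
    have y3 : σ s₂ ∈ F ↔ σ f₁ ∈ F := by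
      have k := (hleave s₂).2 (by simp)
      have k' := (hleave f₁).2 (by simp)
      constructor
      · intro hh
        have := hF.symm _ hh (hKR _ k.1 k.2)
        rwa [x6] at this
      · intro hh
        have := hF.symm _ hh (hKR _ k'.1 k'.2)
        rwa [x5] at this
    have hN : ∃ n₀ n₁, vt n₀ = vt s₀ ∧ vt n₁ = vt (σ q) ∧ (vt (σ n₀) ∈ R → σ n₀ = n₁) ∧
        (vt (σ n₁) ∈ R → σ n₁ = n₀) ∧ (b = n₁ ↔ σ r₀ ∈ F) ∧ (r₀ = n₀ ↔ σ r₀ ∈ F) ∧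
        σ d ≠ n₁ := by
      by_cases hh : σ r₀ ∈ F
      · exact ⟨r₀, b, vr₀, vb, fun k => absurd k ((hleave _).2 (by simp)).2,
          fun k => absurd k ((hleave _).2 (by simp)).2, by simpa, by simpa, nbd.symm⟩
      · refine ⟨q, σ q, vq, rfl, by simp, by simp [i2], iff_of_false nbq hh,
          iff_of_false ?_ hh, ndq⟩
        rintro rfl
        exact hq' hr₀
    have hN' : ∃ n₂ n₃, vt n₂ = vt (σ s₀) ∧ vt n₃ = vt (σ s₁) ∧ (vt (σ n₂) ∈ R → σ n₂ = n₃) ∧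
        (vt (σ n₃) ∈ R → σ n₃ = n₂) ∧ (f₁ = n₂ ↔ σ f₁ ∈ F) ∧ (s₂ = n₃ ↔ σ f₁ ∈ F) ∧
        f₂ ≠ n₃ ∧ (n₂ ∈ S ∨ n₃ ∈ S) := by
      by_cases hh : σ f₁ ∈ F
      · exact ⟨f₁, s₂, vf₁, vs₂, fun k => absurd k ((hleave _).2 (by simp)).2,
          fun k => absurd k ((hleave _).2 (by simp)).2, by simpa, by simpa,
          fun k => hf₂ (k ▸ hs₂), Or.inr hs₂⟩
      · exact ⟨s₁, σ s₁, vs₁, rfl, by simp, by simp [i6],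
          iff_of_false (fun k => hf₁ (k ▸ hs₁)) hh, iff_of_false n₂ hh,
          fun k => hf₂ (k ▸ t2), Or.inl hs₁⟩
    obtain ⟨n₀, n₁, u0, u1, p1, p2, p3, p4, p5⟩ := hN
    obtain ⟨n₂, n₃, u2, u3, q1, q2, q3, q4, q5, q6⟩ := hN'
    have hM2 := four_darts_inj (vt := vt) (x₀ := n₁) (x₁ := n₀) (x₂ := n₂) (x₃ := n₃)
      (by rwa [u0, u1]) (by rwa [u1, u2]) (by rwa [u1, u3]) (by rwa [u0, u2]) (by rwa [u0, u3])
      (by rwa [u2, u3])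
    have ee0 : ∀ x, vt x = vt s₀ → x ∈ ({n₁, n₀, n₂, n₃} : Set D) → x = n₀ :=
      fun x k k' => hM2 x k' n₀ (by simp) (k.trans u0.symm)
    have ee1 : ∀ x, vt x = vt (σ q) → x ∈ ({n₁, n₀, n₂, n₃} : Set D) → x = n₁ :=
      fun x k k' => hM2 x k' n₁ (by simp) (k.trans u1.symm)
    have ee2 : ∀ x, vt x = vt (σ s₀) → x ∈ ({n₁, n₀, n₂, n₃} : Set D) → x = n₂ :=
      fun x k k' => hM2 x k' n₂ (by simp) (k.trans u2.symm)
    have ee3 : ∀ x, vt x = vt (σ s₁) → x ∈ ({n₁, n₀, n₂, n₃} : Set D) → x = n₃ :=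
      fun x k k' => hM2 x k' n₃ (by simp) (k.trans u3.symm)
    obtain ⟨F', hF', G1, G2⟩ := hr.glue hc hF (M := {n₁, n₀, n₂, n₃}) (fun v hv => by
        rcases (hin v).1 hv with rfl | rfl | rfl | rfl
        exacts [⟨n₁, by simp, u1⟩, ⟨n₀, by simp, u0⟩, ⟨n₂, by simp, u2⟩, ⟨n₃, by simp, u3⟩])
      hM2 (fun x hx hxR => by
        simp only [Set.mem_insert_iff, Set.mem_singleton_iff] at hx ⊢
        rcases hx with rfl | rfl | rfl | rfl
        · exact Or.inr (Or.inl (p2 hxR))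
        · exact Or.inl (p1 hxR)
        · exact Or.inr (Or.inr (Or.inr (q1 hxR)))
        · exact Or.inr (Or.inr (Or.inl (q2 hxR))))
      (fun x k1 k2 => by
      rcases (hleave x).1 ⟨k1, k2⟩ with rfl | rfl | rfl | rfl | rfl | rfl
      · rw [i1]; exact iff_of_false (fun k => p5 (ee1 _ vd k)) hdF
      · rw [← p4]; exact ⟨ee0 _ vr₀, fun k => by simp [k]⟩
      · rw [← q3]; exact ⟨ee2 _ vf₁, fun k => by simp [k]⟩
      · rw [y3, ← q4]; exact ⟨ee3 _ vs₂, fun k => by simp [k]⟩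
      · rw [y2, ← p3]; exact ⟨ee1 _ vb, fun k => by simp [k]⟩
      · exact iff_of_false (fun k => q5 (ee3 _ vf₂ k)) y1)
    refine ⟨F', hF', fun x k _ => G1 x k, ?_⟩
    rcases q6 with k | k
    · exact ⟨n₂, G2 _ (by simp) ((hin _).2 (by rw [u2]; simp)), k, u2 ▸ m1⟩
    · exact ⟨n₃, G2 _ (by simp) ((hin _).2 (by rw [u3]; simp)), k, u3 ▸ m2⟩
  · intro C hC' hCC Y hY hhY hdis hland hcut
    have key := hr.parity hc hS hC.toSClosed hCC.symm hY hland t4 t3 (a := σ r₀) (b := σ s₂)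
      ?_ my m3 ?_ ?_ ?_
    · have hdY : vt d ∈ Y := hd ▸ hhY
      by_cases hs : vt (σ s₂) ∈ Y
      · left
        intro x y1 y2 y3
        rcases henter x y1 y2 y3 with rfl | rfl | rfl | rfl | rfl | rfl
        · exact Or.inl hdY
        · exact Or.inl (key.2 hs)
        · rw [x5]; exact Or.inr hs
        · exact Or.inl hs
        · rw [x3]; exact Or.inr (key.2 hs)
        · rw [x2]; exact Or.inr hdY
      · have hy : vt (σ r₀) ∉ Y := mt key.1 hs
        have w1 : vt (σ b) ∉ Y := fun k => by
          have := hland (σ b) (mem_dcut.2 ⟨k, by rwa [x3]⟩)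
          rw [x3] at this
          exact disjoint_left.1 hCC this my
        have w2 : vt (σ f₁) ∉ Y := fun k => by
          have := hland (σ f₁) (mem_dcut.2 ⟨k, by rwa [x5]⟩)
          rw [x5] at this
          exact disjoint_left.1 hCC this m3
        by_cases w3 : vt (σ f₂) ∈ Y
        · exfalso
          refine absurd (hcon Y C (hr.tight h4 hRK hcard hY hC' hdis hland hcut hdY w3
            ?_ ?_ hl3 ?_) hCC) ?_
          · exact ((hleave (σ d)).2 (by simp)).1
          · rw [i9]; exact ((hleave f₂).2 (by simp)).1
          · intro x y2 y3
            have y1 := mem_sdiff.1 (hY y2)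
            rcases henter x y1.1 y1.2 y3 with rfl | rfl | rfl | rfl | rfl | rfl
            · exact Or.inl rfl
            · exact absurd y2 hy
            · exact absurd y2 w2
            · exact absurd y2 hs
            · exact absurd y2 w1
            · exact Or.inr rfl
          · exact fun k => (mem_sdiff.1 (hY k)).2 ((hin _).2 (by simp))
        · right
          intro x y2 y3
          have y1 := mem_sdiff.1 (hY y2)
          rcases henter x y1.1 y1.2 y3 with rfl | rfl | rfl | rfl | rfl | rfl
          · rwa [x1]
          · exact absurd y2 hy
          · exact absurd y2 w2
          · exact absurd y2 hs
          · exact absurd y2 w1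
          · exact absurd y2 w3
    · intro hh
      have : r₀ = s₂ := by rw [← i4, hh, i7]
      exact a5 (by rw [← vr₀, this, vs₂])
    · rw [i4]; exact ((hleave r₀).2 (by simp)).1
    · rw [i7]; exact ((hleave s₂).2 (by simp)).1
    · intro x y0 y1 y2 y3
      have := hS.symm x y0 (hC.sub y1)
      rcases henter x (hC.sub y1) y2 y3 with rfl | rfl | rfl | rfl | rfl | rfl
      · exact absurd rfl (offu _ y0)
      · exact Or.inl rfl
      · rw [i8] at this; exact absurd this hf₁
      · exact Or.inr rfl
      · rw [i3] at this; exact absurd vb (offp _ this)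
      · rw [i9] at this; exact absurd this hf₂

end

section
variable {W D : Type*} [DecidableEq W] [DecidableEq D] [Fintype D] {vt : D → W}
  {K R X : Finset W} {σ σ' : D → D} {S : Finset D} {h : D}
variable {C₀ : Finset W} {d b q r₀ s₀ s₁ f₁ s₂ f₂ : D}

theorem Fork.ends (hc : IsCubic vt K σ) (hG : GirthFour vt K σ) (hS : IsTwoReg vt K σ S)
    (hC : IsComp vt K σ S C₀) (hf : Fork vt K S C₀ σ d b q r₀ s₀ s₁ f₁ s₂ f₂) :
    Ends vt K σ s₀ r₀ q f₁ s₁ := by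
  obtain ⟨⟨-, k0, -⟩, -, ⟨t1, -⟩, -⟩ := hf.basic hc hS hC
  refine hG.ends hc k0 ⟨hf.vr₀, hf.vq⟩ ⟨hf.vf₁, hf.vs₁⟩
    ⟨hf.n₀, fun k => hf.hq (k ▸ hf.hs₀), fun k => hf.hq (k ▸ hf.hr₀)⟩
    ⟨fun k => hf.hf₁ (k ▸ t1), hf.n₁, fun k => hf.hf₁ (k ▸ hf.hs₁)⟩ hf.all₀
    (fun x hx => ?_)
  have := hf.all₁ x hx
  tauto

theorem square_choice {f₃ : D} (vr₀ : vt r₀ = vt s₀) (vq : vt q = vt s₀) (vs₁ : vt s₁ = vt (σ s₀))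
    (vf₁ : vt f₁ = vt (σ s₀)) (vs₂ : vt s₂ = vt (σ s₁)) (vf₂ : vt f₂ = vt (σ s₁))
    (vf₃ : vt f₃ = vt (σ r₀)) (hsq : vt (σ s₂) = vt (σ r₀)) (i4 : σ (σ r₀) = r₀)
    (i5 : σ (σ s₀) = s₀) (i6 : σ (σ s₁) = s₁) (i7 : σ (σ s₂) = s₂) (hr₀ : r₀ ∈ S) (hs₀ : s₀ ∈ S)
    (hs₁ : s₁ ∈ S) (hs₂ : s₂ ∈ S) (hq : q ∉ S) (hf₁ : f₁ ∉ S) (hf₂ : f₂ ∉ S) (hf₃ : f₃ ∉ S)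
    (t1 : σ s₀ ∈ S) (t2 : σ s₁ ∈ S) (t3 : σ s₂ ∈ S) {F : Set D}
    (x₁ : σ s₁ ∈ F ∨ s₂ ∈ F ∨ f₂ ∈ F) (x₂ : σ s₁ ∈ F → s₂ ∉ F) (x₃ : σ s₁ ∈ F → f₂ ∉ F)
    (x₄ : s₂ ∈ F → f₂ ∉ F) (y₁ : σ r₀ ∈ F ∨ σ s₂ ∈ F ∨ f₃ ∈ F) (y₂ : σ r₀ ∈ F → σ s₂ ∉ F)
    (y₃ : σ r₀ ∈ F → f₃ ∉ F) (y₄ : σ s₂ ∈ F → f₃ ∉ F) (hs : s₂ ∈ F ↔ σ s₂ ∈ F) :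
    ∃ n₀ n₁ n₂ n₃, vt n₀ = vt s₀ ∧ vt n₁ = vt (σ s₀) ∧ vt n₂ = vt (σ s₁) ∧
      vt n₃ = vt (σ r₀) ∧ (∀ x, x = n₀ ∨ x = n₁ ∨ x = n₂ ∨ x = n₃ →
        (x = q ∨ x = f₁ ∨ x = f₂ ∨ x = f₃) ∨ σ x = n₀ ∨ σ x = n₁ ∨ σ x = n₂ ∨ σ x = n₃) ∧
      (q = n₀ ↔ σ s₁ ∈ F) ∧ (f₁ = n₁ ↔ σ r₀ ∈ F) ∧ (f₂ = n₂ ↔ f₂ ∈ F) ∧ (f₃ = n₃ ↔ f₃ ∈ F) ∧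
      (n₀ ∈ S ∨ n₁ ∈ S ∨ n₂ ∈ S ∨ n₃ ∈ S) := by
  have hne : ∀ {x y}, x ∉ S → y ∈ S → x ≠ y := fun k k' e => k (e ▸ k')
  by_cases q0 : s₂ ∈ F
  · refine ⟨s₀, σ s₀, s₂, σ s₂, rfl, rfl, vs₂, hsq, ?_, iff_of_false (hne hq hs₀) (x₂ · q0),
      iff_of_false (hne hf₁ t1) (y₂ · (hs.1 q0)), iff_of_false (hne hf₂ hs₂) (x₄ q0),
      iff_of_false (hne hf₃ t3) (y₄ (hs.1 q0)), Or.inl hs₀⟩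
    rintro x (rfl | rfl | rfl | rfl) <;> simp [i5, i7]
  have q0' := mt hs.2 q0
  by_cases q1 : σ s₁ ∈ F
  · by_cases q2 : σ r₀ ∈ F
    · refine ⟨q, f₁, s₂, σ s₂, vq, vf₁, vs₂, hsq, ?_, iff_of_true rfl q1, iff_of_true rfl q2,
        iff_of_false (hne hf₂ hs₂) (x₃ q1), iff_of_false (hne hf₃ t3) (y₃ q2), by simp [hs₂]⟩
      rintro x (rfl | rfl | rfl | rfl) <;> simp [i7]
    · refine ⟨q, s₁, σ s₁, f₃, vq, vs₁, rfl, vf₃, ?_, iff_of_true rfl q1,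
        iff_of_false (hne hf₁ hs₁) q2, iff_of_false (hne hf₂ t2) (x₃ q1),
        iff_of_true rfl (y₁.resolve_left q2 |>.resolve_left q0'), by simp [hs₁]⟩
      rintro x (rfl | rfl | rfl | rfl) <;> simp [i6]
  · have q3 : f₂ ∈ F := (x₁.resolve_left q1).resolve_left q0
    by_cases q2 : σ r₀ ∈ F
    · refine ⟨r₀, f₁, f₂, σ r₀, vr₀, vf₁, vf₂, rfl, ?_, iff_of_false (hne hq hr₀) q1,
        iff_of_true rfl q2, iff_of_true rfl q3, iff_of_false ?_ (y₃ q2), Or.inl hr₀⟩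
      · rintro x (rfl | rfl | rfl | rfl) <;> simp [i4]
      · rintro rfl; exact y₃ q2 q2
    · refine ⟨s₀, σ s₀, f₂, f₃, rfl, rfl, vf₂, vf₃, ?_, iff_of_false (hne hq hs₀) q1,
        iff_of_false (hne hf₁ t1) q2, iff_of_true rfl q3,
        iff_of_true rfl (y₁.resolve_left q2 |>.resolve_left q0'), Or.inl hs₀⟩
      rintro x (rfl | rfl | rfl | rfl) <;> simp [i5]

set_option maxHeartbeats 2000000 in
/-- The component is a quadrangle. -/
theorem Fork.good_of_square (hI : Inst vt K σ S h) (h3 : CutGe vt K σ 3)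
    (h4 : CutGeFour vt K σ) (hG : GirthFour vt K σ)
    (IH : ∀ K' σ' S' h', #K' < #K → Inst vt K' σ' S' h' → Good vt K' σ' S' h')
    (hu : ∀ e ∈ S, vt e ≠ vt h) (hC : IsComp vt K σ S C₀)
    (hf : Fork vt K S C₀ σ d b q r₀ s₀ s₁ f₁ s₂ f₂) (hd : vt d = vt h) (hdh : d ≠ h)
    (hsq : vt (σ s₂) = vt (σ r₀)) : Good vt K σ S h := by
  have hc := hI.cub
  have hS := hI.reg
  have he := hf.ends hc hG hS hC
  obtain ⟨⟨kp, k0, k1, k2⟩, ⟨m1, m2, m3, my, mp⟩, ⟨t1, t2, t3, t4⟩,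
    i1, i2, i3, i4, i5, i6, i7, i8, i9⟩ := hf.basic hc hS hC
  obtain ⟨hm, hm'⟩ := hf.notMem hc hG hS hC hd hdh
  obtain ⟨⟨a1, a2, a3, a4, a5, a6⟩, -, -, ⟨d1, d2, d3, d4⟩,
    ⟨e1, e2, e3, e4⟩, ⟨f1, f2, f3⟩, -, ⟨-, hl2, -, -, -⟩, -⟩ :=
    hf.heads hc hG hS hC
  obtain ⟨σ', hr, x1, x2, x3, x4⟩ := he.exists_removal hc
  have hloop := he.no_loop hc hG x1 x2 x3 x4
  have hN := he.card_dcut hc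
  have hRK := he.sub hc
  have henter := fun x => he.enter hc (d := x)
  have hleave := he.dcut_iff hc
  have hin : ∀ v, v ∈ ({vt s₀, vt (σ s₀)} : Finset W) ↔ v = vt s₀ ∨ v = vt (σ s₀) := by simp
  have hcard : 2 ≤ #({vt s₀, vt (σ s₀)} : Finset W) := by
    rw [← card_pair a4]
  clear he
  generalize ({vt s₀, vt (σ s₀)} : Finset W) = R at *
  obtain ⟨m0, hr₀, hs₀, hq', hs₁, hf₁, hs₂, hf₂, vr₀, vq, vs₁, vf₁, vs₂, vf₂, n₀, n₁, n₂, all₀,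
    all₁, all₂, hdK, vd, vb, ndq, nbd, nbq, allp, offp, offu, offN⟩ := hf
  have hne : σ r₀ ≠ σ s₂ := by
    intro hh
    have : r₀ = s₂ := by rw [← i4, hh, i7]
    exact a5 (by rw [← vr₀, this, vs₂])
  obtain ⟨f₃, g, hg₁, hg₂, hg₃, vf₃, vg, hf₃, -, hall⟩ : ∃ f₃ g, f₃ ≠ σ r₀ ∧ g ≠ σ r₀ ∧ g ≠ f₃ ∧
      vt f₃ = vt (σ r₀) ∧ vt g = vt (σ r₀) ∧ f₃ ∉ S ∧ g ∈ S ∧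
      ∀ x, vt x = vt (σ r₀) → x = σ r₀ ∨ x = g ∨ x = f₃ := by
    obtain ⟨a, z, y1, y2, y3, y4, y5, y6, y7, y8⟩ := hS.exists_of_mem hc (hC.sub my) t4
    exact ⟨z, a, y2, y1, y3, y5, y4, y7, y6, y8⟩
  obtain rfl : g = σ s₂ := by
    rcases hall _ hsq with k | k | k
    · exact absurd k.symm hne
    · exact k.symm
    · exact absurd (k ▸ t3) hf₃
  have ky := hC.sub my
  have i10 : σ (σ f₃) = f₃ := hc.inv _ (vf₃ ▸ ky)
  have w0 : vt (σ f₃) ≠ vt s₀ := by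
    intro k
    rcases all₀ _ k with k | k | k
    · rw [← k, i10] at t1; exact hf₃ t1
    · rw [← k, i10] at t4; exact hf₃ t4
    · rw [← k, i10, vf₃] at mp; exact mp my
  have w1 : vt (σ f₃) ≠ vt (σ s₀) := by
    intro k
    rcases all₁ _ k with k | k | k
    · have : f₃ = s₀ := by rw [← i10, k, i5]
      exact hf₃ (this ▸ hs₀)
    · rw [← k, i10] at t2; exact hf₃ t2
    · rw [← k, i10, hsq, vf₃] at hl2; exact hl2 rfl
  have w2 : vt (σ f₃) ≠ vt (σ s₁) := by
    intro k
    have := hG.parallel f₃ (σ s₂) (vf₃ ▸ ky) (vf₃.trans hsq.symm) (by rw [k, i7, vs₂])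
    exact hf₃ (this ▸ t3)
  have w3 : vt (σ f₃) ≠ vt (σ r₀) := vf₃ ▸ hG.loop f₃ (vf₃ ▸ ky)
  have z3 : vt (σ f₂) ≠ vt (σ r₀) := by
    intro k
    have := hG.parallel f₂ s₂ (vf₂ ▸ k2) (vf₂.trans vs₂.symm) (k.trans hsq.symm)
    exact hf₂ (this ▸ hs₂)
  have e5 : vt (σ f₁) ≠ vt (σ r₀) := hsq ▸ hl2
  have hCR : ∀ v ∈ R, v ∈ C₀ := fun v hv => by
    rcases (hin v).1 hv with rfl | rfl <;> assumption
  have hoff : vt h ∉ C₀ := by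
    intro hh
    obtain ⟨e, he, he'⟩ := hC.on _ hh
    exact hu e he he'
  have hoff' : vt (σ h) ∉ C₀ := by
    intro hh
    obtain ⟨e, he, he'⟩ := hC.on _ hh
    exact offN h hd.symm e he he'
  have nR : vt (σ s₁) ∉ R ∧ vt (σ r₀) ∉ R := by
    simp only [hin]; exact ⟨by simp [a5.symm, a6.symm], by simp [d2, d3]⟩
  refine hr.good hI h3 h4 IH hRK hcard hN hloop hC ?_ hu (fun k => hoff (hCR _ k))
    (fun k => hoff' (hCR _ k)) ?_ ?_
  · intro e _ k
    exact hCR _ k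
  · intro F hF hhF
    have hKR : ∀ x, vt x ∈ K → vt x ∉ R → vt x ∈ K \ R := fun x k k' => mem_sdiff.2 ⟨k, k'⟩
    have hsw : ∀ x y, vt x ∈ K → vt x ∉ R → vt y ∈ K → vt y ∉ R → σ' x = y → σ' y = x →
        (x ∈ F ↔ y ∈ F) := by
      intro x y p1 p2 p3 p4 p5 p6
      exact ⟨fun k => p5 ▸ hF.symm x k (hKR _ p1 p2), fun k => p6 ▸ hF.symm y k (hKR _ p3 p4)⟩
    have y1 : σ q ∈ F ↔ σ s₁ ∈ F :=
      hsw _ _ kp (fun k => mp (hCR _ k)) k2 nR.1 x3 x4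
    have y2 : σ f₁ ∈ F ↔ σ r₀ ∈ F :=
      hsw _ _ (hc.mem _ (vf₁ ▸ k1)) (by rw [hin]; simp [e2, e3]) ky nR.2 x2 x1
    have hag : ∀ x, vt x ∈ K → vt x ∉ R → vt (σ x) ∉ R → (x ∈ F ↔ σ x ∈ F) := fun x p1 p2 p3 =>
      hsw _ _ p1 p2 (hc.mem _ p1) p3 (hr.agree _ p1 p2 p3) (by
        rw [hr.agree _ (hc.mem _ p1) p3 (by rwa [hc.inv _ p1]), hc.inv _ p1])
    have y3 : s₂ ∈ F ↔ σ s₂ ∈ F := hag s₂ (vs₂ ▸ k2) (vs₂ ▸ nR.1) (by rw [hsq]; exact nR.2)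
    have y4 : f₂ ∈ F ↔ σ f₂ ∈ F := hag f₂ (vf₂ ▸ k2) (vf₂ ▸ nR.1) (by rw [hin]; simp [f1, f2])
    have y5 : f₃ ∈ F ↔ σ f₃ ∈ F := hag f₃ (vf₃ ▸ ky) (vf₃ ▸ nR.2) (by rw [hin]; simp [w0, w1])
    obtain ⟨c, hcF, hcv⟩ := hF.ex _ (hKR _ k2 nR.1)
    obtain ⟨c', hcF', hcv'⟩ := hF.ex _ (hKR _ ky nR.2)
    have o2 : ∀ x, vt x = vt (σ s₁) → (x ∈ F ↔ x = c) := fun x hx =>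
      ⟨fun k => (hF.uniq c hcF x k (hcv ▸ hKR _ k2 nR.1) (hcv.trans hx.symm)).symm,
        fun k => k ▸ hcF⟩
    have o3 : ∀ x, vt x = vt (σ r₀) → (x ∈ F ↔ x = c') := fun x hx =>
      ⟨fun k => (hF.uniq c' hcF' x k (hcv' ▸ hKR _ ky nR.2) (hcv'.trans hx.symm)).symm,
        fun k => k ▸ hcF'⟩
    have u1 := o2 _ rfl
    have u2 := o2 _ vs₂
    have u3 := o2 _ vf₂
    have u4 := o3 _ rfl
    have u5 := o3 _ hsq
    have u6 := o3 _ vf₃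
    have v1 : f₂ ≠ s₂ := fun k => hf₂ (k ▸ hs₂)
    have v2 : f₂ ≠ σ s₁ := fun k => hf₂ (k ▸ t2)
    have v3 : f₃ ≠ σ s₂ := fun k => hf₃ (k ▸ t3)
    have hN := square_choice vr₀ vq vs₁ vf₁ vs₂ vf₂ vf₃ hsq i4 i5 i6 i7 hr₀ hs₀ hs₁ hs₂ hq'
      hf₁ hf₂ hf₃
      t1 t2 t3 (F := F) (by rw [u1, u2, u3]; rcases all₂ c hcv with k | k | k <;> simp [k])
      (by rw [u1, u2]; rintro k rfl; exact n₂ k.symm)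
      (by rw [u1, u3]; rintro k rfl; exact v2 k.symm)
      (by rw [u2, u3]; rintro k rfl; exact v1 k.symm)
      (by rw [u4, u5, u6]; rcases hall c' hcv' with k | k | k <;> simp [k])
      (by rw [u4, u5]; rintro k rfl; exact hg₂ k.symm)
      (by rw [u4, u6]; rintro k rfl; exact hg₁ k.symm)
      (by rw [u5, u6]; rintro k rfl; exact v3 k.symm) y3
    clear u1 u2 u3 u4 u5 u6 o2 o3
    obtain ⟨n₀, n₁, n₂, n₃, l0, l1, l2, l3, hcl, c0, c1, c2, c3, hSn⟩ := hN
    have hM2 := four_darts_inj (vt := vt) (x₀ := n₀) (x₁ := n₁) (x₂ := n₂) (x₃ := n₃)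
      (by rwa [l0, l1]) (by rwa [l0, l2]) (by rw [l0, l3]; exact d2.symm) (by rwa [l1, l2])
      (by rw [l1, l3]; exact d3.symm) (by rw [l2, l3]; exact d4.symm)
    have hX : ∀ v, v ∈ ({vt s₀, vt (σ s₀), vt (σ s₁), vt (σ r₀)} : Finset W) ↔
      v = vt s₀ ∨ v = vt (σ s₀) ∨ v = vt (σ s₁) ∨ v = vt (σ r₀) := by simp
    have hXC : ∀ v ∈ ({vt s₀, vt (σ s₀), vt (σ s₁), vt (σ r₀)} : Finset W), v ∈ C₀ := by
      intro v hv
      rcases (hX v).1 hv with rfl | rfl | rfl | rfl <;> assumption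
    generalize ({vt s₀, vt (σ s₀), vt (σ s₁), vt (σ r₀)} : Finset W) = X at *
    have hXR : ∀ v, v ∉ X → v ∉ R := by
      intro v hv k
      apply hv
      rcases (hin v).1 k with k | k <;> simp [hX, k]
    have hM : ∀ x, x ∈ ({n₀, n₁, n₂, n₃} : Set D) ↔ x = n₀ ∨ x = n₁ ∨ x = n₂ ∨ x = n₃ := by simp
    have hMv : ∀ v ∈ X, ∃ x ∈ ({n₀, n₁, n₂, n₃} : Set D), vt x = v := by
      intro v hv
      rcases (hX v).1 hv with rfl | rfl | rfl | rfl
      exacts [⟨n₀, by simp, l0⟩, ⟨n₁, by simp, l1⟩, ⟨n₂, by simp, l2⟩, ⟨n₃, by simp, l3⟩]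
    have hMi : ∀ {x y}, vt x = vt y → y ∈ ({n₀, n₁, n₂, n₃} : Set D) →
        (x ∈ ({n₀, n₁, n₂, n₃} : Set D) ↔ x = y) := fun k1 k2 =>
      ⟨fun k => hM2 _ k _ k2 k1, fun k => k ▸ k2⟩
    have j0 := hMi (vq.trans l0.symm) (by simp)
    have j1 := hMi (vf₁.trans l1.symm) (by simp)
    have j2 := hMi (vf₂.trans l2.symm) (by simp)
    have j3 := hMi (vf₃.trans l3.symm) (by simp)
    have hMc : ∀ x ∈ ({n₀, n₁, n₂, n₃} : Set D), vt (σ x) ∈ X →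
        σ x ∈ ({n₀, n₁, n₂, n₃} : Set D) := by
      intro x hx hxX
      rw [hM] at hx ⊢
      rw [hX] at hxX
      rcases hcl x hx with (rfl | rfl | rfl | rfl) | k
      · exact absurd (hXC _ ((hX _).2 hxX)) mp
      · simp [e2, e3, e4, e5] at hxX
      · simp [f1, f2, f3, z3] at hxX
      · simp [w0, w1, w2, w3] at hxX
      · exact k
    have hall : ∀ x, vt x ∈ X → vt (σ x) ∉ X → x = q ∨ x = f₁ ∨ x = f₂ ∨ x = f₃ := by
      intro x hx hx'
      simp only [hX, not_or] at hx hx'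
      obtain ⟨o1, o2, o3, o4⟩ := hx'
      rcases hx with k | k | k | k
      · rcases all₀ x k with rfl | rfl | rfl
        · exact absurd rfl o2
        · exact absurd rfl o4
        · simp
      · rcases all₁ x k with rfl | rfl | rfl
        · rw [i5] at o1; exact absurd rfl o1
        · exact absurd rfl o3
        · simp
      · rcases all₂ x k with rfl | rfl | rfl
        · rw [i6, vs₁] at o2; exact absurd rfl o2
        · exact absurd hsq o4
        · simp
      · rcases hall x k with rfl | rfl | rfl
        · rw [i4] at o1; exact absurd vr₀ o1
        · rw [i7] at o3; exact absurd vs₂ o3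
        · simp
    refine ⟨_, IsPM.glue hc (X := X) (F₁ := {n₀, n₁, n₂, n₃}) (F₂ := F) (fun v _ => hMv v)
      (fun v hv hvX => hF.ex v (mem_sdiff.2 ⟨hv, hXR v hvX⟩)) (fun d hd e he _ _ => hM2 d hd e he)
      (fun d hd e he k1 k2 => hF.uniq d hd e he (mem_sdiff.2 ⟨k1, hXR _ k2⟩))
      (fun d hd _ _ => hMc d hd)
      (fun d hd k1 k2 k3 => (hag d k1 (hXR _ k2) (hXR _ k3)).1 hd)
      (fun x _ q2 q3 => ?_),
      fun _ _ k1 k2 => Or.inr ⟨fun k => k1 (hXC _ k), k2⟩, ?_⟩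
    · rcases hall x q2 q3 with rfl | rfl | rfl | rfl
      · rw [j0, c0, y1]
      · rw [j1, c1, y2]
      · rw [j2, c2, y4]
      · rw [j3, c3, y5]
    · have hfin : ∀ x ∈ ({n₀, n₁, n₂, n₃} : Set D), vt x ∈ X := by
        intro x hx
        rw [hX]
        rcases (hM x).1 hx with rfl | rfl | rfl | rfl <;> simp [*]
      rcases hSn with k | k | k | k
      all_goals exact ⟨_, Or.inl ⟨hfin _ ((hM _).2 (by simp)), (hM _).2 (by simp)⟩, k,
        hXC _ (hfin _ ((hM _).2 (by simp)))⟩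
  · intro C hC' hCC Y hY hhY hdis hland hcut
    have hR2 : ∀ x, x = r₀ ∨ x = q ∨ x = f₁ ∨ x = s₁ → vt x ∈ R ∧ vt (σ x) ∉ R :=
      fun x => (hleave x).2
    have key := hr.parity hc hS hC.toSClosed hCC.symm hY hland t4 t2 (a := σ r₀) (b := σ s₁)
      ?_ my m2 ?_ ?_ ?_
    · by_cases hs : vt (σ s₁) ∈ Y
      · left
        intro x y1 y2 y3
        rcases henter x y1 y2 y3 with rfl | rfl | rfl | rfl
        · exact Or.inl (key.2 hs)
        · rw [x3]; exact Or.inr hs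
        · rw [x2]; exact Or.inr (key.2 hs)
        · exact Or.inl hs
      · right
        intro x y2 y3
        have y1 := mem_sdiff.1 (hY y2)
        rcases henter x y1.1 y1.2 y3 with rfl | rfl | rfl | rfl
        · exact absurd (key.1 y2) hs
        · rwa [x3]
        · rw [x2]; exact mt key.1 hs
        · exact absurd y2 hs
    · intro hh
      exact d4 (hh ▸ rfl)
    · rw [i4]; exact (hR2 r₀ (by simp)).1
    · rw [i6]; exact (hR2 s₁ (by simp)).1
    · intro x y0 y1 y2 y3
      have := hS.symm x y0 (hC.sub y1)
      rcases henter x (hC.sub y1) y2 y3 with rfl | rfl | rfl | rfl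
      · exact Or.inl rfl
      · exact absurd y1 mp
      · rw [i8] at this; exact absurd this hf₁
      · exact Or.inr rfl

end

section
variable {W D : Type*} [DecidableEq W] [DecidableEq D] [Fintype D] {vt : D → W}
  {K R X : Finset W} {σ σ' : D → D} {S : Finset D} {h : D}
variable {C₀ : Finset W} {d b q r₀ s₀ : D}

theorem exists_fork (hc : IsCubic vt K σ) (hS : IsTwoReg vt K σ S) (hC : IsComp vt K σ S C₀)
    (mem : vt s₀ ∈ C₀) (hr₀ : r₀ ∈ S) (hs₀ : s₀ ∈ S) (hq : q ∉ S) (vr₀ : vt r₀ = vt s₀)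
    (vq : vt q = vt s₀) (n₀ : r₀ ≠ s₀) (all₀ : ∀ x, vt x = vt s₀ → x = s₀ ∨ x = r₀ ∨ x = q)
    (hd : vt d ∈ K) (vd : vt (σ d) = vt (σ q)) (vb : vt b = vt (σ q)) (ndq : σ d ≠ σ q)
    (nbd : b ≠ σ d) (nbq : b ≠ σ q) (allp : ∀ x, vt x = vt (σ q) → x = σ d ∨ x = σ q ∨ x = b)
    (offp : ∀ e ∈ S, vt e ≠ vt (σ q)) (offu : ∀ e ∈ S, vt e ≠ vt d)
    (offN : ∀ x, vt x = vt d → ∀ e ∈ S, vt e ≠ vt (σ x)) :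
    ∃ s₁ f₁ s₂ f₂, Fork vt K S C₀ σ d b q r₀ s₀ s₁ f₁ s₂ f₂ := by
  have m1 := hC.closed _ hs₀ mem
  obtain ⟨s₁, f₁, n₁, -, -, vs₁, vf₁, hs₁, hf₁, all₁⟩ :=
    hS.exists_of_mem hc (hC.sub m1) (hS.symm _ hs₀ (hC.sub mem))
  have m1' : vt s₁ ∈ C₀ := vs₁ ▸ m1
  have m2 := hC.closed _ hs₁ m1'
  obtain ⟨s₂, f₂, n₂, -, -, vs₂, vf₂, hs₂, hf₂, all₂⟩ :=
    hS.exists_of_mem hc (hC.sub m2) (hS.symm _ hs₁ (hC.sub m1'))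
  exact ⟨s₁, f₁, s₂, f₂, mem, hr₀, hs₀, hq, hs₁, hf₁, hs₂, hf₂, vr₀, vq, vs₁, vf₁, vs₂, vf₂, n₀,
    n₁, n₂, all₀, all₁, all₂, hd, vd, vb, ndq, nbd, nbq, allp, offp, offu, offN⟩

theorem Inst.good_of_fork (hI : Inst vt K σ S h) (h3 : CutGe vt K σ 3)
    (h4 : CutGeFour vt K σ) (hG : GirthFour vt K σ)
    (IH : ∀ K' σ' S' h', #K' < #K → Inst vt K' σ' S' h' → Good vt K' σ' S' h')
    (hu : ∀ e ∈ S, vt e ≠ vt h) (hN : ∀ x, vt x = vt h → ∀ e ∈ S, vt e ≠ vt (σ x))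
    (hd : vt d = vt h) (hdh : d ≠ h) {b₀ : D} (hb : vt b₀ = vt (σ d)) (hbd : b₀ ≠ σ d)
    (hC : IsComp vt K σ S C₀) (hbC : vt (σ b₀) ∈ C₀) : Good vt K σ S h := by
  have hc := hI.cub
  have hS := hI.reg
  have hdK : vt d ∈ K := hd ▸ hI.mem
  have hp := hN d hd
  have md := hc.mem d hdK
  have hbK : vt b₀ ∈ K := hb ▸ md
  have ib := hc.inv b₀ hbK
  obtain ⟨x, y, k1, k2, k3, k4, k5, k6⟩ := hc.exists_three md
  obtain ⟨b, n1, n2, vb, allp⟩ : ∃ b, b ≠ σ d ∧ b ≠ b₀ ∧ vt b = vt (σ d) ∧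
      ∀ x, vt x = vt (σ d) → x = σ d ∨ x = b₀ ∨ x = b := by
    rcases k6 b₀ hb with k | rfl | rfl
    · exact absurd k hbd
    · exact ⟨y, k2, k3.symm, k5, k6⟩
    · exact ⟨x, k1, k3, k4, fun z hz => by have := k6 z hz; tauto⟩
  have hq : σ b₀ ∉ S := fun k => hp b₀ (ib ▸ hS.symm _ k (hC.sub hbC)) hb
  obtain ⟨s, r, -, -, nsr, vs, vr, hs, hr, all₀⟩ :=
    hS.exists_of_notMem hc (hC.sub hbC) hq (hC.on _ hbC)
  have hfork : ∀ s r, s ≠ r → vt s = vt (σ b₀) → vt r = vt (σ b₀) → s ∈ S → r ∈ S →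
      (∀ x, vt x = vt (σ b₀) → x = σ b₀ ∨ x = s ∨ x = r) →
      ∃ s₁ f₁ s₂ f₂, Fork vt K S C₀ σ d b (σ b₀) r s s₁ f₁ s₂ f₂ := by
    intro s r nsr vs vr hs hr all₀
    refine exists_fork hc hS hC (vs ▸ hbC) hr hs hq (vr.trans vs.symm) vs.symm nsr.symm
      (fun x hx => by have := all₀ x (hx.trans vs); tauto) hdK ?_ ?_ ?_ n1 ?_ ?_ ?_ ?_ ?_
    all_goals try simp only [ib, hb]
    exacts [vb, hbd.symm, n2, allp, hp, fun e he => hd ▸ hu e he, fun x hx => hN x (hx.trans hd)]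
  obtain ⟨s₁, f₁, s₂, f₂, F₁⟩ := hfork s r nsr vs vr hs hr all₀
  obtain ⟨s₁', f₁', s₂', f₂', F₂⟩ := hfork r s nsr.symm vr vs hr hs
    (fun x hx => by have := all₀ x hx; tauto)
  by_cases hq₁ : vt (σ f₂) = vt (σ (σ b₀))
  · exact F₁.good_of_quadrangle hI h3 h4 hG IH hu hC hd hdh hq₁
  by_cases hq₂ : vt (σ f₂') = vt (σ (σ b₀))
  · exact F₂.good_of_quadrangle hI h3 h4 hG IH hu hC hd hdh hq₂
  obtain ⟨-, ⟨m1, m2, m3, my, mp⟩, ⟨t1, t2, t3, t4⟩, i1, i2, i3, i4, i5, i6, i7, i8, i9⟩ :=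
    F₁.basic hc hS hC
  obtain ⟨-, ⟨-, m2', -⟩, ⟨-, t2', -⟩, -, -, -, -, -, j6, -, -, j9⟩ := F₂.basic hc hS hC
  by_cases hsq : vt (σ s₁) = vt (σ s₁')
  · refine F₁.good_of_square hI h3 h4 hG IH hu hC hd hdh ?_
    obtain ⟨-, -, -, ⟨-, -, d3, -⟩, -⟩ := F₁.heads hc hG hS hC
    rcases F₁.all₂ _ hsq.symm with k | k | k
    · have : s₁' = s₁ := by rw [← j6, k, i6]
      exact absurd (by rw [← F₂.vs₁, this, F₁.vs₁]) d3
    · rw [← k, j6, F₂.vs₁]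
    · exact absurd (k ▸ t2') F₁.hf₂
  rcases F₁.good_or_tight hI h3 h4 hG IH hu hC hd hdh hq₁ with k | ⟨X₁, C₁, T₁, D₁, o₁⟩
  · exact k
  rcases F₂.good_or_tight hI h3 h4 hG IH hu hC hd hdh hq₂ with k | ⟨X₂, C₂, T₂, D₂, o₂⟩
  · exact k
  exfalso
  have hdS : d ∉ S := fun k => hu d k hd
  have g1 : σ f₂ ∉ S := fun k => F₁.hf₂ (i9 ▸ hS.symm _ k (hc.mem _ (F₁.vf₂ ▸ hC.sub m2)))
  have g2 : σ f₂' ∉ S := fun k => F₂.hf₂ (j9 ▸ hS.symm _ k (hc.mem _ (F₂.vf₂ ▸ hC.sub m2')))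
  have e1 := T₁.disjoint hC D₁.symm hdS g1 F₁.mem o₁
  have e2 := T₂.disjoint hC D₂.symm hdS g2 F₂.mem o₂
  have v1 : vt (σ (σ f₂)) ∈ C₀ := by rw [i9, F₁.vf₂]; exact m2
  have v2 : vt (σ (σ f₂')) ∈ C₀ := by rw [j9, F₂.vf₂]; exact m2'
  have hD : ∀ C, C = C₁ ∨ C = C₂ → Disjoint C C₀ := by rintro C (rfl | rfl) <;> assumption
  have hp' : vt (σ d) ∉ C₀ := by rw [← hb, ← ib]; exact mp
  refine T₁.uncross hc h3 h4 T₂ (fun k => hp' (k ▸ v1)) ?_ (fun k => hp' (k ▸ v2))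
    (fun k => disjoint_left.1 e2 k v1) (fun k => disjoint_left.1 e1 k v2) ?_
    (fun C k k' => disjoint_left.1 (hD C k) k' v1) (fun C k k' => disjoint_left.1 (hD C k) k' v2)
  · intro k
    apply hsq
    rw [← F₁.vf₂, ← F₂.vf₂, ← i9, ← j9, k]
  · rintro C k k'
    have hcomp : IsComp vt K σ S C := by
      rcases k with rfl | rfl
      exacts [T₁.comp, T₂.comp]
    obtain ⟨e, he, he'⟩ := hcomp.on _ k'
    exact hp e he he'

/-- Every instance has a perfect matching as sought. -/
theorem Inst.good (n : ℕ) : ∀ (K : Finset W) (σ : D → D) (S : Finset D) (h : D), #K = n →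
    Inst vt K σ S h → Good vt K σ S h := by
  induction n using Nat.strong_induction_on with
  | _ n ih =>
  rintro K σ S h rfl hI
  have IH : ∀ K' σ' S' h', #K' < #K → Inst vt K' σ' S' h' → Good vt K' σ' S' h' :=
    fun K' σ' S' h' hlt hI' => ih _ hlt K' σ' S' h' rfl hI'
  have hc := hI.cub
  by_cases h3 : CutGe vt K σ 3
  swap
  · simp only [CutGe, not_forall, not_le] at h3
    obtain ⟨A, h1, h2, h3, h4⟩ := h3
    have := hI.cut A h1 h2 h3
    exact hI.good_of_two_cut IH h1 h2 h3 (by omega)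
  by_cases h4 : CutGeFour vt K σ
  swap
  · simp only [CutGeFour, not_forall, not_le] at h4
    obtain ⟨X, h1, h2, h5, h6⟩ := h4
    have := h3 X h1 (card_pos.1 (by omega)) (by rintro rfl; simp at h5)
    exact hI.good_of_three_cut h3 h1 h2 h5 (by omega) IH
  have hev := hc.even
  have hpos : 0 < #K := card_pos.2 ⟨_, hI.mem⟩
  by_cases k2 : #K = 2
  · exact hI.good_of_card_two h3 k2
  by_cases k4 : #K = 4
  · exact hI.good_of_card_four h3 k4
  have hG := h4.girthFour hc h3 (by obtain ⟨m, hm⟩ := hev; omega)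
  have hcomp : ∀ {v}, v ∈ K → (∃ e ∈ S, vt e = v) → ∃ C, IsComp vt K σ S C ∧ v ∈ C := by
    rintro v hv ⟨e, he, rfl⟩
    exact hI.reg.exists_comp hc he hv
  by_cases hu : ∃ e ∈ S, vt e = vt h
  · obtain ⟨C, hC, hh⟩ := hcomp hI.mem hu
    exact hI.good_of_mem_comp h3 h4 hG IH hC hh
  by_cases hv : ∃ e ∈ S, vt e = vt (σ h)
  · obtain ⟨C, hC, hh⟩ := hcomp (hc.mem _ hI.mem) hv
    exact .of_swap hc hI.mem (hI.swap.good_of_mem_comp h3 h4 hG IH hC hh)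
  push Not at hu hv
  by_cases hN : ∃ x, vt x = vt h ∧ ∃ e ∈ S, vt e = vt (σ x)
  · obtain ⟨x, hx, he⟩ := hN
    obtain ⟨C, hC, hh⟩ := hcomp (hc.mem _ (hx ▸ hI.mem)) he
    exact hI.good_of_adj_comp h3 h4 hG IH hu hv hx hC hh
  push Not at hN
  obtain ⟨d, -, hdh, -, -, hd, -⟩ := hc.exists_three hI.mem
  have hdK : vt d ∈ K := hd ▸ hI.mem
  obtain ⟨t, -, htd, -, -, ht, -⟩ := hc.exists_three (hc.mem d hdK)
  by_cases hT : ∃ e ∈ S, vt e = vt (σ t)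
  · obtain ⟨C, hC, hh⟩ := hcomp (hc.mem _ (ht ▸ hc.mem d hdK)) hT
    exact hI.good_of_fork h3 h4 hG IH hu hN hd hdh ht htd hC hh
  push Not at hT
  exact hI.good_of_path h3 h4 hG IH hu hd hdh (hN d hd) ht htd hT

end

section
variable {G : SimpleGraph V}

theorem exists_dart_of_reachable {H : SimpleGraph V} (hH : H ≤ G) {x y : V}
    (h : H.Reachable x y) {X : Set V} (hx : x ∈ X) (hy : y ∉ X) :
    ∃ d : G.Dart, d.fst ∈ X ∧ d.snd ∉ X ∧ d.edge ∈ H.edgeSet := by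
  obtain ⟨p⟩ := h
  obtain ⟨d, -, h1, h2⟩ := p.exists_boundary_dart X hx hy
  exact ⟨⟨(d.fst, d.snd), hH d.adj⟩, h1, h2, d.adj⟩

theorem exists_adj_of_isCycleSG {O : G.Subgraph} (hO : IsCycleSG O) {v : V} (hv : v ∈ O.verts) :
    ∃ w, O.Adj v w := by
  have h := hO.2 v hv
  obtain ⟨w, hw⟩ := Set.nonempty_of_ncard_ne_zero (s := O.neighborSet v)
    (by rw [sdeg] at h; omega)
  exact ⟨w, hw⟩

/-- In a cubic graph, edge-disjoint cycles are vertex-disjoint. -/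
theorem eq_of_mem_verts (hreg : IsRegular G 3) {𝒪 : Set G.Subgraph}
    (hcyc : ∀ O ∈ 𝒪, IsCycleSG O) (hdisj : PairwiseEdgeDisjoint 𝒪) {O O' : G.Subgraph}
    (hO : O ∈ 𝒪) (hO' : O' ∈ 𝒪) {v : V} (hv : v ∈ O.verts) (hv' : v ∈ O'.verts) : O = O' := by
  by_contra hne
  have hd := hdisj hO hO' hne
  have h1 := (hcyc O hO).2 v hv
  have h2 := (hcyc O' hO').2 v hv'
  have h3 := hreg v
  rw [sdeg] at h1 h2
  have hf : (G.neighborSet v).Finite := Set.finite_of_ncard_ne_zero (by omega)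
  have hs : O.neighborSet v ⊆ G.neighborSet v := O.neighborSet_subset v
  have hs' : O'.neighborSet v ⊆ G.neighborSet v := O'.neighborSet_subset v
  have hdis : Disjoint (O.neighborSet v) (O'.neighborSet v) := by
    rw [Set.disjoint_left]
    intro w hw hw'
    exact Set.disjoint_left.1 hd (show s(v, w) ∈ O.edgeSet from hw)
      (show s(v, w) ∈ O'.edgeSet from hw')
  have := Set.ncard_union_eq hdis (hf.subset hs) (hf.subset hs')
  have := Set.ncard_le_ncard (Set.union_subset hs hs') hf
  omega

variable [Fintype V] [DecidableEq V] [Fintype G.Dart]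

theorem isCubic_dart (hreg : IsRegular G 3) :
    IsCubic (fun d : G.Dart => d.fst) univ Dart.symm where
  mem _ _ := mem_univ _
  inv d _ := d.symm_symm
  ne d _ := d.symm_ne
  deg v _ := by
    classical
    have h := hreg v
    rw [Set.ncard_eq_toFinset_card', Set.toFinset_card, card_neighborSet_eq_degree,
      ← dart_fst_fiber_card_eq_degree] at h
    convert h

theorem cutGe_two_dart (hconn : TwoEdgeConnected G) :
    CutGe (fun d : G.Dart => d.fst) univ Dart.symm 2 := by
  intro X _ ⟨x, hx⟩ hX
  obtain ⟨y, hy⟩ : ∃ y, y ∉ X := by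
    by_contra! h
    exact hX (eq_univ_of_forall h)
  obtain ⟨d, h1, h2, -⟩ := exists_dart_of_reachable le_rfl (hconn.1.preconnected x y)
    (X := X) hx hy
  obtain ⟨e, h3, h4, h5⟩ := exists_dart_of_reachable (G.deleteEdges_le {d.edge})
    ((hconn.2 d.edge d.edge_mem).preconnected x y) (X := X) hx hy
  refine one_lt_card.2 ⟨d, mem_dcut.2 ⟨h1, h2⟩, e, mem_dcut.2 ⟨h3, h4⟩, ?_⟩
  rintro rfl
  simp at h5

variable [DecidableEq G.Dart] {𝒪 𝒞 : Set G.Subgraph} {S : Finset G.Dart} {h : G.Dart}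

theorem isTwoReg_dart (hreg : IsRegular G 3) (hcyc : ∀ O ∈ 𝒪, IsCycleSG O)
    (hdisj : PairwiseEdgeDisjoint 𝒪) (hP : 𝒞 ⊆ 𝒪)
    (hS : ∀ d, d ∈ S ↔ ∃ O ∈ 𝒞, O.Adj d.fst d.snd) :
    IsTwoReg (fun d : G.Dart => d.fst) univ Dart.symm S where
  symm d hd _ := by
    obtain ⟨O, hO, h⟩ := (hS d).1 hd
    exact (hS _).2 ⟨O, hO, h.symm⟩
  deg d hd _ := by
    obtain ⟨O, hO, h⟩ := (hS d).1 hd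
    have h2 := (hcyc O (hP hO)).2 d.fst h.fst_mem
    rw [sdeg] at h2
    rw [← h2, ← Set.ncard_coe_finset]
    refine Set.ncard_congr (fun e _ => e.snd) ?_ ?_ ?_
    · intro e he
      simp only [coe_filter, Set.mem_ofPred_eq] at he
      obtain ⟨O', hO', h'⟩ := (hS e).1 he.1
      obtain rfl := eq_of_mem_verts hreg hcyc hdisj (hP hO) (hP hO') h.fst_mem
        (he.2 ▸ h'.fst_mem)
      exact he.2 ▸ h'
    · intro e e' he he' hee
      simp only [coe_filter, Set.mem_ofPred_eq] at he he'
      exact Dart.ext _ _ (Prod.ext (he.2.trans he'.2.symm) hee)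
    · intro w hw
      refine ⟨⟨(d.fst, w), O.adj_sub hw⟩, ?_, rfl⟩
      simp only [coe_filter, Set.mem_ofPred_eq, and_true]
      exact (hS _).2 ⟨O, hO, hw⟩

theorem adj_of_mem_verts (hreg : IsRegular G 3) (hcyc : ∀ O ∈ 𝒪, IsCycleSG O)
    (hdisj : PairwiseEdgeDisjoint 𝒪) (hP : 𝒞 ⊆ 𝒪)
    (hS : ∀ d, d ∈ S ↔ ∃ O ∈ 𝒞, O.Adj d.fst d.snd) {O : G.Subgraph} (hO : O ∈ 𝒞) {d : G.Dart}
    (hd : d ∈ S) (hdO : d.fst ∈ O.verts) : O.Adj d.fst d.snd := by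
  obtain ⟨O', hO', h'⟩ := (hS d).1 hd
  obtain rfl := eq_of_mem_verts hreg hcyc hdisj (hP hO) (hP hO') hdO h'.fst_mem
  exact h'

theorem sClosed_dart (hreg : IsRegular G 3) (hcyc : ∀ O ∈ 𝒪, IsCycleSG O)
    (hdisj : PairwiseEdgeDisjoint 𝒪) (hP : 𝒞 ⊆ 𝒪)
    (hS : ∀ d, d ∈ S ↔ ∃ O ∈ 𝒞, O.Adj d.fst d.snd) {O : G.Subgraph} (hO : O ∈ 𝒞) {A : Finset V}
    (hA : ∀ v, v ∈ A ↔ v ∈ O.verts) :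
    SClosed (fun d : G.Dart => d.fst) univ Dart.symm S A where
  sub := subset_univ _
  on v hv := by
    obtain ⟨w, hw⟩ := exists_adj_of_isCycleSG (hcyc O (hP hO)) ((hA v).1 hv)
    exact ⟨⟨(v, w), O.adj_sub hw⟩, (hS _).2 ⟨O, hO, hw⟩, rfl⟩
  closed d hd hdA := (hA _).2
    (adj_of_mem_verts hreg hcyc hdisj hP hS hO hd ((hA _).1 hdA)).snd_mem

theorem inst_dart (hconn : TwoEdgeConnected G) (hreg : IsRegular G 3)
    (hcyc : ∀ O ∈ 𝒪, IsCycleSG O) (hdisj : PairwiseEdgeDisjoint 𝒪)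
    (hcut : ∀ e f : Sym2 V, e ∈ G.edgeSet → f ∈ G.edgeSet → e ≠ f →
      ¬ (G.deleteEdges {e, f}).Connected →
      ∃ c : (G.deleteEdges {e, f}).ConnectedComponent,
        ∀ O ∈ 𝒪, O.edgeSet ⊆ (G.deleteEdges {e, f}).edgeSet ∧
          ∀ x ∈ O.verts, (G.deleteEdges {e, f}).connectedComponentMk x = c)
    (hP : 𝒞 ⊆ 𝒪) (hS : ∀ d, d ∈ S ↔ ∃ O ∈ 𝒞, O.Adj d.fst d.snd)
    (hh : ∀ O ∈ 𝒞, ∃ O₀ ∈ 𝒪, O₀ ≠ O ∧ O₀.Adj h.fst h.snd) :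
    Inst (fun d : G.Dart => d.fst) univ Dart.symm S h where
  cub := isCubic_dart hreg
  cut := cutGe_two_dart hconn
  reg := isTwoReg_dart hreg hcyc hdisj hP hS
  mem := mem_univ _
  notMem hmem := by
    obtain ⟨O, hO, h1⟩ := (hS h).1 hmem
    obtain ⟨O₀, hO₀, hne, h2⟩ := hh O hO
    exact hne (eq_of_mem_verts hreg hcyc hdisj hO₀ (hP hO) h2.fst_mem h1.fst_mem)
  c1 C hC hhC := by
    obtain ⟨d, hd, hdv⟩ := hC.on _ hhC
    obtain ⟨O, hO, h1⟩ := (hS d).1 hd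
    obtain ⟨O₀, hO₀, hne, h2⟩ := hh O hO
    exact absurd (eq_of_mem_verts hreg hcyc hdisj hO₀ (hP hO) h2.fst_mem (hdv ▸ h1.fst_mem)) hne
  c2 C hC Y hY hhY hYC _ := by
    by_contra! hlt
    obtain ⟨w, hw⟩ := hC.nonempty
    obtain ⟨d, hd, rfl⟩ := hC.on _ hw
    obtain ⟨O, hO, h1⟩ := (hS d).1 hd
    obtain ⟨O₀, hO₀, -, h2⟩ := hh O hO
    have hwY : d.fst ∉ Y := disjoint_right.1 hYC hw
    obtain ⟨y, hyY, hyO⟩ : ∃ y ∈ Y, y ∈ O₀.verts := by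
      rcases hhY with k | k
      exacts [⟨_, k, h2.fst_mem⟩, ⟨_, k, h2.snd_mem⟩]
    have hge := cutGe_two_dart hconn Y hY ⟨y, hyY⟩ (fun k => hwY (k ▸ mem_univ _))
    obtain ⟨d₁, d₂, hne, heq⟩ := card_eq_two.1
      (show #(dcut (fun d : G.Dart => d.fst) Dart.symm Y) = 2 by omega)
    have hm : ∀ x : G.Dart, x.fst ∈ Y ∧ x.snd ∉ Y ↔ x = d₁ ∨ x = d₂ := by
      intro x
      have := congrArg (x ∈ ·) heq
      simpa [mem_dcut] using this
    have hnr : ¬ (G.deleteEdges {d₁.edge, d₂.edge}).Reachable y d.fst := by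
      intro hr
      obtain ⟨x, k1, k2, k3⟩ := exists_dart_of_reachable (G.deleteEdges_le _) hr (X := Y) hyY hwY
      rcases (hm x).1 ⟨k1, k2⟩ with rfl | rfl <;> simp at k3
    obtain ⟨c, hc⟩ := hcut d₁.edge d₂.edge d₁.edge_mem d₂.edge_mem (fun k => by
      rcases dart_edge_eq_iff d₁ d₂ |>.1 k with k | k
      · exact hne k
      · have k1 := (hm d₁).2 (Or.inl rfl)
        have k2 := (hm d₂).2 (Or.inr rfl)
        rw [k] at k1
        exact k2.2 k1.1) (fun k => hnr (k.preconnected _ _))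
    exact hnr (ConnectedComponent.exact
      (((hc O₀ hO₀).2 y hyO).trans ((hc O (hP hO)).2 _ h1.fst_mem).symm))

theorem exists_isTFactor_one {F : Set G.Dart}
    (hF : IsPM (fun d : G.Dart => d.fst) univ Dart.symm F) :
    ∃ H : G.Subgraph, IsTFactor H 1 ∧ ∀ d ∈ F, H.Adj d.fst d.snd := by
  let H : G.Subgraph :=
    { verts := Set.univ
      Adj := fun v w => ∃ d ∈ F, d.fst = v ∧ d.snd = w
      adj_sub := by rintro _ _ ⟨d, -, rfl, rfl⟩; exact d.adj
      edge_vert := fun _ => Set.mem_univ _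
      symm := ⟨by
        rintro _ _ ⟨d, hd, rfl, rfl⟩
        exact ⟨d.symm, hF.symm d hd (mem_univ _), rfl, rfl⟩⟩ }
  refine ⟨H, ⟨fun v => Set.mem_univ v, fun v => ?_⟩, fun d hd => ⟨d, hd, rfl, rfl⟩⟩
  obtain ⟨d, hd, rfl⟩ := hF.ex v (mem_univ _)
  refine Set.ncard_eq_one.2 ⟨d.snd, Set.ext fun w => ?_⟩
  constructor
  · rintro ⟨e, he, h1, rfl⟩
    rw [hF.uniq e he d hd (mem_univ _) h1]
    rfl
  · rintro rfl
    exact ⟨d, hd, rfl, rfl⟩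

end

end

/-- In a 2-edge-connected cubic graph, if for every 2-edge-cut `{e, f}` all cycles of
`𝒪` are subgraphs of the same component of `G − {e, f}`, then there is a perfect
matching meeting every cycle of `𝒪`. -/
theorem stmt_9 {V : Type*} [Fintype V] (G : SimpleGraph V)
    (hconn : TwoEdgeConnected G) (hreg : IsRegular G 3)
    (𝒪 : Set G.Subgraph) (hcyc : ∀ O ∈ 𝒪, IsCycleSG O)
    (hdisj : PairwiseEdgeDisjoint 𝒪)
    (hcut : ∀ e f : Sym2 V, e ∈ G.edgeSet → f ∈ G.edgeSet → e ≠ f →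
      ¬ (G.deleteEdges {e, f}).Connected →
      ∃ c : (G.deleteEdges {e, f}).ConnectedComponent,
        ∀ O ∈ 𝒪, O.edgeSet ⊆ (G.deleteEdges {e, f}).edgeSet ∧
          ∀ x ∈ O.verts, (G.deleteEdges {e, f}).connectedComponentMk x = c) :
    ∃ F : G.Subgraph, IsTFactor F 1 ∧
      ∀ O ∈ 𝒪, (F.edgeSet ∩ O.edgeSet).Nonempty := by
  classical
  obtain ⟨h, hh⟩ : ∃ h : G.Dart, ∀ O ∈ 𝒪, O.Adj h.fst h.snd ∨
      ∃ O₀ ∈ 𝒪, O₀ ≠ O ∧ O₀.Adj h.fst h.snd := by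
    rcases 𝒪.eq_empty_or_nonempty with rfl | ⟨O₀, hO₀⟩
    · obtain ⟨v⟩ := hconn.1.nonempty
      have hv := hreg v
      obtain ⟨w, hw⟩ := Set.nonempty_of_ncard_ne_zero (s := G.neighborSet v) (by omega)
      exact ⟨⟨(v, w), hw⟩, fun O hO => absurd hO (Set.notMem_empty O)⟩
    · obtain ⟨v, hv⟩ := (hcyc O₀ hO₀).1.nonempty
      obtain ⟨w, hw⟩ := exists_adj_of_isCycleSG (hcyc O₀ hO₀) hv
      refine ⟨⟨(v, w), O₀.adj_sub hw⟩, fun O _ => ?_⟩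
      by_cases hO : O₀ = O
      · exact Or.inl (hO ▸ hw)
      · exact Or.inr ⟨O₀, hO₀, hO, hw⟩
  let 𝒞 : Set G.Subgraph := {O | O ∈ 𝒪 ∧ ¬ O.Adj h.fst h.snd}
  have hP : 𝒞 ⊆ 𝒪 := fun O hO => hO.1
  let S : Finset G.Dart := {d | ∃ O ∈ 𝒞, O.Adj d.fst d.snd}
  have hS : ∀ d, d ∈ S ↔ ∃ O ∈ 𝒞, O.Adj d.fst d.snd := fun d => by simp [S]
  have hI := inst_dart hconn hreg hcyc hdisj hcut hP hS
    (fun O hO => (hh O hO.1).resolve_left hO.2)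
  obtain ⟨F, hF, hhF, hC⟩ := Inst.good _ _ _ _ _ rfl hI
  obtain ⟨H, hH, hHF⟩ := exists_isTFactor_one hF
  refine ⟨H, hH, fun O hO => ?_⟩
  by_cases hOh : O.Adj h.fst h.snd
  · exact ⟨s(h.fst, h.snd), hHF h hhF, hOh⟩
  have hO' : O ∈ 𝒞 := ⟨hO, hOh⟩
  have hA := sClosed_dart hreg hcyc hdisj hP hS hO' (A := O.verts.toFinset)
    (fun v => Set.mem_toFinset)
  obtain ⟨v, hv⟩ := (hcyc O hO).1.nonempty
  obtain ⟨C, hCA, hCc⟩ := hA.exists_comp ⟨v, Set.mem_toFinset.2 hv⟩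
  obtain ⟨d, hdF, hdS, hdC⟩ := hC C hCc
  exact ⟨s(d.fst, d.snd), hHF d hdF,
    adj_of_mem_verts hreg hcyc hdisj hP hS hO' hdS (Set.mem_toFinset.1 (hCA hdC))⟩

end PaperFormalization
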